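/- There exists a constant C > 0 such that for every natural number m ≥ 1 and every finite field F of even order q, writing G = Sp_{2m}(F), there exists a subset A ⊆ G with |A| ≤ 2 such that the number of y ∈ G for which some x ∈ A makes {x, y} invariably generate G is at least (1 − 6/q − C·m^{−1/200}) · |G|. -/

import Mathlib

/-- `{x, y}` invariably generates `G`: for all `g, h`, the conjugates
`g * x * g⁻¹` and `h * y * h⁻¹` generate `G`. -/
def InvGen {G : Type*} [Group G] (x y : G) : Prop :=
  ∀ g h : G, Subgroup.closure {g * x * g⁻¹, h * y * h⁻¹} = ⊤

section
open scoped Classical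
open Finset (mem_filter univ mem_univ sum_congr sum_const card_univ sum_le_sum card_le_card mul_sum coe_filter mem_Icc sum_filter mem_biUnion mem_erase card_le_card_of_injOn mem_product mem_insert mem_image card_erase_of_mem sum_nonneg mem_range mem_insert_of_mem disjoint_left sum_mul_sum sum_le_sum_of_subset_of_nonneg sum_comm ne_of_mem_erase mem_insert_self card_union_le card_image_le card_filter_add_card_filter_not card_biUnion_le sum_product' sum_mul sum_biUnion prod_dvd_of_coprime mem_union mem_singleton mem_Ico filter_subset filter_eq_empty_iff card_le_univ card_le_mul_card_image_of_maps_to card_image_of_injective)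
open LinearMap (range BilinForm mulRight mulLeftRight mulLeft comp_apply mul_apply' smulRight_apply restrictScalars_apply)
open Module (finrank natCard_eq_pow_finrank finite_of_finite Dual End)
open Algebra (lmul adjoin smul_def coe_lmul_eq_mul algebraMap_eq_smul_one adjoin_induction)
open Nat (card_eq_fintype_card one_le_pow pow_le_pow_right one_lt_pow card_congr cast_nonneg pow_le_pow_left cast_sum cast_le card_le_card_of_injective Coprime pow_right_injective exists_eq_succ_of_ne_zero eq_of_mul_eq_mul_left cast_sub)
open AdjoinRoot (root mk_surjective mk_eq_zero aeval_eq algHomOfDvd algHomOfDvd_root)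
open Fintype (one_lt_card card_pos ofFinite card_subtype)
open Units (val_mul inv_mul val_pow_eq_pow_val)
open Set (mem_ofPred_eq toFinite)
open CharTwo (neg_eq two_eq_zero)
open Function (Surjective Injective)
open LinearEquiv (symm_apply_apply apply_symm_apply trans_apply)
open Submodule (subset_span finrank_mono finrank_le span_induction mem_top mem_bot)
open Matrix (mulVec_mulVec toLinearMap₂')
open UniqueFactorizationMonoid (normalizedFactors)
open Multiset (toFinset_card_le)
open Fintype renaming card → fcd
open CharTwo renaming add_self_eq_zero → cse
open Module.End renaming mul_apply → ema
open LinearMap renaming add_apply → laa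
open LinearMap renaming sub_apply → lsa
open LinearMap renaming smul_apply → lma
set_option linter.all false

structure QM (F A : Type*) [Field F] [CommRing A] [Algebra F A] where
  σ : A →ₐ[F] A
  lam : A →ₗ[F] F
  Q : A → F
  inv : ∀ a, σ (σ a) = a
  lam_fix : ∀ c, c + σ c = 0 → lam c = 0
  nondeg : ∀ a, (∀ b, lam (a * b) = 0) → a = 0
  red : ∀ a, a * σ a = 0 → a + σ a = 0 → a = 0
  Q_add : ∀ a b, Q (a + b) = Q a + Q b + lam (a * σ b)
  Q_smul : ∀ (c : F) a, Q (c • a) = c ^ 2 * Q a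
  Q_mul : ∀ a b, b * σ b = 1 → Q (b * a) = Q a

namespace QM

variable {F A : Type*} [Field F] [CommRing A] [Algebra F A] (D : QM F A)

def B : A →ₗ[F] A →ₗ[F] F :=
  LinearMap.mk₂ F (fun a b => D.lam (a * D.σ b))
    (fun a b c => by simp [add_mul]) (fun c a b => by simp)
    (fun a b c => by simp [mul_add]) (fun c a b => by simp)

lemma B_apply (a b : A) : D.B a b = D.lam (a * D.σ b) := rfl

lemma B_mul (c a b : A) : D.B (c * a) b = D.B a (D.σ c * b) := by
  simp only [B_apply, map_mul, D.inv]; congr 1; ring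

def IsT (τ : A) : Prop := τ * D.σ τ = 1

variable {D} in
lemma IsT.mul {a b : A} (ha : D.IsT a) (hb : D.IsT b) : D.IsT (a * b) := by
  unfold IsT at *; rw [map_mul]; linear_combination ha + (a * D.σ a) * hb - (a * D.σ a - 1)

variable {D} in
lemma IsT.star {a : A} (ha : D.IsT a) : D.IsT (D.σ a) := by
  unfold IsT at *; rw [D.inv, mul_comm]; exact ha

lemma isT_one : D.IsT 1 := by simp [IsT]

variable {D} in
lemma IsT.isUnit {a : A} (ha : D.IsT a) : IsUnit a := .of_mul_eq_one _ ha

lemma B_T {τ : A} (h : D.IsT τ) (a b : A) : D.B (τ * a) (τ * b) = D.B a b := by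
  rw [B_mul, ← mul_assoc, mul_comm (D.σ τ), h, one_mul]

variable [CharP A 2]

lemma lam_σ (a : A) : D.lam (D.σ a) = D.lam a := by
  have := D.lam_fix (a - D.σ a) (by rw [map_sub, D.inv]; ring)
  rw [map_sub] at this; exact (sub_eq_zero.1 this).symm

lemma B_symm (a b : A) : D.B a b = D.B b a := by
  rw [B_apply, ← D.lam_σ, B_apply, map_mul, D.inv, mul_comm]

lemma B_self (a : A) : D.B a a = 0 := by
  rw [B_apply]; apply D.lam_fix
  rw [map_mul, D.inv, mul_comm (D.σ a)]; exact cse _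

lemma Q_add' (a b : A) : D.Q (a + b) = D.Q a + D.Q b + D.B a b := D.Q_add a b

lemma B_nondeg (a : A) (h : ∀ b, D.B a b = 0) : a = 0 :=
  D.nondeg a fun b => by have := h (D.σ b); rwa [B_apply, D.inv] at this

/-- every element with nonzero norm is a unit -/
def IsX : Prop := ∀ a : A, a * D.σ a = 0 ∨ IsUnit a

variable {D}

lemma IsT.sub_isUnit (hX : D.IsX) {a b : A} (ha : D.IsT a) (hb : D.IsT b) (h : a ≠ b) :
    IsUnit (a - b) := by
  rcases hX (a - b) with h0 | h0
  swap; · exact h0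
  exfalso
  have ha' : a * D.σ a = 1 := ha
  have hb' : b * D.σ b = 1 := hb
  have h2 : (2 : A) = 0 := two_eq_zero
  rw [map_sub] at h0
  have hc := D.red (a * D.σ b - 1) (by
    rw [map_sub, map_mul, D.inv, map_one]
    linear_combination h0 + (a * D.σ a - 1) * hb' ) (by
    rw [map_sub, map_mul, D.inv, map_one]
    linear_combination -h0 + ha' + hb')
  apply h
  linear_combination b * hc - (a) * hb'

lemma T_quad (hX : D.IsX) {a b c d : A} (ha : D.IsT a) (hb : D.IsT b) (hc : D.IsT c)
    (hd : D.IsT d) (h : a + b = c + d) : (a = b ∧ c = d) ∨ (c = a ∧ d = b) ∨ (c = b ∧ d = a) := by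
  have h2 : (2 : A) = 0 := two_eq_zero
  by_cases hab : a = b
  · left; refine ⟨hab, ?_⟩
    subst hab
    linear_combination - h + (a - d) * h2
  right
  have hs := congrArg D.σ h
  rw [map_add, map_add] at hs
  have hu := ha.sub_isUnit hX hb hab
  have ha' : a * D.σ a = 1 := ha
  have hb' : b * D.σ b = 1 := hb
  have hc' : c * D.σ c = 1 := hc
  have hd' : d * D.σ d = 1 := hd
  have key : (a - b) * (c * d - a * b) = 0 := by
    have e1 : (a + b) * (c * d - a * b) = 0 := by
      linear_combination (-a*b) * h + (a*b*c*d) * hs - (b*c*d) * ha' - (a*c*d)*hb' + (a*b*d)*hc' + (a*b*c) * hd'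
    linear_combination e1 - b * (c * d - a * b) * h2
  have key2 : c * d = a * b := by
    have := hu.mul_right_eq_zero.1 key
    linear_combination this
  have key3 : (c - a) * (c - b) = 0 := by linear_combination -c * h - key2
  by_cases hca : c = a
  · left; exact ⟨hca, by linear_combination -h - hca⟩
  · right
    have := (hc.sub_isUnit hX ha hca).mul_right_eq_zero.1 key3
    have hcb : c = b := by linear_combination this
    exact ⟨hcb, by linear_combination -h - hcb⟩

variable (D)
variable [Fintype A]

noncomputable def Tf : Finset A := univ.filter D.IsT

lemma mem_Tf {a : A} : a ∈ D.Tf ↔ D.IsT a := by simp [Tf]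

noncomputable def S (ψ : AddChar A ℂ) : ℂ := ∑ τ ∈ D.Tf, ψ τ

lemma S_shift (ψ : AddChar A ℂ) {τ : A} (h : D.IsT τ) : D.S (ψ.mulShift τ) = D.S ψ := by
  unfold S
  simp only [AddChar.mulShift_apply]
  refine Finset.sum_bij (fun a _ => τ * a) ?_ ?_ ?_ ?_
  · intro a ha; rw [mem_Tf] at *; exact h.mul ha
  · intro a _ b _ hab; exact h.isUnit.mul_left_cancel hab
  · intro b hb; rw [mem_Tf] at hb
    refine ⟨D.σ τ * b, by rw [mem_Tf]; exact h.star.mul hb, ?_⟩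
    rw [← mul_assoc, h, one_mul]
  · intros; rfl

variable {D}

lemma quad_card (hX : D.IsX) :
    ((((D.Tf ×ˢ D.Tf) ×ˢ (D.Tf ×ˢ D.Tf)).filter
      (fun p => p.1.1 + p.1.2 - (p.2.1 + p.2.2) = 0)).card) ≤ 3 * D.Tf.card ^ 2 := by
  have : ((D.Tf ×ˢ D.Tf) ×ˢ (D.Tf ×ˢ D.Tf)).filter
      (fun p => p.1.1 + p.1.2 - (p.2.1 + p.2.2) = 0) ⊆
      ((D.Tf ×ˢ D.Tf).image (fun p => ((p.1, p.1), (p.2, p.2)))) ∪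
      (((D.Tf ×ˢ D.Tf).image (fun p => ((p.1, p.2), (p.1, p.2)))) ∪
      ((D.Tf ×ˢ D.Tf).image (fun p => ((p.1, p.2), (p.2, p.1))))) := by
    rintro ⟨⟨a, b⟩, ⟨c, d⟩⟩ hp
    simp only [mem_filter, mem_product, mem_Tf] at hp
    obtain ⟨⟨⟨ha, hb⟩, hc, hd⟩, h⟩ := hp
    simp only [mem_union, mem_image, mem_product, mem_Tf, Prod.mk.injEq,
      Prod.exists]
    rcases T_quad hX ha hb hc hd (sub_eq_zero.1 h) with ⟨rfl, rfl⟩ | ⟨rfl, rfl⟩ | ⟨rfl, rfl⟩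
    · left; exact ⟨a, c, ⟨ha, hc⟩, ⟨rfl, rfl⟩, rfl, rfl⟩
    · right; left; exact ⟨_, _, ⟨ha, hb⟩, ⟨rfl, rfl⟩, rfl, rfl⟩
    · right; right; exact ⟨_, _, ⟨ha, hb⟩, ⟨rfl, rfl⟩, rfl, rfl⟩
  refine (card_le_card this).trans ((card_union_le _ _).trans ?_)
  have h1 := card_image_le (s := D.Tf ×ˢ D.Tf) (f := fun p => ((p.1, p.1), (p.2, p.2)))
  have h2 := card_image_le (s := D.Tf ×ˢ D.Tf) (f := fun p => ((p.1, p.2), (p.1, p.2)))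
  have h3 := card_image_le (s := D.Tf ×ˢ D.Tf) (f := fun p => ((p.1, p.2), (p.2, p.1)))
  have h4 := card_union_le ((D.Tf ×ˢ D.Tf).image (fun p => ((p.1, p.2), (p.1, p.2))))
     ((D.Tf ×ˢ D.Tf).image (fun p => ((p.1, p.2), (p.2, p.1))))
  rw [Finset.card_product] at h1 h2 h3
  nlinarith

lemma fourth_moment (hX : D.IsX) :
    ∑ ψ : AddChar A ℂ, ‖D.S ψ‖ ^ 4 ≤ 3 * (D.Tf.card : ℝ) ^ 2 * fcd A := by
  have e : ∀ ψ : AddChar A ℂ, ((‖D.S ψ‖ ^ 4 : ℝ) : ℂ) =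
      ∑ p ∈ (D.Tf ×ˢ D.Tf) ×ˢ (D.Tf ×ˢ D.Tf), ψ (p.1.1 + p.1.2 - (p.2.1 + p.2.2)) := by
    intro ψ
    have : ((‖D.S ψ‖ ^ 4 : ℝ) : ℂ) = (D.S ψ * D.S ψ) * ((starRingEnd ℂ) (D.S ψ) * (starRingEnd ℂ) (D.S ψ)) := by
      push_cast
      have := Complex.mul_conj' (D.S ψ)
      linear_combination (-(D.S ψ * (starRingEnd ℂ) (D.S ψ)) - ‖D.S ψ‖^2) * this
    rw [this, Finset.sum_product, S, map_sum, sum_mul_sum, sum_mul_sum,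
      ← sum_product', ← sum_product', sum_mul_sum]
    refine sum_congr rfl fun p _ => sum_congr rfl fun r _ => ?_
    rw [sub_eq_add_neg, AddChar.map_add_eq_mul, AddChar.map_add_eq_mul, neg_add,
      AddChar.map_add_eq_mul, AddChar.map_neg_eq_conj, AddChar.map_neg_eq_conj]
  have : ((∑ ψ : AddChar A ℂ, ‖D.S ψ‖ ^ 4 : ℝ) : ℂ) =
     ((((((D.Tf ×ˢ D.Tf) ×ˢ (D.Tf ×ˢ D.Tf)).filter
      (fun p => p.1.1 + p.1.2 - (p.2.1 + p.2.2) = 0)).card) * (fcd A) : ℝ) : ℂ) := by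
    rw [Complex.ofReal_sum, sum_congr rfl (fun ψ _ => e ψ), sum_comm]
    rw [sum_congr rfl (fun p _ => AddChar.sum_apply_eq_ite _), ← sum_filter]
    simp
  rw [Complex.ofReal_inj.1 this]
  have := quad_card hX
  have h2 : ((((((D.Tf ×ˢ D.Tf) ×ˢ (D.Tf ×ˢ D.Tf)).filter
      (fun p => p.1.1 + p.1.2 - (p.2.1 + p.2.2) = 0)).card) : ℕ) : ℝ) ≤ 3 * (D.Tf.card : ℝ) ^ 2 := by
    exact_mod_cast this
  gcongr

lemma S_bound (hX : D.IsX) (ψ : AddChar A ℂ) (hψ : ψ ≠ 1) :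
    ‖D.S ψ‖ ^ 4 ≤ 3 * (D.Tf.card : ℝ) * fcd A := by
  have hpos : 0 < D.Tf.card := Finset.card_pos.2 ⟨1, (D.mem_Tf).2 D.isT_one⟩
  have h1 : (D.Tf.card : ℝ) * ‖D.S ψ‖ ^ 4 ≤ ∑ ψ : AddChar A ℂ, ‖D.S ψ‖ ^ 4 := by
    have hinj : Set.InjOn (fun τ => ψ.mulShift τ) (D.Tf : Set A) := by
      intro a ha b hb hab
      by_contra hne
      have hu := IsT.sub_isUnit hX ((D.mem_Tf).1 ha) ((D.mem_Tf).1 hb) hne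
      apply hψ
      rw [← AddChar.mulShift_unit_eq_one_iff ψ hu]
      ext x
      have := DFunLike.congr_fun hab x
      simp only [AddChar.mulShift_apply] at this
      rw [AddChar.mulShift_apply, sub_mul, AddChar.map_sub_eq_div, this]
      simp [(AddChar.val_isUnit ψ _).ne_zero]
    calc (D.Tf.card : ℝ) * ‖D.S ψ‖ ^ 4 = ∑ χ ∈ D.Tf.image (fun τ => ψ.mulShift τ), ‖D.S χ‖ ^ 4 := by
          rw [Finset.sum_image hinj, sum_congr rfl (g := fun _ => ‖D.S ψ‖ ^ 4), sum_const, nsmul_eq_mul]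
          intro τ hτ; rw [S_shift D ψ ((D.mem_Tf).1 hτ)]
      _ ≤ _ := sum_le_sum_of_subset_of_nonneg (Finset.subset_univ _) (fun _ _ _ => by positivity)
  have h2 := h1.trans (fourth_moment hX)
  have hp : (0:ℝ) < D.Tf.card := by exact_mod_cast hpos
  have : (D.Tf.card : ℝ) * ‖D.S ψ‖ ^ 4 ≤ (D.Tf.card : ℝ) * (3 * (D.Tf.card : ℝ) * fcd A) := by
    linarith
  exact le_of_mul_le_mul_left this hp

/-- weak density -/
lemma WD (hX : D.IsX) (hA : fcd A ≤ (D.Tf.card + 1) ^ 2) {N : ℕ} (hN : 3 ≤ N)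
    (hNt : N ^ 8 ≤ D.Tf.card) {X : Type*} [AddCommGroup X] [Finite X] (hXN : Nat.card X ≤ N)
    (f : A →+ X) (hf : Surjective f) (x : X) :
    N ^ 6 ≤ (D.Tf.filter (fun τ => f τ = x)).card := by
  have := ofFinite X
  rw [card_eq_fintype_card] at hXN
  set c := (D.Tf.filter (fun τ => f τ = x)).card with hc
  set i := fcd X with hi
  by_contra hlt
  push Not at hlt
  set t := D.Tf.card with ht
  have hi0 : 0 < i := card_pos
  have e1 : ((i * c : ℝ) : ℂ) = ∑ ψ : AddChar X ℂ, ψ (-x) * D.S (ψ.compAddMonoidHom f) := by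
    unfold S
    simp only [mul_sum]
    rw [sum_comm]
    have : ∀ τ ∈ D.Tf, ∑ ψ : AddChar X ℂ, ψ (-x) * (ψ.compAddMonoidHom f) τ = if f τ = x then (i : ℂ) else 0 := by
      intro τ _
      simp only [AddChar.compAddMonoidHom_apply, ← AddChar.map_add_eq_mul]
      rw [AddChar.sum_apply_eq_ite, neg_add_eq_zero]
      simp only [eq_comm, hi]
    rw [sum_congr rfl this, ← sum_filter, sum_const, nsmul_eq_mul, ← hc]
    push_cast; ring
  rw [← Finset.add_sum_erase _ _ (mem_univ (1 : AddChar X ℂ))] at e1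
  have e2 : D.S ((1 : AddChar X ℂ).compAddMonoidHom f) = t := by
    simp [S, ht]
  rw [e2, AddChar.one_apply, one_mul] at e1
  obtain ⟨w, hw0, hw⟩ : ∃ w : ℝ, 0 ≤ w ∧ w ^ 4 = 3 * (t : ℝ) * fcd A := by
    refine ⟨(3 * (t : ℝ) * fcd A) ^ ((1:ℝ)/4), by positivity, ?_⟩
    rw [← Real.rpow_natCast, ← Real.rpow_mul (by positivity)]; norm_num
  have e3 : ‖∑ ψ ∈ univ.erase (1 : AddChar X ℂ), ψ (-x) * D.S (ψ.compAddMonoidHom f)‖ ≤ i * w := by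
    refine (norm_sum_le _ _).trans ?_
    have : ∀ ψ ∈ univ.erase (1 : AddChar X ℂ), ‖ψ (-x) * D.S (ψ.compAddMonoidHom f)‖ ≤ w := by
      intro ψ hψ
      rw [norm_mul, AddChar.norm_apply, one_mul]
      have hne : ψ.compAddMonoidHom f ≠ 1 := by
        intro h
        apply (mem_erase.1 hψ).1
        exact AddChar.compAddMonoidHom_injective_left f hf (h.trans (by ext; simp))
      have := S_bound hX _ hne
      rw [← hw] at this
      exact le_of_pow_le_pow_left₀ (by norm_num) hw0 this
    refine (Finset.sum_le_card_nsmul _ _ _ this).trans ?_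
    rw [nsmul_eq_mul]
    gcongr
    refine (card_le_univ _).trans ?_
    rw [AddChar.card_eq]
  have e4 : (t : ℝ) ≤ i * c + i * w := by
    have : (t : ℂ) = ((i * c : ℝ) : ℂ) - ∑ ψ ∈ univ.erase (1 : AddChar X ℂ), ψ (-x) * D.S (ψ.compAddMonoidHom f) := by
      rw [e1]; ring
    have h5 : ‖(t : ℂ)‖ ≤ ‖((i * c : ℝ) : ℂ)‖ + i * w := by
      rw [this]; exact (norm_sub_le _ _).trans (add_le_add le_rfl e3)
    have h6 : (0:ℝ) ≤ i * c := mul_nonneg (cast_nonneg _) (cast_nonneg _)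
    rw [Complex.norm_natCast, Complex.norm_real, Real.norm_of_nonneg h6] at h5
    exact h5
  have hNr : (3:ℝ) ≤ N := by exact_mod_cast hN
  have hir : (i:ℝ) ≤ N := by exact_mod_cast hXN
  have hcr : (c:ℝ) ≤ N ^ 6 := by exact_mod_cast hlt.le
  have htr : (N:ℝ) ^ 8 ≤ t := by exact_mod_cast hNt
  have hAr : (fcd A : ℝ) ≤ (t + 1) ^ 2 := by exact_mod_cast hA
  have e5 : (t : ℝ) ≤ N * N ^ 6 + N * w := e4.trans (by gcongr)
  have e6 : 2 * (t : ℝ) ≤ 3 * (N * w) := by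
    have : 3 * (N:ℝ)^7 ≤ t := by
      calc 3 * (N:ℝ)^7 ≤ N * N ^ 7 := by gcongr
        _ = (N:ℝ) ^ 8 := by ring
        _ ≤ (t:ℝ) := htr
    nlinarith
  have e7 : (2 * (t : ℝ)) ^ 4 ≤ (3 * (N * w)) ^ 4 := by gcongr
  have e8 : (81:ℝ) * N ^ 4 ≤ t := by
    calc (81:ℝ) * N ^ 4 = (3:ℝ) ^ 4 * (N:ℝ) ^ 4 := by norm_num
      _ ≤ (N:ℝ) ^ 4 * (N:ℝ) ^ 4 := by gcongr
      _ = (N:ℝ) ^ 8 := by ring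
      _ ≤ (t:ℝ) := htr
  have e9 : (16 : ℝ) * t ^ 4 ≤ t * w ^ 4 := by
    calc (16 : ℝ) * t ^ 4 = (2 * (t : ℝ)) ^ 4 := by ring
      _ ≤ (3 * (N * w)) ^ 4 := e7
      _ = (81 * N ^ 4) * w ^ 4 := by ring
      _ ≤ t * w ^ 4 := by gcongr
  rw [hw] at e9
  have ht1 : (1:ℝ) ≤ t := by nlinarith [pow_pos (by linarith : (0:ℝ) < N) 4, one_le_pow₀ (n := 4) (by linarith : (1:ℝ) ≤ N)]
  have e10 : (t:ℝ) * (3 * t * fcd A) ≤ t * (3 * t * (t+1)^2) := by gcongr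
  have e11 : (t + 1 : ℝ) ^ 2 ≤ 4 * t ^ 2 := by nlinarith
  have e12 : (t:ℝ) * (3 * t * (t+1)^2) ≤ t * (3 * t * (4 * t^2)) := by gcongr
  have : (0:ℝ) < t ^ 4 := by positivity
  nlinarith

end QM

namespace QM
variable {F A : Type*} [Field F] [CommRing A] [Algebra F A] {D : QM F A}
variable [CharP A 2] [Fintype A] [Fintype F]

/-- standing numerical hypotheses -/
structure Num (D : QM F A) (N N0 : ℕ) : Prop where
  hX : D.IsX
  hA : fcd A ≤ (D.Tf.card + 1) ^ 2
  hN : 3 ≤ N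
  hNt : N ^ 8 ≤ D.Tf.card
  hN0 : 2 ≤ N0
  hq : 2 * fcd F ^ 4 * N0 ≤ N

lemma pair_lemma {N N0 : ℕ} (hn : Num D N N0) {X1 X0 : Type*} [AddCommGroup X1] [Module F X1]
    [Finite X1] [AddCommGroup X0] [Module F X0] [Finite X0] (h1 : Nat.card X1 ≤ N0)
    (h0 : Nat.card X0 ≤ N0) (f1 : A →ₗ[F] X1) (f0 : A →ₗ[F] X0)
    (hf1 : Surjective f1) (hf0 : Surjective f0) (x : X1) :
    ∃ τ, D.IsT τ ∧ f1 τ = x ∧ ∀ u v, ∃ a, f1 a = u ∧ f0 (D.σ τ * a) = v := by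
  by_contra hcon
  push Not at hcon
  have hle : N0 ≤ N := by
    have := hn.hq
    have hq : 1 ≤ fcd F ^ 4 := one_le_pow _ _ card_pos
    nlinarith
  have hWD := WD hn.hX hn.hA hn.hN hn.hNt (h1.trans hle) f1.toAddMonoidHom hf1 x
  have key : ∀ τ, D.IsT τ → f1 τ = x → ∃ g : Dual F (X1 × X0), g ≠ 0 ∧
      ∀ a, g (f1 a, f0 (D.σ τ * a)) = 0 := by
    intro τ hτ hx
    obtain ⟨u, v, huv⟩ := hcon τ hτ hx
    let φ : A →ₗ[F] X1 × X0 := f1.prod (f0 ∘ₗ mulLeft F (D.σ τ))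
    have hlt : range φ < ⊤ := by
      rw [lt_top_iff_ne_top]
      intro htop
      obtain ⟨a, ha⟩ := LinearMap.range_eq_top.1 htop (u, v)
      have ha' := Prod.ext_iff.1 ha
      exact huv a ha'.1 ha'.2
    obtain ⟨g, hg0, hg⟩ := Submodule.exists_le_ker_of_lt_top _ hlt
    exact ⟨g, hg0, fun a => hg ⟨a, rfl⟩⟩
  choose! g hg0 hg using key
  have : Finite (Dual F (X1 × X0)) := finite_of_finite F
  have := ofFinite (Dual F (X1 × X0))
  have hcard : (D.Tf.filter (fun τ => f1 τ = x)).card ≤ fcd (Dual F (X1 × X0)) := by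
    rw [← card_univ]
    refine card_le_card_of_injOn g (by intro _ _; simp) ?_
    intro τ hτ τ' hτ' heq
    simp only [coe_filter, mem_ofPred_eq, mem_Tf] at hτ hτ'
    by_contra hne
    have hne' : D.σ τ ≠ D.σ τ' := fun h => hne (by rw [← D.inv τ, h, D.inv])
    have hu := IsT.sub_isUnit hn.hX hτ.1.star hτ'.1.star hne'
    apply hg0 τ hτ.1 hτ.2
    have hv : ∀ v, g τ (0, v) = 0 := by
      intro v
      obtain ⟨b, rfl⟩ := hf0 v
      obtain ⟨a, rfl⟩ := hu.dvd (a := b)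
      have e1 := hg τ hτ.1 hτ.2 a
      have e2 := hg τ' hτ'.1 hτ'.2 a
      rw [← heq] at e2
      have := congrArg₂ (· - ·) e1 e2
      simp only [← map_sub, Prod.mk_sub_mk, sub_self] at this
      rw [sub_mul]; exact this
    ext u
    · obtain ⟨a, rfl⟩ := hf1 u
      have e1 := hg τ hτ.1 hτ.2 a
      have : (f1 a, f0 (D.σ τ * a)) = (f1 a, 0) + (0, f0 (D.σ τ * a)) := by simp
      rw [this, map_add, hv, add_zero] at e1
      simpa using e1
    · simpa using hv u
  have hc2 : fcd (Dual F (X1 × X0)) ≤ N0 * N0 := by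
    have := ofFinite (X1 × X0)
    have : Module.Finite F (X1 × X0) := Module.Finite.of_finite
    rw [Module.card_eq_pow_finrank (K := F), Subspace.dual_finrank_eq, ← Module.card_eq_pow_finrank,
      ← card_eq_fintype_card, Nat.card_prod]
    exact Nat.mul_le_mul h1 h0
  have h3 : N ^ 6 ≤ N0 * N0 := hWD.trans (hcard.trans hc2)
  have h4 : N0 * N0 ≤ N * N := Nat.mul_le_mul hle hle
  have h5 := hn.hN
  have : N * N * 1 < N * N * N ^ 4 := by
    apply Nat.mul_lt_mul_of_pos_left _ (by nlinarith)
    exact one_lt_pow (by norm_num) (by omega)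
  nlinarith


noncomputable def mT (τ : A) (h : D.IsT τ) : (End F A)ˣ :=
  ⟨lmul F A τ, lmul F A (D.σ τ),
    by rw [← map_mul, h, map_one], by rw [← map_mul, mul_comm, h, map_one]⟩

/-- standing hypothesis on the group -/
structure Grp (D : QM F A) (H : Subgroup (End F A)ˣ) : Prop where
  iso : ∀ h ∈ H, ∀ x y, D.B ((h : End F A) x) ((h : End F A) y) = D.B x y
  T : ∀ τ (h : D.IsT τ), mT τ h ∈ H

/-- small elements -/
structure Sm (D : QM F A) (H : Subgroup (End F A)ˣ) (e : End F A)
    (Zs : Set (End F A)ˣ) (N0 : ℕ) : Prop where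
  ee : e * e = e
  adj : ∀ x y, D.B (e x) y = D.B x (e y)
  sub : ∀ z ∈ Zs, z ∈ H
  eZ : ∀ z ∈ Zs, e * ((z : End F A) - 1) = (z : End F A) - 1
  Ze : ∀ z ∈ Zs, ((z : End F A) - 1) * e = (z : End F A) - 1
  card : Nat.card (range (mulLeftRight F (e, e))) ≤ N0
  gen : adjoin F (Set.range (lmul F A) ∪ (fun z : (End F A)ˣ => (z : End F A)) '' Zs) = ⊤

variable {H : Subgroup (End F A)ˣ} {e : End F A} {Zs : Set (End F A)ˣ}
  {N N0 : ℕ}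

noncomputable def Mm (e h : End F A) : A →ₗ[F] End F A :=
  mulLeftRight F (e * h, e) ∘ₗ (lmul F A).toLinearMap

lemma Mm_apply (e h : End F A) (a : A) : Mm e h a = e * h * lmul F A a * e := rfl

lemma Mm_card (hS : Sm D H e Zs N0) (h : End F A) :
    Nat.card (range (Mm e h)) ≤ N0 := by
  have hfin : Finite (End F A) := finite_of_finite F
  refine le_trans ?_ hS.card
  apply Nat.card_mono (toFinite _)
  rintro _ ⟨a, rfl⟩
  exact ⟨h * lmul F A a, by simp [Mm_apply, mul_assoc]⟩

theorem S1 (hn : Num D N N0) (hG : Grp D H) (hS : Sm D H e Zs N0) :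
    ∃ h ∈ H, ∀ X : End F A, ∃ a, e * h * lmul F A a * e = e * X * e := by
  have hfin : Finite (End F A) := finite_of_finite F
  obtain ⟨h, hH, hmax⟩ : ∃ h ∈ H, ∀ g ∈ H, Nat.card (range (Mm e g.1)) ≤
      Nat.card (range (Mm e h.1)) :=
    Set.exists_max_image (H : Set (End F A)ˣ) (fun g => Nat.card (range (Mm e g.1)))
      (toFinite _) ⟨1, H.one_mem⟩
  refine ⟨h, hH, ?_⟩
  set M := range (Mm e h.1) with hM
  set L := lmul F A with hL
  -- key closure
  have key : ∀ P ∈ M, ∀ z ∈ Zs, ∀ b, P * ((z : End F A) - 1) * (e * L b * e) ∈ M := by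
    intro P hP z hz b
    obtain ⟨τ, hτ, hx, hs⟩ := pair_lemma hn (Mm_card hS h.1) (Mm_card hS 1) (Mm e h.1).rangeRestrict
      (Mm e 1).rangeRestrict (LinearMap.surjective_rangeRestrict _)
      (LinearMap.surjective_rangeRestrict _) ⟨P, hP⟩
    have hx' : e * h * L τ * e = P := congrArg Subtype.val hx
    set g := h * mT τ hτ * z * (mT τ hτ)⁻¹ with hg
    have hgH : g ∈ H := H.mul_mem (H.mul_mem (H.mul_mem hH (hG.T τ hτ)) (hS.sub z hz)) (H.inv_mem (hG.T τ hτ))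
    have hform : ∀ a, Mm e g.1 a = Mm e h.1 a + P * ((z : End F A) - 1) * (Mm e 1 (D.σ τ * a)) := by
      intro a
      simp only [Mm_apply, ← hx', mul_one]
      have h1 : (g : End F A) = h * L τ * z * L (D.σ τ) := rfl
      have h2 : L τ * L (D.σ τ) = 1 := by rw [← map_mul, hτ, map_one]
      have h3 : (z : End F A) = 1 + e * ((z : End F A) - 1) * e := by
        rw [hS.eZ z hz, hS.Ze z hz]; abel
      have h4 : e * h * L τ * e * ((z : End F A) - 1) * (e * L (D.σ τ * a) * e)
         = e * h * L τ * (e * ((z : End F A) - 1) * e) * (L (D.σ τ) * L a) * e := by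
         rw [map_mul]; simp only [mul_assoc]
      rw [h1, ← hL, h4]
      conv_lhs => rw [h3]
      have h5 : e * (↑h * L τ * (1 + e * ((z : End F A) - 1) * e) * L (D.σ τ)) * L a * e
        = e * h * (L τ * L (D.σ τ)) * L a * e + e * h * L τ * (e * ((z : End F A) - 1) * e) * (L (D.σ τ) * L a) * e := by
        noncomm_ring
      rw [h5, h2, mul_one]
    have hsub : M ≤ range (Mm e g.1) := by
      rintro u hu
      obtain ⟨a, ha1, ha0⟩ := hs ⟨u, hu⟩ 0
      refine ⟨a, ?_⟩
      rw [hform]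
      have e1 : Mm e h.1 a = u := congrArg Subtype.val ha1
      have e2 : Mm e 1 (D.σ τ * a) = 0 := congrArg Subtype.val ha0
      rw [e1, e2, mul_zero, add_zero]
    have heq : M = range (Mm e g.1) := by
      apply SetLike.coe_injective
      refine Set.eq_of_subset_of_ncard_le hsub ?_ (toFinite _)
      exact hmax g hgH
    rw [heq]
    obtain ⟨a, ha1, ha0⟩ := hs 0 ⟨Mm e 1 b, ⟨b, rfl⟩⟩
    refine ⟨a, ?_⟩
    have e1 : Mm e h.1 a = 0 := congrArg Subtype.val ha1
    have e2 : Mm e 1 (D.σ τ * a) = Mm e 1 b := congrArg Subtype.val ha0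
    rw [hform, e1, e2, zero_add, Mm_apply, mul_one]
  let R : Submodule F (End F A) := Submodule.span F
    ({Y | ∃ a, Y = e * h * L a} ∪ {Y | ∃ P ∈ M, ∃ z ∈ Zs, ∃ a, Y = P * ((z : End F A) - 1) * L a})
  have hgenA : ∀ a, ∀ Y ∈ R, Y * L a ∈ R := by
    intro a Y hY
    induction hY using span_induction with
    | mem Y hY =>
      rcases hY with ⟨b, rfl⟩ | ⟨P, hP, z, hz, b, rfl⟩
      · apply subset_span; left; exact ⟨b * a, by rw [map_mul]; simp only [mul_assoc]⟩
      · apply subset_span; right; exact ⟨P, hP, z, hz, b * a, by rw [map_mul]; simp only [mul_assoc]⟩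
    | zero => simp
    | add x y _ _ hx hy => rw [add_mul]; exact R.add_mem hx hy
    | smul c x _ hx => rw [smul_mul_assoc]; exact R.smul_mem c hx
  have hgenz : ∀ z ∈ Zs, ∀ Y ∈ R, Y * ((z : End F A) - 1) ∈ R := by
    intro z hz Y hY
    have hz1 : ∀ X : End F A, X * ((z : End F A) - 1) = X * e * ((z : End F A) - 1) * L 1 := by
      intro X; rw [mul_assoc X, hS.eZ z hz, map_one, mul_one]
    induction hY using span_induction with
    | mem Y hY =>
      rw [hz1]
      rcases hY with ⟨b, rfl⟩ | ⟨P, hP, z', hz', b, rfl⟩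
      · apply subset_span; right; exact ⟨_, ⟨b, rfl⟩, z, hz, 1, rfl⟩
      · apply subset_span; right
        refine ⟨_, key P hP z' hz' b, z, hz, 1, ?_⟩
        have := hS.Ze z' hz'
        rw [← mul_assoc, ← mul_assoc, mul_assoc P _ e, this]
    | zero => simp
    | add x y _ _ hx hy => rw [add_mul]; exact R.add_mem hx hy
    | smul c x _ hx => rw [smul_mul_assoc]; exact R.smul_mem c hx
  let Sg : Subalgebra F (End F A) :=
    { carrier := {Y | ∀ X ∈ R, X * Y ∈ R}
      mul_mem' := by intro a b ha hb X hX; rw [← mul_assoc]; exact hb _ (ha _ hX)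
      add_mem' := by intro a b ha hb X hX; rw [mul_add]; exact R.add_mem (ha _ hX) (hb _ hX)
      algebraMap_mem' := by
        intro c X hX; rw [algebraMap_eq_smul_one, mul_smul_comm, mul_one]; exact R.smul_mem c hX }
  have htop : Sg = ⊤ := by
    rw [eq_top_iff, ← hS.gen]
    apply Algebra.adjoin_le
    rintro _ (⟨a, rfl⟩ | ⟨z, hz, rfl⟩)
    · exact hgenA a
    · intro X hX
      have : X * (z : End F A) = X + X * ((z : End F A) - 1) := by rw [mul_sub, mul_one]; abel
      change X * (z : End F A) ∈ R
      rw [this]; exact R.add_mem hX (hgenz z hz X hX)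
  intro X
  have h1 : e * X ∈ R := by
    have : e * h * L 1 ∈ R := subset_span (Or.inl ⟨1, rfl⟩)
    have h2 : (↑h⁻¹ * X : End F A) ∈ Sg := by rw [htop]; trivial
    have h3 := h2 _ this
    rw [map_one, mul_one] at h3
    have h4 : e * (h : End F A) * (↑h⁻¹ * X) = e * X := by
      rw [mul_assoc, ← mul_assoc (h : End F A), Units.mul_inv, one_mul]
    rwa [h4] at h3
  have h2 : ∀ Y ∈ R, Y * e ∈ M := by
    intro Y hY
    induction hY using span_induction with
    | mem Y hY =>
      rcases hY with ⟨b, rfl⟩ | ⟨P, hP, z, hz, b, rfl⟩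
      · exact ⟨b, rfl⟩
      · have := key P hP z hz b
        have h3 := hS.Ze z hz
        have h4 : P * ((z : End F A) - 1) * (e * L b * e) = P * ((z : End F A) - 1) * L b * e := by
          rw [← mul_assoc, ← mul_assoc, mul_assoc P _ e, h3]
        rwa [h4] at this
    | zero => simp
    | add x y _ _ hx hy => rw [add_mul]; exact M.add_mem hx hy
    | smul c x _ hx => rw [smul_mul_assoc]; exact M.smul_mem c hx
  obtain ⟨a, ha⟩ := h2 _ h1
  exact ⟨a, ha⟩

end QM

namespace QM
variable {F A : Type*} [Field F] [CommRing A] [Algebra F A] {D : QM F A}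
variable [CharP A 2] [CharP F 2] [Fintype A] [Fintype F]
variable {H : Subgroup (End F A)ˣ} {e : End F A} {Zs : Set (End F A)ˣ}
  {N N0 : ℕ}

lemma Num.WD' (hn : Num D N N0) (W : AddSubgroup A) (hW : W.index ≤ N) (a : A) :
    N ^ 6 ≤ (D.Tf.filter (fun τ => τ - a ∈ W)).card := by
  have := WD hn.hX hn.hA hn.hN hn.hNt (X := A ⧸ W) hW (QuotientAddGroup.mk' W)
    (QuotientAddGroup.mk'_surjective W) (a : A ⧸ W)
  convert this using 5 with τ
  simp only [QuotientAddGroup.mk'_apply]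
  rw [← sub_eq_zero, ← QuotientAddGroup.mk_sub, QuotientAddGroup.eq_zero_iff]

lemma Num.WD1 (hn : Num D N N0) (W : AddSubgroup A) (hW : W.index ≤ N) (a : A) :
    ∃ τ, D.IsT τ ∧ τ - a ∈ W := by
  have h1 := hn.WD' W hW a
  have h2 := hn.hN
  have : 0 < N ^ 6 := by positivity
  obtain ⟨τ, hτ⟩ := Finset.card_pos.1 (this.trans_le h1)
  rw [mem_filter, mem_Tf] at hτ
  exact ⟨τ, hτ⟩

lemma Num.WDgen (hn : Num D N N0) (W : AddSubgroup A) (hW : W.index * 2 ≤ N) (a : A)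
    (G : AddSubgroup A) (hG : ∀ τ τ', D.IsT τ → D.IsT τ' → τ - a ∈ W → τ' - a ∈ W → τ - τ' ∈ G) :
    W ≤ G := by
  intro c hc
  by_contra hcG
  letI : Algebra (ZMod 2) A := ZMod.algebra A 2
  obtain ⟨f, hf, hfG⟩ := Submodule.exists_le_ker_of_notMem
    (p := AddSubgroup.toZModSubmodule 2 G) (v := c) hcG
  have h2 : (W ⊓ f.toAddMonoidHom.ker).index ≤ N := by
    refine AddSubgroup.index_inf_le.trans (le_trans (Nat.mul_le_mul_left _ ?_) hW)
    rw [AddSubgroup.index_ker]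
    refine (card_le_card_of_injective _ (Subtype.val_injective)).trans ?_
    simp
  obtain ⟨τ, hτ, h1⟩ := hn.WD1 _ h2 a
  obtain ⟨τ', hτ', h1'⟩ := hn.WD1 _ h2 (a + c)
  have := hfG (hG τ τ' hτ hτ' h1.1 (by
    have := W.add_mem h1'.1 hc
    rwa [show τ' - (a + c) + c = τ' - a by ring] at this))
  have e1 : f (τ - a) = 0 := h1.2
  have e2 : f (τ' - (a + c)) = 0 := h1'.2
  have e3 : f (τ - τ') = 0 := this
  apply hf
  rw [show c = (τ - a) - (τ' - (a + c)) - (τ - τ') by ring, map_sub, map_sub, e1, e2, e3]; simp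

variable (D) in
noncomputable def Et (a b : A) (l : F) : End F A :=
  1 + (D.B b).smulRight a + (D.B a).smulRight b + l • (D.B a).smulRight a

lemma Et_apply (a b : A) (l : F) (v : A) :
    D.Et a b l v = v + D.B b v • a + D.B a v • b + (l * D.B a v) • a := by
  simp [Et, mul_smul]

variable (D) in
def EH (H : Subgroup (End F A)ˣ) (a b : A) (l : F) : Prop :=
  ∃ g ∈ H, (g : End F A) = D.Et a b l

lemma F2 (x : F) : x + x = 0 := cse x
lemma A2 (x : A) : x + x = 0 := cse x

lemma Et_mul (a b b' : A) (l l' : F) (h : D.B a b = 0) (h' : D.B a b' = 0) :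
    D.Et a b l * D.Et a b' l' = D.Et a (b + b') (l + l' + D.B b b') := by
  ext v
  have h1 := D.B_self a
  have h2 : D.B b a = 0 := by rw [D.B_symm]; exact h
  simp only [End.mul_apply, Et_apply, map_add, map_smul, h, h', h1, h2, laa, smul_eq_mul]
  module

lemma EH.mul {a b b' : A} {l l' : F} (h1 : D.EH H a b l) (h2 : D.EH H a b' l') (h : D.B a b = 0)
    (h' : D.B a b' = 0) : D.EH H a (b + b') (l + l' + D.B b b') := by
  obtain ⟨g, hg, e1⟩ := h1
  obtain ⟨g', hg', e2⟩ := h2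
  exact ⟨g * g', H.mul_mem hg hg', by rw [val_mul, e1, e2, Et_mul a b b' l l' h h']⟩

lemma Et_zero (a : A) : D.Et a 0 0 = 1 := by ext v; simp [Et_apply]

lemma comm_E (z g : (End F A)ˣ)
    (hz : ∀ x y, D.B ((z : End F A) x) ((z : End F A) y) = D.B x y)
    (hg : ∀ x y, D.B ((g : End F A) x) ((g : End F A) y) = D.B x y)
    (adj : ∀ x y, D.B (e x) y = D.B x (e y))
    (eZ : e * ((z : End F A) - 1) = (z : End F A) - 1)
    (Ze : ((z : End F A) - 1) * e = (z : End F A) - 1)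
    (p p' : A) (hW : ∀ v, e ((g : End F A) (e v)) = D.B p' v • p)
    (h0 : D.B p' ((z : End F A) p') = 0) (a b : A)
    (ha : a = ((z : End F A) - 1) p')
    (hb : b = ((g⁻¹ : (End F A)ˣ) : End F A) (((z : End F A) - 1) p)) :
    D.Et a b (D.B p ((z : End F A) p)) * ((z * (g⁻¹ * z * g) : (End F A)ˣ) : End F A)
      = ((g⁻¹ * z * g * z : (End F A)ˣ) : End F A) ∧ D.B a b = 0 := by
  set Z : End F A := (z : End F A) - 1 with hZ
  set gi : End F A := ((g⁻¹ : (End F A)ˣ) : End F A) with hgi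
  have gg : ∀ v, gi ((g : End F A) v) = v := fun v => by
    rw [← End.mul_apply, hgi, inv_mul]; rfl
  have gg' : ∀ v, (g : End F A) (gi v) = v := fun v => by
    rw [← End.mul_apply, hgi, Units.mul_inv]; rfl
  have eZ' : ∀ v, e (Z v) = Z v := fun v => by rw [← End.mul_apply, eZ]
  have Ze' : ∀ v, Z (e v) = Z v := fun v => by rw [← End.mul_apply, Ze]
  have zv : ∀ v, (z : End F A) v = v + Z v := fun v => by rw [hZ]; simp
  have hgi' : ∀ x y, D.B (gi x) y = D.B x ((g : End F A) y) := fun x y => by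
    rw [← hg, gg']
  have f1 : ∀ v, Z ((g : End F A) (Z v)) = D.B p' (Z v) • Z p := fun v => by
    rw [← Ze', ← eZ' v, hW, map_smul, eZ']
  have w2 : ∀ u, e (gi (e u)) = D.B p u • p' := fun u => by
    rw [← sub_eq_zero]
    apply D.B_nondeg
    intro y
    rw [map_sub, lsa, adj, hgi', adj, hW, map_smul, map_smul, lma, D.B_symm u p, smul_eq_mul, smul_eq_mul]
    ring
  have f2 : ∀ v, Z (gi (Z v)) = D.B p (Z v) • Z p' := fun v => by
    rw [← Ze', ← eZ' v, w2, map_smul, eZ']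
  have hexp : ∀ x y, D.B x (Z y) + D.B (Z x) y + D.B (Z x) (Z y) = 0 := fun x y => by
    have := hz x y
    rw [zv, zv, map_add, map_add, laa, laa] at this
    linear_combination this
  have f3 : ∀ x y, D.B (Z x) y = D.B ((z : End F A) x) (Z y) := fun x y => by
    rw [zv, map_add, laa]
    linear_combination hexp x y - F2 (D.B x (Z y) + D.B (Z x) (Z y))
  have f4 : ∀ x y, D.B (Z x) ((z : End F A) y) = D.B x (Z y) := fun x y => by
    rw [zv, map_add]
    linear_combination hexp x y - F2 (D.B x (Z y))
  have h00 : D.B p' (Z p') = 0 := by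
    rw [zv, map_add, D.B_self, zero_add] at h0; exact h0
  have hk : D.B ((z : End F A) p) (Z p) = D.B p ((z : End F A) p) := by
    rw [← f3, D.B_symm, zv, map_add, D.B_self, zero_add]
  have c1 : ∀ v, D.B a ((z : End F A) (gi ((z : End F A) ((g : End F A) v)))) = D.B p' (Z v) := by
    intro v
    rw [ha, f4, zv, map_add, gg, map_add, f2, map_add, map_smul, h00]; simp
  have c1' : ∀ v, D.B p' (Z (gi ((z : End F A) ((g : End F A) v)))) = D.B p' (Z v) := by
    intro v; rw [← f4, ← ha, c1]
  have c2 : ∀ v, D.B b ((z : End F A) (gi ((z : End F A) ((g : End F A) v)))) =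
      D.B p (Z ((g : End F A) v)) + D.B p' (Z v) * D.B p ((z : End F A) p) := by
    intro v
    have e1 : D.B b (gi ((z : End F A) ((g : End F A) v))) = D.B p (Z ((g : End F A) v)) := by
      rw [hb, hgi', gg', f4]
    rw [zv, map_add, e1, hb, hgi', f3, f1, map_smul, hk, c1', smul_eq_mul]
  constructor
  · ext v
    simp only [val_mul, End.mul_apply, Et_apply, ← hgi]
    rw [c1, c2]
    have r1 : (z : End F A) (gi ((z : End F A) ((g : End F A) v)))
        = v + gi (Z ((g : End F A) v)) + Z v + D.B p (Z ((g : End F A) v)) • a := by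
      rw [zv (gi _), zv ((g : End F A) v), map_add gi, gg, map_add Z, f2, ha]; abel
    have r2 : gi ((z : End F A) ((g : End F A) ((z : End F A) v)))
        = v + Z v + gi (Z ((g : End F A) v)) + D.B p' (Z v) • b := by
      rw [zv v, map_add (g : End F A), zv, map_add Z, f1, map_add, map_add, gg, gg, map_add gi, map_smul gi, ← hb]
      abel
    rw [r1, r2]
    have hF := F2 (D.B p (Z ((g : End F A) v)))
    have hF2 := F2 (D.B p' (Z v) * D.B p ((z : End F A) p))
    have : ∀ (x y : A) (s t k r : F), s + s = 0 → r + r = 0 → x + s • a + (s + r) • a + t • b + r • a = x + t • b := by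
      intro x y s t k r hs hr
      have : x + s • a + (s + r) • a + t • b + r • a = x + t • b + ((s + s) + (r + r)) • a := by module
      rw [this, hs, hr]; simp
    rw [mul_comm (D.B p ((z : End F A) p)), this _ 0 _ _ 0 _ hF hF2]; abel
  · rw [ha, f3, hb, f2, map_smul, ← f3, D.B_symm (Z p') p', h00]; simp

end QM

namespace QM
variable {F A : Type*} [Field F] [CommRing A] [Algebra F A] {D : QM F A}
variable [CharP A 2] [CharP F 2] [Fintype A] [Fintype F]
variable {H : Subgroup (End F A)ˣ} {e : End F A} {Zs : Set (End F A)ˣ}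
  {N N0 : ℕ}

lemma nonunit_perp {a b : A} (ha : a * D.σ a = 0) (hb : b * D.σ b = 0)
    (hab : (a + b) * D.σ (a + b) = 0) : D.B a b = 0 := by
  rw [B_apply]; apply D.lam_fix
  rw [map_mul, D.inv]
  rw [map_add] at hab
  linear_combination hab - ha - hb

lemma u_inv (g : (End F A)ˣ) (v : A) :
    ((g⁻¹ : (End F A)ˣ) : End F A) ((g : End F A) v) = v := by
  rw [← End.mul_apply, inv_mul]; rfl
lemma u_inv' (g : (End F A)ˣ) (v : A) :
    (g : End F A) (((g⁻¹ : (End F A)ˣ) : End F A) v) = v := by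
  rw [← End.mul_apply, Units.mul_inv]; rfl

lemma H_of_eq {X : End F A} {u w : (End F A)ˣ} (hu : u ∈ H) (hw : w ∈ H)
    (h : X * (u : End F A) = w) : ∃ g ∈ H, (g : End F A) = X :=
  ⟨w * u⁻¹, H.mul_mem hw (H.inv_mem hu), by
    rw [val_mul, ← h, mul_assoc, Units.mul_inv, mul_one]⟩

variable (D) in
def Gd (H : Subgroup (End F A)ˣ) (N0 : ℕ) (a : A) : Prop :=
  a ≠ 0 ∧ ∃ C : Submodule F A, C.toAddSubgroup.index ≤ N0 ∧
    ∀ b ∈ C, D.B a b = 0 ∧ ∃ l, D.EH H a b l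

lemma Num.two_le (hn : Num D N N0) : N0 * 2 ≤ N := by
  have := hn.hq
  have hq : 1 ≤ fcd F ^ 4 := one_le_pow _ _ card_pos
  nlinarith [Nat.mul_le_mul_right N0 hq]

theorem S2 (hn : Num D N N0) (hG : Grp D H) (hS : Sm D H e Zs N0) (z : (End F A)ˣ)
    (hz : z ∈ Zs) (hz2 : z * z ≠ 1) (p' : A) (hp' : e p' = p')
    (h0 : D.B p' ((z : End F A) p') = 0) (hne : (z : End F A) p' ≠ p') :
    ∃ a, D.Gd H N0 a := by
  obtain ⟨h, hH, hh⟩ := S1 hn hG hS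
  set Z : End F A := (z : End F A) - 1 with hZ
  set hi : End F A := ((h⁻¹ : (End F A)ˣ) : End F A) with hhi
  have zv : ∀ v, (z : End F A) v = v + Z v := fun v => by rw [hZ]; simp
  have hzi := hG.iso z (hS.sub z hz)
  have hii : ∀ x y, D.B (hi x) (hi y) = D.B x y := hG.iso _ (H.inv_mem hH)
  obtain ⟨p0, hp0⟩ : ∃ p, IsUnit (hi (Z p)) := by
    by_contra hcon
    push Not at hcon
    have hN : ∀ p, hi (Z p) * D.σ (hi (Z p)) = 0 := fun p => (hn.hX _).resolve_right (hcon p)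
    have hperp : ∀ x y, D.B (Z x) (Z y) = 0 := by
      intro x y
      rw [← hii]
      apply nonunit_perp (hN x) (hN y)
      rw [← map_add, ← map_add]; exact hN _
    apply hz2
    apply Units.ext
    ext v
    rw [val_mul, End.mul_apply, Units.val_one, End.one_apply, ← sub_eq_zero]
    apply D.B_nondeg
    intro y
    obtain ⟨y, rfl⟩ : ∃ y', (z : End F A) y' = y := ⟨_, u_inv' z y⟩
    have h1 := hzi v y
    rw [map_sub, lsa, hzi]
    simp only [zv, map_add, laa, hperp] at h1 ⊢
    linear_combination -h1 + F2 (D.B (Z v) y)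
  set p := e p0 with hp
  have Zp : Z p = Z p0 := by rw [hp, ← End.mul_apply, hS.Ze z hz]
  have ep : e p = p := by rw [hp, ← End.mul_apply, hS.ee]
  set β := hi (Z p) with hβ
  have hβu : IsUnit β := by rw [hβ, Zp]; exact hp0
  obtain ⟨a1, ha1⟩ := hh ((D.B p').smulRight p)
  set a := Z p' with ha
  set W := (LinearMap.ker (Mm e h.1)) with hWdef
  have hWi : W.toAddSubgroup.index ≤ N0 := by
    have : W.toAddSubgroup = (Mm e h.1).toAddMonoidHom.ker := rfl
    rw [this, AddSubgroup.index_ker]; exact Mm_card hS h.1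
  have hmain : ∀ τ, D.IsT τ → τ - a1 ∈ W → D.B a (D.σ τ * β) = 0 ∧ ∃ l, D.EH H a (D.σ τ * β) l := by
    intro τ hτ hτW
    have e1 : e * h * lmul F A τ * e = e * ((D.B p').smulRight p) * e := by
      rw [← ha1]; rw [hWdef, LinearMap.sub_mem_ker_iff] at hτW; exact hτW
    have hgH := H.mul_mem hH (hG.T τ hτ)
    obtain ⟨c1, c2⟩ := comm_E z (h * mT τ hτ) hzi (hG.iso _ hgH) hS.adj (hS.eZ z hz) (hS.Ze z hz) p p'
      (by
        intro v
        have := LinearMap.congr_fun e1 v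
        simp only [End.mul_apply, smulRight_apply, map_smul, ep, ← hS.adj, hp'] at this
        exact this) h0 a (D.σ τ * β) rfl (by
        rw [mul_inv_rev, val_mul, End.mul_apply]; rfl)
    refine ⟨c2, _, H_of_eq ?_ ?_ c1⟩
    · exact H.mul_mem (hS.sub z hz) (H.mul_mem (H.mul_mem (H.inv_mem hgH) (hS.sub z hz)) hgH)
    · exact H.mul_mem (H.mul_mem (H.mul_mem (H.inv_mem hgH) (hS.sub z hz)) hgH) (hS.sub z hz)
  let Γ : AddSubgroup A :=
    { carrier := {c | D.B a (D.σ c * β) = 0 ∧ ∃ l, D.EH H a (D.σ c * β) l}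
      zero_mem' := by
        refine ⟨by simp, 0, 1, H.one_mem, ?_⟩
        simp [Et_zero]
      add_mem' := by
        rintro c c' ⟨h1, l, h2⟩ ⟨h1', l', h2'⟩
        have h3 := h2.mul h2' h1 h1'
        rw [← add_mul, ← map_add] at h3
        exact ⟨by rw [map_add, add_mul, map_add, h1, h1', add_zero], _, h3⟩
      neg_mem' := by
        intro c hc; rw [neg_eq]; exact hc }
  have hle := hn.WDgen W.toAddSubgroup ((Nat.mul_le_mul_right 2 hWi).trans hn.two_le) a1 Γ (by
    intro τ τ' hτ hτ' h1 h2
    exact Γ.sub_mem (hmain τ hτ h1) (hmain τ' hτ' h2))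
  obtain ⟨βu, hβu'⟩ := hβu
  refine ⟨a, ?_, W.comap (D.σ.toLinearMap ∘ₗ (mulLeft F (↑βu⁻¹ : A))), ?_, ?_⟩
  · rw [ha, hZ]; simpa [sub_eq_zero] using hne
  · refine le_trans (le_of_eq ?_) hWi
    refine AddSubgroup.index_comap_of_surjective W.toAddSubgroup
      (f := (D.σ.toLinearMap ∘ₗ (mulLeft F (↑βu⁻¹ : A))).toAddMonoidHom) ?_
    intro y
    refine ⟨βu * D.σ y, ?_⟩
    simp [D.inv]
  · intro b hb
    have := hle hb
    have e1 : D.σ ((D.σ.toLinearMap ∘ₗ (mulLeft F (↑βu⁻¹ : A))) b) * β = b := by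
      rw [← hβu', comp_apply, AlgHom.toLinearMap_apply, D.inv, LinearMap.mulLeft_apply,
        mul_right_comm, inv_mul, one_mul]
    have h2 : D.B a (D.σ ((D.σ.toLinearMap ∘ₗ (mulLeft F (↑βu⁻¹ : A))) b) * β) = 0 ∧
      ∃ l, D.EH H a (D.σ ((D.σ.toLinearMap ∘ₗ (mulLeft F (↑βu⁻¹ : A))) b) * β) l := this
    rwa [e1] at h2

lemma Et_conj (g : (End F A)ˣ)
    (hg : ∀ x y, D.B ((g : End F A) x) ((g : End F A) y) = D.B x y) (a b : A) (l : F) :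
    D.Et ((g : End F A) a) ((g : End F A) b) l * (g : End F A) =
      (g : End F A) * D.Et a b l := by
  ext v; simp [Et_apply, hg]

lemma EH.conj (hG : Grp D H) {a b : A} {l : F} (h : D.EH H a b l) {g : (End F A)ˣ} (hg : g ∈ H) :
    D.EH H ((g : End F A) a) ((g : End F A) b) l := by
  obtain ⟨u, hu, hu'⟩ := h
  refine H_of_eq hg (H.mul_mem hg hu) ?_
  rw [Et_conj g (hG.iso g hg), val_mul, hu']

lemma Gd.conj (hG : Grp D H) {a : A} (h : D.Gd H N0 a) {g : (End F A)ˣ} (hg : g ∈ H) :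
    D.Gd H N0 ((g : End F A) a) := by
  obtain ⟨h0, C, hC, h1⟩ := h
  refine ⟨fun h => h0 ?_, C.comap ((g⁻¹ : (End F A)ˣ) : End F A), ?_, ?_⟩
  · rw [← u_inv g a, h, map_zero]
  · refine le_trans (le_of_eq ?_) hC
    refine AddSubgroup.index_comap_of_surjective C.toAddSubgroup
      (f := ((g⁻¹ : (End F A)ˣ) : End F A).toAddMonoidHom) ?_
    intro y; exact ⟨_, u_inv g y⟩
  · intro b hb
    obtain ⟨h2, l, h3⟩ := h1 _ hb
    have h4 := h3.conj hG hg
    rw [u_inv'] at h4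
    refine ⟨?_, l, h4⟩
    rw [← u_inv' g b, hG.iso g hg]; exact h2

lemma exists_pair (W1 W2 : Submodule F A)
    (h : W1.toAddSubgroup.index * W2.toAddSubgroup.index < Nat.card A) :
    ∃ w1 ∈ W1, ∃ w2 ∈ W2, D.B w1 w2 = 1 := by
  by_contra hcon
  push Not at hcon
  have h0 : ∀ w1 ∈ W1, ∀ w2 ∈ W2, D.B w1 w2 = 0 := by
    intro w1 h1 w2 h2
    by_contra hne
    apply hcon ((D.B w1 w2)⁻¹ • w1) (W1.smul_mem _ h1) w2 h2
    rw [map_smul, lma, smul_eq_mul, inv_mul_cancel₀ hne]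
  have : Module.Finite F A := Module.Finite.of_finite
  have hnd : BilinForm.Nondegenerate (D.B : BilinForm F A) := by
    constructor
    · intro x hx; exact D.B_nondeg x hx
    · intro x hx; exact D.B_nondeg x (fun b => by rw [D.B_symm]; exact hx b)
  have h1 := BilinForm.finrank_orthogonal hnd W2
  have hle : W1 ≤ BilinForm.orthogonal (D.B : BilinForm F A) W2 := by
    intro w1 hw1 w2 hw2
    change D.B w2 w1 = 0
    rw [D.B_symm]; exact h0 _ hw1 _ hw2
  have h2 := finrank_mono hle
  have h3 := finrank_le W2
  have c1 := Submodule.finrank_quotient_add_finrank W1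
  have c2 := Submodule.finrank_quotient_add_finrank W2
  have k1 : ∀ W : Submodule F A, W.toAddSubgroup.index = fcd F ^ (finrank F (A ⧸ W)) := by
    intro W
    have : W.toAddSubgroup.index = Nat.card (A ⧸ W) := rfl
    rw [this, natCard_eq_pow_finrank (K := F), card_eq_fintype_card]
  rw [k1, k1, natCard_eq_pow_finrank (K := F) (V := A), card_eq_fintype_card, ← pow_add] at h
  have h4 := (Nat.pow_lt_pow_iff_right (one_lt_card (α := F))).1 h
  omega

lemma index_kerB (a : A) : (LinearMap.ker (D.B a)).toAddSubgroup.index ≤ fcd F := by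
  have : (LinearMap.ker (D.B a)).toAddSubgroup = (D.B a).toAddMonoidHom.ker := rfl
  rw [this, AddSubgroup.index_ker, ← card_eq_fintype_card]
  exact card_le_card_of_injective _ Subtype.val_injective

lemma Num.lt_card (hn : Num D N N0) : N ^ 2 < Nat.card A := by
  have h1 := hn.hNt
  have h2 : D.Tf.card ≤ fcd A := card_le_univ _
  rw [card_eq_fintype_card]
  have : N ^ 2 < N ^ 8 := Nat.pow_lt_pow_right (by have := hn.hN; omega) (by norm_num)
  omega

lemma Num.q_le (hn : Num D N N0) : N0 * fcd F ^ 3 * 2 ≤ N := by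
  have := hn.hq
  have hq : 1 ≤ fcd F := card_pos
  have : N0 * fcd F ^ 3 * 2 ≤ 2 * fcd F ^ 4 * N0 := by
    calc _ = 2 * N0 * fcd F ^ 3 * 1 := by ring
      _ ≤ 2 * N0 * fcd F ^ 3 * fcd F := by gcongr
      _ = _ := by ring
  omega

lemma Num.q_le' (hn : Num D N N0) : N0 * fcd F ≤ N := by
  have := hn.q_le
  have hq : 1 ≤ fcd F := card_pos
  have : N0 * fcd F * 1 ≤ N0 * fcd F * (fcd F ^ 2 * 2) := by
    apply Nat.mul_le_mul_left; nlinarith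
  nlinarith

lemma Gd.swap (hn : Num D N N0) {a a' : A} (h : D.Gd H N0 a) (h' : D.Gd H N0 a')
    (haa : D.B a a' = 0) : D.EH H a a' 0 := by
  obtain ⟨h0, C, hC, h1⟩ := h
  obtain ⟨h0', C', hC', h1'⟩ := h'
  have i1 : ∀ (C : Submodule F A) (a : A), C.toAddSubgroup.index ≤ N0 → (C ⊓ LinearMap.ker (D.B a)).toAddSubgroup.index ≤ N := by
    intro C a hC
    exact (AddSubgroup.index_inf_le (H := C.toAddSubgroup) (K := (LinearMap.ker (D.B a)).toAddSubgroup)).trans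
      ((Nat.mul_le_mul hC (index_kerB a)).trans hn.q_le')
  obtain ⟨b, hb, b', hb', hbb⟩ := exists_pair (D := D) (C ⊓ LinearMap.ker (D.B a')) (C' ⊓ LinearMap.ker (D.B a))
    (lt_of_le_of_lt (by rw [sq]; exact Nat.mul_le_mul (i1 C a' hC) (i1 C' a hC')) hn.lt_card)
  obtain ⟨k1, l, x, hx, ex⟩ := h1 b hb.1
  obtain ⟨k1', l', x', hx', ex'⟩ := h1' b' hb'.1
  have k2 : D.B a' b = 0 := hb.2
  have k2' : D.B a b' = 0 := hb'.2
  refine H_of_eq (H.mul_mem hx' hx) (H.mul_mem hx hx') ?_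
  rw [val_mul, val_mul, ex, ex']
  have q1 := D.B_self a
  have q2 := D.B_self a'
  have q3 : D.B a' a = 0 := by rw [D.B_symm]; exact haa
  have q4 : D.B b a = 0 := by rw [D.B_symm]; exact k1
  have q5 : D.B b a' = 0 := by rw [D.B_symm]; exact k2
  have q6 : D.B b' a = 0 := by rw [D.B_symm]; exact k2'
  have q7 : D.B b' a' = 0 := by rw [D.B_symm]; exact k1'
  have q8 : D.B b' b = 1 := by rw [D.B_symm]; exact hbb
  ext v
  simp only [End.mul_apply, Et_apply, map_add, map_smul, smul_eq_mul, q1, q2, q3, q4, q5, q6, q7, q8, k1, k1', k2, k2', haa, hbb]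
  have : (D.B a v • a' + D.B a v • a') = 0 := A2 _
  have e2 : (2:F) = 0 := two_eq_zero
  linear_combination (norm := module) this

end QM

namespace QM
variable {F A : Type*} [Field F] [CommRing A] [Algebra F A] {D : QM F A}
variable [CharP A 2] [CharP F 2] [Fintype A] [Fintype F]
variable {H : Subgroup (End F A)ˣ} {e : End F A} {Zs : Set (End F A)ˣ}
  {N N0 : ℕ}

lemma tr_unit (hX : D.IsX) {a : A} (h0 : a ≠ 0) (ha : a * D.σ a = 0) : IsUnit (a + D.σ a) := by
  rcases hX (a + D.σ a) with h | h
  swap; · exact h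
  exfalso; apply h0; apply D.red a ha
  apply D.red _ h
  rw [map_add, D.inv]; linear_combination A2 (a + D.σ a)

lemma T_of_ideal (hX : D.IsX) {a c : A} (h0 : a ≠ 0) (ha : a * D.σ a = 0) (hc : c * a ≠ 0) :
    ∃ τ, D.IsT τ ∧ τ * a = c * a := by
  obtain ⟨s, hs⟩ := tr_unit hX h0 ha
  have hsσ : D.σ (s : A) = s := by rw [hs, map_add, D.inv, add_comm]
  have hsi : D.σ (↑s⁻¹ : A) = ↑s⁻¹ := by
    have h1 : (s : A) * D.σ (↑s⁻¹ : A) = 1 := by rw [← hsσ, ← map_mul, Units.mul_inv, map_one]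
    calc D.σ (↑s⁻¹ : A) = (↑s⁻¹ * s) * D.σ (↑s⁻¹ : A) := by rw [inv_mul, one_mul]
      _ = _ := by rw [mul_assoc, h1, mul_one]
  have hsm : (s : A) * ↑s⁻¹ = 1 := Units.mul_inv s
  generalize (↑s⁻¹ : A) = r at *
  have hae : a * a = s * a := by rw [hs]; linear_combination -ha
  have hx0 : c * (a * r) ≠ 0 := fun h => hc (by linear_combination s * h - c * a * hsm)
  have hxN : c * (a * r) * D.σ (c * (a * r)) = 0 := by
    rw [map_mul, map_mul]; linear_combination c * r * D.σ c * D.σ r * ha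
  obtain ⟨t, ht⟩ := tr_unit hX hx0 hxN
  have htσ : D.σ (t : A) = t := by rw [ht, map_add, D.inv, add_comm]
  have hti : D.σ (↑t⁻¹ : A) = ↑t⁻¹ := by
    have h1 : (t : A) * D.σ (↑t⁻¹ : A) = 1 := by rw [← htσ, ← map_mul, Units.mul_inv, map_one]
    calc D.σ (↑t⁻¹ : A) = (↑t⁻¹ * t) * D.σ (↑t⁻¹ : A) := by rw [inv_mul, one_mul]
      _ = _ := by rw [mul_assoc, h1, mul_one]
  have htm : (t : A) * ↑t⁻¹ = 1 := Units.mul_inv t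
  generalize (↑t⁻¹ : A) = w at *
  rw [map_mul, map_mul, hsi] at ht
  have hae' : D.σ a * D.σ a = s * D.σ a := by
    have := congrArg D.σ hae; rwa [map_mul, map_mul, hsσ] at this
  refine ⟨c * (a * r) + D.σ (a * r) * w, ?_, ?_⟩
  · unfold IsT
    simp only [map_add, map_mul, D.inv, hsi, hti]
    linear_combination htm - w * ht + r * r * D.σ c * c * ha + w * w * r * r * ha + c * r * r * w * hae + D.σ c * r * r * w * hae' + (c * a * r * w + D.σ c * D.σ a * r * w) * hsm
  · rw [map_mul, hsi]
    linear_combination r * w * ha + c * r * hae + c * a * hsm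

lemma range_small (hn : Num D N N0) (hS : Sm D H e Zs N0) (z : (End F A)ˣ) (hz : z ∈ Zs) (a : A) :
    ∃ τ, D.IsT τ ∧ (z : End F A) (τ * a) = τ * a := by
  have hfin : Finite (End F A) := finite_of_finite F
  set Z := (z : End F A) - 1 with hZ
  suffices h : ∃ τ, D.IsT τ ∧ Z (τ * a) = 0 by
    obtain ⟨τ, h1, h2⟩ := h
    refine ⟨τ, h1, ?_⟩
    rw [hZ, lsa, sub_eq_zero] at h2; exact h2
  by_cases he : ∃ p, e p ≠ 0
  swap
  · push Not at he
    refine ⟨1, D.isT_one, ?_⟩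
    rw [hZ, ← hS.Ze z hz, End.mul_apply, he, map_zero]
  obtain ⟨p, hp⟩ := he
  obtain ⟨b, hb⟩ : ∃ b, D.B (e p) b ≠ 0 := by
    by_contra hc; push Not at hc; exact hp (D.B_nondeg _ hc)
  let f : A →+ A := (Z ∘ₗ mulRight F a).toAddMonoidHom
  have hf : ∀ c, f c = Z (c * a) := fun c => rfl
  have hle : f.ker.index ≤ N := by
    rw [AddSubgroup.index_ker]
    refine le_trans ?_ ((le_mul_of_one_le_right (Nat.zero_le _) (by norm_num)).trans hn.two_le)
    refine le_trans ?_ hS.card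
    have hr : ∀ x : f.range, e x = x := by
      rintro ⟨_, c, rfl⟩
      change e (Z (c * a)) = Z (c * a)
      rw [← End.mul_apply, hS.eZ z hz]
    refine card_le_card_of_injective (β := range (mulLeftRight F (e, e)))
      (fun x => ⟨e * (D.B b).smulRight (x : A) * e, _, rfl⟩) ?_
    intro x y hxy
    have h1 : e * (D.B b).smulRight (x : A) * e = e * (D.B b).smulRight (y : A) * e := congrArg Subtype.val hxy
    have h2 := LinearMap.congr_fun h1 p
    simp only [End.mul_apply, smulRight_apply, map_smul, hr] at h2
    rw [D.B_symm] at h2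
    exact Subtype.ext (smul_right_injective A hb h2)
  obtain ⟨τ, h1, h2⟩ := hn.WD1 f.ker hle 0
  rw [sub_zero] at h2
  exact ⟨τ, h1, h2⟩

lemma mT_apply {τ : A} (h : D.IsT τ) (v : A) : ((mT τ h : (End F A)ˣ) : End F A) v = τ * v := rfl

lemma orbit_unit (hn : Num D N N0) (hG : Grp D H) (hS : Sm D H e Zs N0) (a : A) (h0 : a ≠ 0) :
    ∃ g ∈ H, IsUnit ((g : End F A) a) := by
  by_contra hcon
  push Not at hcon
  have hN : ∀ g ∈ H, (g : End F A) a * D.σ ((g : End F A) a) = 0 :=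
    fun g hg => (hn.hX _).resolve_right (hcon g hg)
  have ha : a * D.σ a = 0 := hN 1 H.one_mem
  have hN2 : ∀ g ∈ H, ∀ c, (g : End F A) (c * a) * D.σ ((g : End F A) (c * a)) = 0 := by
    intro g hg c
    by_cases hc : c * a = 0
    · rw [hc]; simp
    obtain ⟨τ, hτ, h1⟩ := T_of_ideal hn.hX h0 ha hc
    rw [← h1]
    exact hN _ (H.mul_mem hg (hG.T τ hτ))
  have hst : ∀ z ∈ Zs, ∀ c, ∃ c', (z : End F A) (c * a) = c' * a := by
    intro z hz c
    obtain ⟨τ, hτ, h1⟩ := range_small hn hS z hz a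
    have k1 := hN2 z (hS.sub z hz) c
    have k2 := hN2 z (hS.sub z hz) (c + τ)
    rw [add_mul, map_add, h1] at k2
    generalize (z : End F A) (c * a) = w at *
    have hτ' : τ * D.σ τ = 1 := hτ
    have h2 : w * D.σ (τ * a) = 0 := by
      apply D.red
      · simp only [map_mul, D.inv]; linear_combination τ * D.σ τ * a * D.σ a * k1
      · simp only [map_mul, map_add, D.inv] at k2 ⊢
        linear_combination k2 - k1 - τ * D.σ τ * ha
    obtain ⟨s, hs⟩ := tr_unit hn.hX h0 ha
    refine ⟨↑s⁻¹ * w, ?_⟩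
    have hsm : (s : A) * ↑s⁻¹ = 1 := Units.mul_inv s
    rw [map_mul] at h2
    linear_combination -w * hsm + (↑s⁻¹ * w) * hs + ↑s⁻¹ * τ * h2 - ↑s⁻¹ * w * D.σ a * hτ'
  have hall : ∀ X : End F A, ∀ c, ∃ c', X (c * a) = c' * a := by
    intro X
    have hX : X ∈ adjoin F (Set.range (lmul F A) ∪ (fun z : (End F A)ˣ => (z : End F A)) '' Zs) := by
      rw [hS.gen]; trivial
    induction hX using adjoin_induction with
    | mem x hx =>
      rcases hx with ⟨b, rfl⟩ | ⟨z, hz, rfl⟩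
      · intro c; exact ⟨b * c, by simp [mul_assoc]⟩
      · exact hst z hz
    | algebraMap r => intro c; exact ⟨r • c, by simp [Module.algebraMap_end_apply]⟩
    | add x y _ _ hx hy =>
      intro c; obtain ⟨c1, h1⟩ := hx c; obtain ⟨c2, h2⟩ := hy c
      exact ⟨c1 + c2, by rw [laa, h1, h2, add_mul]⟩
    | mul x y _ _ hx hy =>
      intro c; obtain ⟨c1, h1⟩ := hy c; obtain ⟨c2, h2⟩ := hx c1
      exact ⟨c2, by rw [End.mul_apply, h1, h2]⟩
  obtain ⟨b, hb⟩ : ∃ b, D.B a b ≠ 0 := by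
    by_contra hc; push Not at hc; exact h0 (D.B_nondeg _ hc)
  obtain ⟨c', hc'⟩ := hall ((D.B b).smulRight ((D.B a b)⁻¹ • (1 : A))) 1
  rw [one_mul, smulRight_apply, D.B_symm, smul_smul, mul_inv_cancel₀ hb, one_smul] at hc'
  exact hcon 1 H.one_mem (.of_mul_eq_one_right c' hc'.symm)

end QM

namespace QM
variable {F A : Type*} [Field F] [CommRing A] [Algebra F A] {D : QM F A}
variable [CharP A 2] [CharP F 2] [Fintype A] [Fintype F]
variable {H : Subgroup (End F A)ˣ} {e : End F A} {Zs : Set (End F A)ˣ}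
  {N N0 : ℕ}

lemma B_surj (f : A →ₗ[F] F) : ∃ v, ∀ x, D.B v x = f x := by
  have : Module.Finite F A := Module.Finite.of_finite
  have hi : Injective (D.B : A →ₗ[F] Dual F A) := by
    rw [← LinearMap.ker_eq_bot, LinearMap.ker_eq_bot']
    intro a ha
    exact D.B_nondeg a fun b => LinearMap.congr_fun ha b
  obtain ⟨v, hv⟩ := (LinearMap.injective_iff_surjective_of_finrank_eq_finrank
    (Subspace.dual_finrank_eq (K := F) (V := A)).symm).1 hi f
  exact ⟨v, fun x => LinearMap.congr_fun hv x⟩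

lemma sep {x y : A} (h : ∀ c : F, y ≠ c • x) : ∃ v, D.B v x = 0 ∧ D.B v y = 1 := by
  obtain ⟨f, hf, hfx⟩ := Submodule.exists_le_ker_of_notMem (p := Submodule.span F {x}) (v := y) (by
    rw [Submodule.mem_span_singleton]; rintro ⟨c, hc⟩; exact h c hc.symm)
  obtain ⟨v, hv⟩ := B_surj (D := D) f
  have h0 : D.B v x = 0 := by rw [hv]; exact hfx (Submodule.mem_span_singleton_self x)
  refine ⟨(f y)⁻¹ • v, ?_, ?_⟩
  · rw [map_smul, lma, h0, smul_zero]
  · rw [map_smul, lma, hv, smul_eq_mul, inv_mul_cancel₀ hf]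

lemma Num.q_le2 (hn : Num D N N0) : fcd F * fcd F * 2 ≤ N := by
  have := hn.q_le
  have hq : 1 ≤ fcd F := card_pos
  have h2 := hn.hN0
  calc fcd F * fcd F * 2 = 1 * (fcd F^2 * 1) * 2 := by ring
    _ ≤ N0 * (fcd F^2 * fcd F) * 2 := by gcongr; omega
    _ = N0 * fcd F ^ 3 * 2 := by ring
    _ ≤ N := this

lemma index_ker_le (f : A →+ F) : f.ker.index ≤ fcd F := by
  rw [AddSubgroup.index_ker, ← card_eq_fintype_card]
  exact card_le_card_of_injective _ Subtype.val_injective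

lemma Tsel0 (hn : Num D N N0) (f1 f2 : A →+ F) (c : A) :
    ∃ τ, D.IsT τ ∧ f1 τ = f1 c ∧ f2 τ = f2 c := by
  obtain ⟨τ, h, h1, h2⟩ := hn.WD1 (f1.ker ⊓ f2.ker) (AddSubgroup.index_inf_le.trans
    ((Nat.mul_le_mul (index_ker_le f1) (index_ker_le f2)).trans (by have := hn.q_le2; omega))) c
  replace h1 : f1 (τ - c) = 0 := h1
  replace h2 : f2 (τ - c) = 0 := h2
  rw [map_sub, sub_eq_zero] at h1 h2
  exact ⟨τ, h, h1, h2⟩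

lemma Tsel (hn : Num D N N0) {a : A} (ha : IsUnit a) (v1 v2 c : A) :
    ∃ τ, D.IsT τ ∧ D.B (τ * a) v1 = D.B c v1 ∧ D.B (τ * a) v2 = D.B c v2 := by
  obtain ⟨u, rfl⟩ := ha
  obtain ⟨τ, h, h1, h2⟩ := Tsel0 hn (((D.B.flip v1) ∘ₗ mulRight F (u : A)).toAddMonoidHom)
    (((D.B.flip v2) ∘ₗ mulRight F (u : A)).toAddMonoidHom) (c * ↑u⁻¹)
  refine ⟨τ, h, ?_, ?_⟩
  · simpa using h1
  · simpa using h2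

lemma T_ne (hn : Num D N N0) (f : A →+ F) : ∃ τ, D.IsT τ ∧ τ ≠ 1 ∧ f τ = 0 := by
  obtain ⟨K, hK⟩ : ∃ K, K = f.ker := ⟨_, rfl⟩
  have h := hn.WD' K (hK ▸ (index_ker_le f).trans (by have := hn.q_le2; nlinarith [card_pos (α := F)])) 0
  have h3 := hn.hN
  have : 1 < N ^ 6 := one_lt_pow (by norm_num) (by omega)
  obtain ⟨τ, hτ, h1⟩ := Finset.exists_mem_ne (this.trans_le h) 1
  have hτ' := mem_filter.1 hτ
  rw [D.mem_Tf, sub_zero, hK] at hτ'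
  exact ⟨τ, hτ'.1, h1, hτ'.2⟩

lemma T_smul {τ : A} (hτ : D.IsT τ) (h1 : τ ≠ 1) {a : A} (ha : IsUnit a) (c : F) : τ * a ≠ c • a := by
  intro h
  have h2 : τ = c • (1 : A) := ha.mul_right_cancel (by rw [h, smul_mul_assoc, one_mul])
  have h3 : τ * D.σ τ = 1 := hτ
  have hA : Nontrivial A := ⟨τ, 1, h1⟩
  rw [h2, map_smul, map_one, smul_mul_smul_comm, mul_one] at h3
  have h4 : c * c = 1 := by
    have : algebraMap F A (c * c) = algebraMap F A 1 := by rw [algebraMap_eq_smul_one, h3, map_one]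
    exact (algebraMap F A).injective this
  have h5 : (c + 1) * (c + 1) = 0 := by linear_combination h4 + F2 c + F2 (1 : F)
  have h6 : c = 1 := by
    have := mul_self_eq_zero.1 h5
    linear_combination this - F2 (1 : F)
  apply h1; rw [h2, h6, one_smul]

lemma T_out (hn : Num D N N0) {v : A} (hv : v ≠ 0) : ∃ τ, D.IsT τ ∧ ∀ c : F, τ * v ≠ c • v := by
  by_contra hcon
  push Not at hcon
  have h1 : D.Tf.card ≤ fcd F := by
    choose! f hf using hcon
    rw [← card_univ]
    refine card_le_card_of_injOn f (fun _ _ => mem_univ _) ?_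
    intro x hx y hy hxy
    by_contra hne
    have hu := IsT.sub_isUnit hn.hX ((D.mem_Tf).1 hx) ((D.mem_Tf).1 hy) hne
    apply hv
    apply hu.mul_left_cancel
    rw [sub_mul, hf x ((D.mem_Tf).1 hx), hf y ((D.mem_Tf).1 hy), hxy, sub_self, mul_zero]
  have h2 := hn.q_le2
  have h3 := hn.hNt
  have h4 : N ≤ N ^ 8 := Nat.le_self_pow (by norm_num) N
  have h5 : 1 ≤ fcd F := card_pos
  nlinarith

lemma Q_T {τ : A} (h : D.IsT τ) (a : A) : D.Q (τ * a) = D.Q a := D.Q_mul _ _ h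

lemma S3 (hn : Num D N N0) (hG : Grp D H) (hS : Sm D H e Zs N0) (a : A) (ha : D.Gd H N0 a) :
    ∃ a, IsUnit a ∧ D.Q a = 0 ∧ ∀ b, D.B a b = 0 → D.EH H a b (D.Q b) := by
  obtain ⟨g, hg, hu⟩ := orbit_unit hn hG hS a ha.1
  replace ha := ha.conj hG hg
  generalize (g : End F A) a = a at *
  have hGT : ∀ a τ, D.IsT τ → D.Gd H N0 a → D.Gd H N0 (τ * a) := fun a τ hτ h => h.conj hG (hG.T τ hτ)
  obtain ⟨τ, hτ, hτ1, h0⟩ := T_ne hn ((D.B a) ∘ₗ mulRight F a).toAddMonoidHom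
  replace h0 : D.B a (τ * a) = 0 := h0
  obtain ⟨v, hv1, hv2⟩ := sep (D := D) (T_smul hτ hτ1 hu)
  obtain ⟨τ', hτ', k1, k2⟩ := Tsel hn hu a (τ * a) v
  rw [hv1] at k1; rw [hv2] at k2
  obtain ⟨s, hs, es⟩ := Gd.swap hn ha (hGT a τ' hτ' ha) (by rw [D.B_symm]; exact k1)
  have hc := (hGT a τ hτ ha).conj hG hs
  rw [es, Et_apply, k2, h0, mul_zero, zero_smul, zero_smul, add_zero, add_zero, one_smul] at hc
  have hQ : D.Q (τ * a + a) = 0 := by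
    rw [Q_add', Q_T hτ, D.B_symm, h0, add_zero, F2]
  have hun : IsUnit (τ * a + a) := by
    have := (IsT.sub_isUnit hn.hX hτ D.isT_one hτ1).mul hu
    rwa [sub_mul, one_mul, CharTwo.sub_eq_add] at this
  generalize τ * a + a = a at *
  refine ⟨a, hun, hQ, ?_⟩
  let Γ : AddSubgroup A :=
    { carrier := {c | D.B a (c * a) = 0 ∧ D.EH H a (c * a) (D.Q (c * a))}
      zero_mem' := by
        have : D.Q 0 = 0 := by have := D.Q_add' 0 0; simpa using this
        refine ⟨by simp, 1, H.one_mem, ?_⟩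
        simp [Et_zero, this]
      add_mem' := by
        rintro c c' ⟨h1, h2⟩ ⟨h1', h2'⟩
        have h3 := h2.mul h2' h1 h1'
        rw [← Q_add', ← add_mul] at h3
        exact ⟨by rw [add_mul, map_add, h1, h1', add_zero], h3⟩
      neg_mem' := by
        intro c hc; rw [neg_eq]; exact hc }
  let f : A →+ F := ((D.B a) ∘ₗ mulRight F a).toAddMonoidHom
  have hle := hn.WDgen f.ker (by
    have := index_ker_le f
    have := hn.q_le2; nlinarith [card_pos (α := F)]) 0 Γ (by
    have : ∀ τ, D.IsT τ → τ - 0 ∈ f.ker → τ ∈ Γ := by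
      intro τ hτ h
      rw [sub_zero] at h
      refine ⟨h, ?_⟩
      rw [Q_T hτ, hQ]
      exact Gd.swap hn hc (hGT a τ hτ hc) h
    intro τ τ' hτ hτ' h1 h2
    exact Γ.sub_mem (this τ hτ h1) (this τ' hτ' h2))
  intro b hb
  obtain ⟨u, rfl⟩ := hun
  have := hle (show b * ↑u⁻¹ ∈ f.ker by change D.B u (b * ↑u⁻¹ * u) = 0; simpa using hb)
  have h2 : D.EH H u (b * ↑u⁻¹ * u) (D.Q (b * ↑u⁻¹ * u)) := this.2
  simpa using h2

end QM

namespace QM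
variable {F A : Type*} [Field F] [CommRing A] [Algebra F A] {D : QM F A}
variable [CharP A 2] [CharP F 2] [Fintype A] [Fintype F]
variable {H : Subgroup (End F A)ˣ} {e : End F A} {Zs : Set (End F A)ˣ}
  {N N0 : ℕ}

lemma EQ_Q {a b : A} (ha : D.Q a = 0) (hab : D.B a b = 0) (v : A) :
    D.Q (D.Et a b (D.Q b) v) = D.Q v := by
  have h1 := D.B_self a
  have h2 : D.B b a = 0 := by rw [D.B_symm]; exact hab
  have h3 := D.B_symm v a
  have h4 := D.B_symm v b
  rw [Et_apply]
  simp only [Q_add', D.Q_smul, map_add, map_smul, laa, lma, smul_eq_mul,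
    ha, h1, h2, h3, h4, hab]
  linear_combination F2 (D.B a v * D.B b v) + F2 (D.Q b * D.B a v ^ 2)

lemma trans_aux (hn : Num D N N0) (hG : Grp D H) {a : A} (hu : IsUnit a) (hQ : D.Q a = 0)
    (hE : ∀ b, D.B a b = 0 → D.EH H a b (D.Q b)) {v v' : A} (hv : v ≠ 0) (hvv : D.Q v = D.Q v')
    (hi : ∀ c : F, v' ≠ c • v) : ∃ g ∈ H, (∀ x, D.Q ((g : End F A) x) = D.Q x) ∧ (g : End F A) v = v' := by
  obtain ⟨x, hx1, hx2⟩ := sep (D := D) hi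
  obtain ⟨y, hy1, hy2⟩ := sep (D := D) (x := v') (y := v) (by
    rintro c rfl
    have hc : c ≠ 0 := by rintro rfl; simp at hv
    exact hi c⁻¹ (by rw [smul_smul, inv_mul_cancel₀ hc, one_smul]))
  obtain ⟨τ, hτ, k1, k2⟩ := Tsel hn hu v v' (x + y)
  rw [map_add, laa, hx1, hy2, zero_add] at k1
  rw [map_add, laa, hx2, hy1, add_zero] at k2
  have hb : D.B (τ * a) (v + v') = 0 := by rw [map_add, k1, k2, F2]
  have hσ : D.B a (D.σ τ * (v + v')) = 0 := by rw [← B_mul]; exact hb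
  obtain ⟨g, hg, eg⟩ := (hE _ hσ).conj hG (hG.T τ hτ)
  have e1 : τ * (D.σ τ * (v + v')) = v + v' := by rw [← mul_assoc, show τ * D.σ τ = 1 from hτ, one_mul]
  rw [mT_apply, mT_apply, e1, Q_T hτ.star] at eg
  refine ⟨g, hg, ?_, ?_⟩
  · intro x; rw [eg]; exact EQ_Q (by rw [Q_T hτ, hQ]) hb x
  · have e3 : D.Q (v + v') = D.B v' v := by
      rw [Q_add', hvv, D.B_symm]; linear_combination F2 (D.Q v')
    rw [eg, Et_apply, k1, map_add, laa, D.B_self, e3]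
    have h1 := A2 v
    have h2 := A2 (D.B v' v • (τ * a))
    linear_combination (norm := module) h1 + h2

lemma trans (hn : Num D N N0) (hG : Grp D H) {a : A} (hu : IsUnit a) (hQ : D.Q a = 0)
    (hE : ∀ b, D.B a b = 0 → D.EH H a b (D.Q b)) {v v' : A} (hv : v ≠ 0) (hv' : v' ≠ 0) (hvv : D.Q v = D.Q v') :
    ∃ g ∈ H, (∀ x, D.Q ((g : End F A) x) = D.Q x) ∧ (g : End F A) v = v' := by
  by_cases hi : ∀ c : F, v' ≠ c • v
  · exact trans_aux hn hG hu hQ hE hv hvv hi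
  push Not at hi
  obtain ⟨c, rfl⟩ := hi
  obtain ⟨τ, hτ, hout⟩ := T_out hn hv
  have hw : τ * v ≠ 0 := fun h => hout 0 (by rw [h, zero_smul])
  obtain ⟨g, hg, h1, h2⟩ := trans_aux hn hG hu hQ hE (v' := τ * v) hv (Q_T hτ v).symm hout
  obtain ⟨g', hg', h1', h2'⟩ := trans_aux hn hG hu hQ hE (v := τ * v) (v' := c • v) hw (by rw [Q_T hτ, hvv]) (by
    intro d hd
    have hc : c ≠ 0 := by rintro rfl; simp at hv'
    have hd0 : d ≠ 0 := by rintro rfl; rw [zero_smul] at hd; exact hv' hd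
    apply hout (d⁻¹ * c)
    rw [mul_smul, hd, smul_smul, inv_mul_cancel₀ hd0, one_smul])
  refine ⟨g' * g, H.mul_mem hg' hg, fun x => ?_, ?_⟩
  · rw [val_mul, End.mul_apply, h1', h1]
  · rw [val_mul, End.mul_apply, h2, h2']

lemma exists_sq (c : F) : ∃ μ : F, c = μ * μ := by
  obtain ⟨μ, h⟩ := FiniteField.isSquare_of_char_two (ringChar.eq F 2) c
  exact ⟨μ, h⟩

lemma Et_sq (u : A) (μ : F) : D.Et u 0 (μ * μ) = D.Et (μ • u) 0 1 := by
  ext v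
  simp only [Et_apply, map_smul, map_zero, LinearMap.zero_apply, lma, smul_eq_mul]
  module

lemma S4 (hn : Num D N N0) (hG : Grp D H) {a : A} (hu : IsUnit a) (hQ : D.Q a = 0)
    (hE : ∀ b, D.B a b = 0 → D.EH H a b (D.Q b)) (g : (End F A)ˣ) (hg : g ∈ H)
    (hgQ : ∃ b, D.Q ((g : End F A) b) ≠ D.Q b) : ∀ u l, D.EH H u 0 l := by
  obtain ⟨b, hb⟩ := hgQ
  have hiso := hG.iso g hg
  have h00 : D.Q 0 = 0 := by have := D.Q_add' 0 0; simpa using this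
  have hne : Nontrivial A := ⟨(g : End F A) b, b, fun h => hb (by rw [h])⟩
  let f : A →+ F :=
    { toFun := fun x => D.Q ((g : End F A) (x * a)) + D.Q (x * a)
      map_zero' := by simp [h00]
      map_add' := by
        intro x y
        simp only [add_mul, map_add, Q_add', hiso]
        linear_combination F2 (D.B (x * a) (y * a)) }
  obtain ⟨τ, hτ, k1, k2⟩ := Tsel0 hn f ((D.B.flip b) ∘ₗ mulRight F a).toAddMonoidHom 0
  have k1 : D.Q ((g : End F A) (τ * a)) + D.Q (τ * a) = 0 := by rw [map_zero] at k1; exact k1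
  have k2 : D.B (τ * a) b = 0 := by rw [map_zero] at k2; exact k2
  have hE' : ∀ τ, D.IsT τ → ∀ b, D.B (τ * a) b = 0 → D.EH H (τ * a) b (D.Q b) := by
    intro τ hτ b hb
    have := (hE (D.σ τ * b) (by rw [← B_mul]; exact hb)).conj hG (hG.T τ hτ)
    have e1 : τ * (D.σ τ * b) = b := by rw [← mul_assoc, show τ * D.σ τ = 1 from hτ, one_mul]
    rwa [mT_apply, mT_apply, e1, Q_T hτ.star] at this
  have h0 : ∀ τ, D.IsT τ → τ * a ≠ 0 := fun τ hτ => (hτ.isUnit.mul hu).ne_zero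
  obtain ⟨h1, hh1, hh2, hh3⟩ := trans hn hG hu hQ hE (v := (g : End F A) (τ * a)) (v' := τ * a)
    (fun h => h0 τ hτ (by rw [← u_inv g (τ * a), h, map_zero])) (h0 τ hτ)
    (by linear_combination k1 - F2 (D.Q (τ * a)))
  have hH := H.mul_mem hh1 hg
  have hv : ((h1 * g : (End F A)ˣ) : End F A) (τ * a) = τ * a := by
    rw [val_mul, End.mul_apply, hh3]
  have hb2 : D.Q (((h1 * g : (End F A)ˣ) : End F A) b) ≠ D.Q b := by
    rw [val_mul, End.mul_apply, hh2]; exact hb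
  have p1 := (hE' τ hτ b k2).conj hG hH
  have hB := hG.iso _ hH (τ * a) b
  rw [hv] at p1 hB
  rw [k2] at hB
  have p2 := p1.mul (hE' τ hτ _ hB) hB hB
  rw [A2, D.B_self, add_zero] at p2
  generalize hl : D.Q b + D.Q (((h1 * g : (End F A)ˣ) : End F A) b) = l at p2
  have hl0 : l ≠ 0 := by
    rintro rfl; apply hb2; linear_combination hl - F2 (D.Q b)
  obtain ⟨μ, rfl⟩ := exists_sq l
  have hμ : μ ≠ 0 := by rintro rfl; simp at hl0
  have hs : ∀ u, u ≠ 0 → D.Q u = 0 → D.EH H u 0 1 := by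
    intro u hu0 hQu
    obtain ⟨k, hk, -, hk3⟩ := trans hn hG hu hQ hE (v := μ • (τ * a)) (v' := u)
      (smul_ne_zero hμ (h0 τ hτ)) hu0 (by rw [D.Q_smul, Q_T hτ, hQ, mul_zero, hQu])
    have : D.EH H (μ • (τ * a)) 0 1 := by unfold EH at *; rwa [← Et_sq]
    have h2 := this.conj hG hk
    rwa [hk3, map_zero] at h2
  have hall : ∀ u, D.EH H u 0 1 := by
    intro u
    by_cases hu0 : u = 0
    · subst hu0; exact ⟨1, H.one_mem, by ext; simp [Et_apply]⟩
    obtain ⟨ν, hν⟩ := exists_sq (D.Q u)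
    obtain ⟨c, hc⟩ : ∃ c, D.B c a = ν := by
      obtain ⟨v, hv1, hv2⟩ := sep (D := D) (x := 0) (y := a) (fun c => by rw [smul_zero]; exact hu.ne_zero)
      exact ⟨ν • v, by rw [map_smul, lma, hv2, smul_eq_mul, mul_one]⟩
    obtain ⟨τ', hτ', k3, -⟩ := Tsel hn hu a a c
    obtain ⟨t, ht, et⟩ := hs (τ' * a) (h0 _ hτ') (by rw [Q_T hτ', hQ])
    have q1 : D.Q ((t : End F A) a) = D.Q u := by
      rw [et, Et_apply, k3, hc, map_zero, LinearMap.zero_apply, zero_smul, smul_zero, add_zero, add_zero, Q_add', map_smul, D.Q_smul, Q_T hτ', hQ, D.B_symm, k3, hν, hc]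
      simp
    obtain ⟨k, hk, -, hk3⟩ := trans hn hG hu hQ hE (v := (t : End F A) a) (v' := u)
      (fun h => hu.ne_zero (by rw [← u_inv t a, h, map_zero])) hu0 q1
    have h2 := ((hs a hu.ne_zero hQ).conj hG ht).conj hG hk
    rwa [hk3, map_zero, map_zero] at h2
  intro u l
  obtain ⟨μ, rfl⟩ := exists_sq l
  unfold EH at *
  rw [Et_sq]; exact hall _

lemma iso_step (hall : ∀ u l, D.EH H u 0 l) (g : (End F A)ˣ)
    (hg : ∀ x y, D.B ((g : End F A) x) ((g : End F A) y) = D.B x y) (w : A) (l : F)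
    (hw : ∀ x, (g : End F A) x = x → D.B w x = 0) :
    ∃ g' : (End F A)ˣ, (g' ∈ H → g ∈ H) ∧
      (∀ x y, D.B ((g' : End F A) x) ((g' : End F A) y) = D.B x y) ∧
      (∀ x, (g : End F A) x = x → (g' : End F A) x = x) ∧
      ∀ x, (g' : End F A) x = (g : End F A) x + (l * D.B w ((g : End F A) x)) • w := by
  obtain ⟨t, ht, et⟩ := hall w l
  have e1 : ∀ x, ((t * g : (End F A)ˣ) : End F A) x = (g : End F A) x + (l * D.B w ((g : End F A) x)) • w := by
    intro x
    rw [val_mul, End.mul_apply, et, Et_apply]; simp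
  refine ⟨t * g, fun h => ?_, ?_, ?_, e1⟩
  · have := H.mul_mem (H.inv_mem ht) h
    rwa [inv_mul_cancel_left] at this
  · intro x y
    rw [e1, e1]
    have := D.B_symm ((g : End F A) x) w
    simp only [map_add, laa, map_smul, lma, smul_eq_mul, D.B_self, hg, this]
    linear_combination F2 (l * D.B w ((g : End F A) x) * D.B w ((g : End F A) y))
  · intro x hx; rw [e1, hx, hw x hx]; simp

theorem all_iso (hall : ∀ u l, D.EH H u 0 l) (g : (End F A)ˣ)
    (hg : ∀ x y, D.B ((g : End F A) x) ((g : End F A) y) = D.B x y) : g ∈ H := by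
  obtain ⟨k, hk⟩ : ∃ k, fcd A ≤ (univ.filter fun x => (g : End F A) x = x).card + k :=
    ⟨fcd A, by omega⟩
  induction k generalizing g with
  | zero =>
    have h1 := Finset.eq_univ_of_card _ (le_antisymm (card_le_univ _) hk)
    have : g = 1 := by
      apply Units.ext; ext x
      have := mem_univ x
      rw [← h1] at this
      exact (mem_filter.1 this).2
    rw [this]; exact H.one_mem
  | succ k ih =>
    have hfix : ∀ (g : (End F A)ˣ) (hg : ∀ x y, D.B ((g : End F A) x) ((g : End F A) y) = D.B x y) (v x : A), (g : End F A) x = x → D.B ((g : End F A) v - v) x = 0 := by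
      intro g hg v x hx
      rw [map_sub, lsa, sub_eq_zero, ← hg v x, hx]
    have step : ∀ g : (End F A)ˣ, (∀ x y, D.B ((g : End F A) x) ((g : End F A) y) = D.B x y) →
        fcd A ≤ (univ.filter fun x => (g : End F A) x = x).card + (k + 1) →
        (∃ v, D.B v ((g : End F A) v) ≠ 0) → g ∈ H := by
      intro g hg hk ⟨v, hv⟩
      obtain ⟨g', i1, i2, i3, i4⟩ := iso_step hall g hg ((g : End F A) v - v) (D.B v ((g : End F A) v))⁻¹ (hfix g hg v)
      apply i1
      apply ih g' i2
      have : (univ.filter fun x => (g : End F A) x = x).card < (univ.filter fun x => (g' : End F A) x = x).card := by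
        apply Finset.card_lt_card
        rw [Finset.ssubset_iff_of_subset (fun x hx => by simpa using i3 x (by simpa using hx))]
        refine ⟨v, ?_, ?_⟩
        · rw [mem_filter]; refine ⟨mem_univ _, ?_⟩
          rw [i4, map_sub, lsa, D.B_self, zero_sub, mul_neg, inv_mul_cancel₀ hv]
          module
        · rw [mem_filter]; rintro ⟨-, h⟩; rw [h, D.B_self] at hv; exact hv rfl
      omega
    by_cases hv : ∃ v, D.B v ((g : End F A) v) ≠ 0
    · exact step g hg hk hv
    push Not at hv
    by_cases h1 : ∃ v, (g : End F A) v - v ≠ 0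
    swap
    · push Not at h1
      have : g = 1 := by
        apply Units.ext; ext x; exact sub_eq_zero.1 (h1 x)
      rw [this]; exact H.one_mem
    obtain ⟨v, hv1⟩ := h1
    obtain ⟨x, hx⟩ : ∃ x, D.B ((g : End F A) v - v) x ≠ 0 := by
      by_contra hc; push Not at hc; exact hv1 (D.B_nondeg _ hc)
    obtain ⟨g', i1, i2, i3, i4⟩ := iso_step hall g hg ((g : End F A) v - v) 1 (hfix g hg v)
    apply i1
    refine step g' i2 (hk.trans ?_) ⟨x, ?_⟩
    · exact Nat.add_le_add_right (card_le_card (fun y hy => by simpa using i3 y (by simpa using hy))) _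
    · have h3 := hv (x + v)
      have e3 := D.B_symm v ((g : End F A) x)
      have e4 := D.B_symm x ((g : End F A) v)
      have e5 := D.B_symm x v
      simp only [map_add, laa, hv, zero_add, add_zero] at h3
      simp only [map_sub, lsa, hg, map_add, map_smul, smul_eq_mul, i4, hv, zero_add, one_mul] at hx ⊢
      have h4 : D.B v x - D.B v ((g : End F A) x) = D.B ((g : End F A) v) x - D.B v x := by
        linear_combination -h3 + e4 + F2 (D.B v x)
      have h5 : D.B x ((g : End F A) v) - D.B x v = D.B ((g : End F A) v) x - D.B v x := by
        rw [e4, e5]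
      rw [h4, h5]
      exact mul_ne_zero hx hx

/-- the structural theorem -/
theorem structural (hn : Num D N N0) (hG : Grp D H) (hS : Sm D H e Zs N0) (z : (End F A)ˣ)
    (hz : z ∈ Zs) (hz2 : z * z ≠ 1) (p' : A) (hp' : e p' = p')
    (h0 : D.B p' ((z : End F A) p') = 0) (hne : (z : End F A) p' ≠ p')
    (g : (End F A)ˣ) (hg : g ∈ H) (hgQ : ∃ b, D.Q ((g : End F A) b) ≠ D.Q b)
    (k : (End F A)ˣ)
    (hk : ∀ x y, D.B ((k : End F A) x) ((k : End F A) y) = D.B x y) : k ∈ H := by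
  obtain ⟨a, ha⟩ := S2 hn hG hS z hz hz2 p' hp' h0 hne
  obtain ⟨a, h1, h2, h3⟩ := S3 hn hG hS a ha
  exact all_iso (S4 hn hG h1 h2 h3 g hg hgQ) k hk

end QM

namespace QM
open QuadraticAlgebra

abbrev QA (E : Type*) [CommRing E] (s : E) := QuadraticAlgebra E 1 s

section
variable {F E : Type*} [Field F] [CommRing E] [Algebra F E] [CharP E 2]


instance (s : E) : CharP (QA E s) 2 := by
  refine (CharTwo.of_one_ne_zero_of_two_eq_zero ?_ ?_)
  · have : Nontrivial E := CharP.nontrivial_of_char_ne_one (v := 2) (by norm_num)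
    exact one_ne_zero
  · ext <;> simp [two_eq_zero]

noncomputable instance (s : E) [Fintype E] : Fintype (QA E s) := Fintype.ofEquiv _ (equivProd 1 s).symm

lemma card_QA (s : E) [Fintype E] : fcd (QA E s) = fcd E ^ 2 := by
  rw [Fintype.card_congr (equivProd 1 s), Fintype.card_prod, sq]

variable (F) in
noncomputable def sig (s : E) : QA E s →ₐ[F] QA E s :=
  { (starRingEnd (QA E s)) with
    commutes' := fun r => by
      change star (⟨algebraMap F E r, 0⟩ : QA E s) = ⟨algebraMap F E r, 0⟩
      ext <;> simp [re_star, im_star] }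

lemma sig_apply (s : E) (a : QA E s) : sig F s a = star a := rfl

variable [IsReduced E]

/-- the quadratic model -/
noncomputable def mk' (s : E) (hs : IsUnit s) (ℓ : E →ₗ[F] F) (hℓ : ∀ a, (∀ b, ℓ (a * b) = 0) → a = 0) :
    QM F (QA E s) where
  σ := sig F s
  lam := ℓ ∘ₗ ((QuadraticAlgebra.trace : QA E s →ₗ[E] E).restrictScalars F)
  Q := fun a => ℓ (norm a)
  inv := fun a => by rw [sig_apply, sig_apply, star_star]
  lam_fix := fun c hc => by
    rw [sig_apply, ← algebraMap_trace_eq_add_star] at hc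
    have : QuadraticAlgebra.trace c = 0 := algebraMap_injective (by rw [hc, map_zero])
    rw [comp_apply, restrictScalars_apply, this, map_zero]
  nondeg := fun a ha => by
    simp only [comp_apply, restrictScalars_apply, trace_def, two_eq_zero, zero_mul, zero_add] at ha
    have h1 : a.im = 0 := by
      have : s * a.im = 0 := hℓ _ fun b => by
        have := ha ⟨b, 0⟩
        simpa [mul_assoc] using this
      exact (hs.mul_right_eq_zero).1 this
    have h2 : a.re = 0 := by
      have : s * a.re = 0 := hℓ _ fun b => by
        have := ha ⟨0, b⟩
        simpa [mul_assoc, h1] using this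
      exact (hs.mul_right_eq_zero).1 this
    ext <;> simp [h1, h2]
  red := fun a h1 h2 => by
    rw [sig_apply, ← algebraMap_trace_eq_add_star] at h2
    rw [sig_apply, ← algebraMap_norm_eq_mul_star] at h1
    have h3 : QuadraticAlgebra.trace a = 0 := algebraMap_injective (by rw [h2, map_zero])
    have h4 : norm a = 0 := algebraMap_injective (by rw [h1, map_zero])
    rw [trace_def, two_eq_zero, zero_mul, zero_add] at h3
    have h5 : a.im = 0 := (hs.mul_right_eq_zero).1 h3
    rw [norm_def, h5] at h4
    have h6 : a.re = 0 := by
      apply IsReduced.eq_zero _ ⟨2, _⟩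
      rw [sq]; simpa using h4
    ext <;> simp [h5, h6]
  Q_add := fun a b => by
    simp only [comp_apply, restrictScalars_apply]
    rw [← map_add, ← map_add]; congr 1
    simp only [sig_apply, trace_def, norm_def, re_add, im_add, re_mul, im_mul, re_star, im_star]
    ring
  Q_smul := fun c a => by
    have : norm (c • a) = c ^ 2 • norm a := by
      rw [norm_def, re_smul, im_smul, norm_def]; simp only [smul_def, map_pow]; ring
    rw [this, map_smul, smul_eq_mul]
  Q_mul := fun a b h => by
    have : norm b = 1 := algebraMap_injective (by
      rw [algebraMap_norm_eq_mul_star, map_one]; exact h)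
    rw [map_mul, this, one_mul]

variable (s : E) (hs : IsUnit s) (ℓ : E →ₗ[F] F) (hℓ : ∀ a, (∀ b, ℓ (a * b) = 0) → a = 0)

lemma isT_iff (a : QA E s) : (mk' s hs ℓ hℓ).IsT a ↔ norm a = 1 := by
  change a * star a = 1 ↔ _
  rw [← algebraMap_norm_eq_mul_star, ← map_one (algebraMap E (QA E s)), algebraMap_inj]

lemma isT_omega : (mk' s hs ℓ hℓ).IsT ω := by
  rw [isT_iff, norm_def]; simp [neg_eq]

end

section field
variable {F K : Type*} [Field F] [Field K] [Algebra F K] [CharP K 2] [Fintype K]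
variable (s : K) (hs : IsUnit s) (ℓ : K →ₗ[F] F) (hℓ : ∀ a, (∀ b, ℓ (a * b) = 0) → a = 0)

lemma norm_unit {a : QA K s} (h : norm a ≠ 0) : IsUnit a := isUnit_iff_norm_isUnit.2 h.isUnit

lemma isX : (mk' s hs ℓ hℓ).IsX := by
  intro a
  by_cases h : norm a = 0
  · left; change a * star a = 0
    rw [← algebraMap_norm_eq_mul_star, h, map_zero]
  · right; exact norm_unit s h

/-- squares are surjective -/
lemma exK_sq (c : K) : ∃ μ : K, c = μ * μ := by
  obtain ⟨μ, h⟩ := FiniteField.isSquare_of_char_two (ringChar.eq K 2) c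
  exact ⟨μ, h⟩

lemma norm_smul' (c : K) (a : QA K s) : norm (c • a) = c ^ 2 * norm a := by
  rw [norm_def, re_smul, im_smul, norm_def]; simp only [smul_eq_mul]; ring

/-- fibres of the norm -/
lemma card_norm_fib {c : K} (hc : c ≠ 0) :
    (univ.filter fun a : QA K s => norm a = c).card = (univ.filter fun a : QA K s => norm a = 1).card := by
  obtain ⟨μ, rfl⟩ := exK_sq c
  have hμ : μ ≠ 0 := left_ne_zero_of_mul hc
  refine Finset.card_nbij' (fun a => μ⁻¹ • a) (fun a => μ • a) ?_ ?_ ?_ ?_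
  · intro a ha
    simp only [coe_filter, mem_univ, true_and, mem_ofPred_eq] at ha ⊢
    rw [norm_smul', ha]; field_simp
  · intro a ha
    simp only [coe_filter, mem_univ, true_and, mem_ofPred_eq] at ha ⊢
    rw [norm_smul', ha]; ring
  · intro a _; exact smul_inv_smul₀ hμ a
  · intro a _; exact inv_smul_smul₀ hμ a

lemma card_norm_set (S : Finset K) (h0 : 0 ∈ S) :
    (univ.filter fun a : QA K s => norm a ∈ S).card =
    (univ.filter fun a : QA K s => norm a = 0).card +
    (S.card - 1) * (univ.filter fun a : QA K s => norm a = 1).card := by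
  rw [Finset.card_eq_sum_card_fiberwise (f := fun a : QA K s => norm a) (t := S)
    (fun a ha => by simpa using ha), ← Finset.add_sum_erase _ _ h0, ← card_erase_of_mem h0]
  congr 1
  · rw [Finset.filter_filter]; congr 1; ext a; simp only [mem_filter, mem_univ, true_and]
    exact ⟨fun h => h.2, fun h => ⟨h ▸ h0, h⟩⟩
  · rw [sum_congr rfl (g := fun _ => (univ.filter fun a : QA K s => norm a = 1).card),
      sum_const, smul_eq_mul]
    intro c hc
    rw [← card_norm_fib s (ne_of_mem_erase hc), Finset.filter_filter]
    congr 1; ext a; simp only [mem_filter, mem_univ, true_and]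
    exact ⟨fun h => h.2, fun h => ⟨h ▸ Finset.mem_of_mem_erase hc, h⟩⟩

lemma card_norm_all : fcd K ^ 2 =
    (univ.filter fun a : QA K s => norm a = 0).card +
    (fcd K - 1) * (univ.filter fun a : QA K s => norm a = 1).card := by
  rw [← card_univ (α := K), ← card_norm_set s _ (mem_univ 0), card_univ, ← card_QA s]
  simp

lemma card_norm_zero_inert (h : ∀ t : K, t * t + s * t + 1 ≠ 0) :
    (univ.filter fun a : QA K s => norm a = 0).card = 1 := by
  rw [Finset.card_eq_one]
  refine ⟨0, ?_⟩
  ext a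
  simp only [mem_filter, mem_univ, true_and, mem_singleton]
  refine ⟨fun ha => ?_, fun ha => by rw [ha]; simp⟩
  rw [norm_def] at ha
  by_cases hi : a.im = 0
  · rw [hi] at ha
    have : a.re = 0 := by simpa using ha
    ext <;> simp [hi, this]
  · exfalso; apply h (a.re / a.im)
    field_simp
    rw [sub_eq_add_neg, neg_eq] at ha
    linear_combination ha

lemma card_norm_zero_split (hs : s ≠ 0) {t : K} (h : t * t + s * t + 1 = 0) :
    (univ.filter fun a : QA K s => norm a = 0).card = 2 * fcd K - 1 := by
  have h2 := two_eq_zero (R := K)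
  have key : (univ.filter fun a : QA K s => norm a = 0) =
      insert 0 (((univ.erase (0:K)).image fun v => (⟨t * v, v⟩ : QA K s)) ∪
        ((univ.erase (0:K)).image fun v => (⟨(t + s) * v, v⟩ : QA K s))) := by
    ext a
    simp only [mem_filter, mem_univ, true_and, mem_insert, mem_union,
      mem_image, mem_erase, and_true]
    constructor
    · intro ha
      rw [norm_def] at ha
      by_cases hi : a.im = 0
      · rw [hi] at ha
        have : a.re = 0 := by simpa using ha
        left; ext <;> simp [hi, this]
      · have : (a.re - t * a.im) * (a.re - (t + s) * a.im) = 0 := by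
          linear_combination ha + (a.im ^ 2) * h + (-t * a.im * a.re - s * a.im * a.re) * h2
        right
        rcases mul_eq_zero.1 this with h | h
        · left; exact ⟨a.im, hi, by ext <;> simp [← sub_eq_zero.1 h]⟩
        · right; exact ⟨a.im, hi, by ext <;> simp [← sub_eq_zero.1 h]⟩
    · rintro (rfl | ⟨v, hv, rfl⟩ | ⟨v, hv, rfl⟩)
      · simp
      · rw [norm_def]; linear_combination v ^ 2 * h - v ^ 2 * h2
      · rw [norm_def]; linear_combination v ^ 2 * h + (s ^ 2 * v ^ 2 + s * t * v ^ 2 - v ^ 2) * h2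
  have hK : 1 ≤ fcd K := card_pos
  rw [key, Finset.card_insert_of_notMem, Finset.card_union_of_disjoint, card_image_of_injective,
    card_image_of_injective, card_erase_of_mem (mem_univ _), card_univ]
  · omega
  · intro a b hab; exact congrArg im hab
  · intro a b hab; exact congrArg im hab
  · rw [disjoint_left]
    simp only [mem_image, mem_erase, mem_univ, and_true]
    rintro _ ⟨v, hv, rfl⟩ ⟨w, hw, he⟩
    have h1 : w = v := congrArg im he
    have h2 : (t + s) * w = t * v := congrArg re he
    rw [h1] at h2
    exact mul_ne_zero hs hv (by linear_combination h2)
  · simp only [mem_union, mem_image, mem_erase, mem_univ, and_true]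
    rintro (⟨v, hv, he⟩ | ⟨v, hv, he⟩) <;> exact hv (congrArg im he)

lemma card_norm_zero (hs : s ≠ 0) : (univ.filter fun a : QA K s => norm a = 0).card ≤ 2 * fcd K - 1 := by
  have hK : 1 ≤ fcd K := card_pos
  by_cases h : ∃ t : K, t * t + s * t + 1 = 0
  · obtain ⟨t, h⟩ := h
    exact (card_norm_zero_split s hs h).le
  · push Not at h
    rw [card_norm_zero_inert s h]; omega

lemma card_T_ge (hs : s ≠ 0) : fcd K ≤ (univ.filter fun a : QA K s => norm a = 1).card + 1 := by
  have h1 := card_norm_all s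
  have h2 := card_norm_zero s hs
  have hK : 2 ≤ fcd K := one_lt_card
  generalize fcd K = k at *
  obtain ⟨k, rfl⟩ : ∃ j, k = j + 1 := ⟨k - 1, by omega⟩
  simp only [Nat.add_sub_cancel] at h1
  have h2 : (univ.filter fun a : QA K s => norm a = 0).card ≤ 2 * k + 1 := by omega
  generalize (univ.filter fun a : QA K s => norm a = 1).card = t at *
  by_contra hc
  have : k * t + k ≤ k * k := by
    have : t + 1 ≤ k := by omega
    nlinarith
  nlinarith


/-- the zero counts of the two types differ -/
lemma zeros_ne [Fintype F] {s₂ : K} (hs₂ : s₂ ≠ 0) (h1 : ∀ t : K, t * t + s * t + 1 ≠ 0)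
    {t : K} (h2 : t * t + s₂ * t + 1 = 0) (hℓ0 : ℓ ≠ 0) :
    (univ.filter fun a : QA K s => ℓ (norm a) = 0).card ≠
    (univ.filter fun a : QA K s₂ => ℓ (norm a) = 0).card := by
  have e : ∀ s : K, (univ.filter fun a : QA K s => ℓ (norm a) = 0) =
    (univ.filter fun a : QA K s => norm a ∈ (univ.filter fun c : K => ℓ c = 0)) := by
    intro s; ext a; simp
  rw [e, e, card_norm_set _ _ (by simp), card_norm_set _ _ (by simp)]
  have a1 := card_norm_all s
  have a2 := card_norm_all s₂
  rw [card_norm_zero_inert s h1] at *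
  rw [card_norm_zero_split s₂ hs₂ h2] at *
  have hlt : (univ.filter fun c : K => ℓ c = 0).card < fcd K := by
    rw [← card_univ]
    apply Finset.card_lt_card
    rw [Finset.filter_ssubset]
    by_contra hc; push Not at hc
    exact hℓ0 (LinearMap.ext fun c => hc c (mem_univ _))
  have hK : 2 ≤ fcd K := one_lt_card
  have hk1 : 1 ≤ (univ.filter fun c : K => ℓ c = 0).card := Finset.card_pos.2 ⟨0, by simp⟩
  generalize fcd K = k at *
  generalize (univ.filter fun a : QA K s => norm a = 1).card = t1 at *
  generalize (univ.filter fun a : QA K s₂ => norm a = 1).card = t2 at *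
  generalize (univ.filter fun c : K => ℓ c = 0).card = j at *
  obtain ⟨k, rfl⟩ : ∃ j, k = j + 2 := ⟨k - 2, by omega⟩
  obtain ⟨j, rfl⟩ : ∃ i, j = i + 1 := ⟨j - 1, by omega⟩
  simp only [Nat.add_sub_cancel, show k + 2 - 1 = k + 1 by omega, show 2 * (k+2) - 1 = 2 * k + 3 by omega] at *
  have b1 : t1 = k + 3 := by
    apply eq_of_mul_eq_mul_left (show 0 < k + 1 by omega); nlinarith
  have b2 : t2 = k + 1 := by
    apply eq_of_mul_eq_mul_left (show 0 < k + 1 by omega); nlinarith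
  subst b1 b2
  intro h
  nlinarith

end field
end QM

namespace QM

section symp
variable {F : Type*} [Field F]

structure SF {V : Type*} [AddCommGroup V] [Module F V] (B : V →ₗ[F] V →ₗ[F] F) : Prop where
  alt : ∀ x, B x x = 0
  nd : ∀ x, (∀ y, B x y = 0) → x = 0

lemma SF.neg {V : Type*} [AddCommGroup V] [Module F V] {B : V →ₗ[F] V →ₗ[F] F} (h : SF B) (x y : V) :
    B x y = - B y x := by
  have := h.alt (x + y)
  simp only [map_add, laa, h.alt] at this
  linear_combination this

lemma SF.split {V : Type*} [AddCommGroup V] [Module F V] [FiniteDimensional F V] {B : V →ₗ[F] V →ₗ[F] F} (h : SF B)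
    (hV : 0 < finrank F V) : ∃ (W : Submodule F V) (e : V ≃ₗ[F] (F × F × W)),
      SF ((B.domRestrict₁₂ W W)) ∧
      ∀ x y, B x y = (e x).1 * (e y).2.1 - (e x).2.1 * (e y).1 + B (e x).2.2 (e y).2.2 := by
  haveI : Nontrivial V := Module.finrank_pos_iff.1 hV
  obtain ⟨v, hv⟩ := exists_ne (0 : V)
  obtain ⟨w', hw'⟩ : ∃ w, B v w ≠ 0 := by
    by_contra hc; push Not at hc; exact hv (h.nd v hc)
  obtain ⟨w, hw⟩ : ∃ w, B v w = 1 := ⟨(B v w')⁻¹ • w', by simp [hw']⟩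
  have hwv : B w v = -1 := by rw [h.neg, hw]
  let W : Submodule F V := LinearMap.ker (B v) ⊓ LinearMap.ker (B.flip w)
  have hW : ∀ x, x ∈ W ↔ B v x = 0 ∧ B x w = 0 := fun x => by simp [W]
  let e : V ≃ₗ[F] (F × F × W) :=
    { toFun := fun x => (B x w, B v x, ⟨x - (B x w) • v - (B v x) • w, by
        rw [hW]; simp [h.alt, hw]⟩)
      map_add' := fun x y => by
        ext <;> simp
        module
      map_smul' := fun c x => by
        ext <;> simp
        module
      invFun := fun p => p.1 • v + p.2.1 • w + p.2.2
      left_inv := fun x => by simp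
      right_inv := fun p => by
        obtain ⟨a, b, r, hr⟩ := p
        rw [hW] at hr
        ext <;> simp [h.alt, hw, hr.1, hr.2]
        module }
  have hBe : ∀ x y, B x y = (e x).1 * (e y).2.1 - (e x).2.1 * (e y).1 + B (e x).2.2 (e y).2.2 := by
    intro x y
    simp only [e, LinearEquiv.coe_mk, LinearMap.coe_mk, AddHom.coe_mk, map_sub, lsa, map_smul,
      lma, smul_eq_mul, h.alt, hw, hwv]
    rw [h.neg w y, h.neg x v]
    ring
  refine ⟨W, e, ⟨fun x => h.alt x, ?_⟩, hBe⟩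
  intro x hx
  apply Subtype.ext
  apply h.nd
  intro y
  have hx' := (hW x).1 x.2
  have hex : (e x).1 = 0 ∧ (e x).2.1 = 0 ∧ (e x).2.2 = x := by
    refine ⟨hx'.2, hx'.1, ?_⟩
    apply Subtype.ext
    change (x : V) - (B x w) • v - (B v x) • w = x
    rw [hx'.1, hx'.2]; simp
  rw [hBe, hex.1, hex.2.1, hex.2.2]
  have := hx (e y).2.2
  simp only [LinearMap.domRestrict₁₂_apply] at this
  rw [this]; ring

theorem exists_isom (n : ℕ) : ∀ {V V' : Type} [AddCommGroup V] [Module F V] [FiniteDimensional F V]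
    [AddCommGroup V'] [Module F V'] [FiniteDimensional F V']
    {B : V →ₗ[F] V →ₗ[F] F} {B' : V' →ₗ[F] V' →ₗ[F] F} (h : SF B) (h' : SF B')
    (hn : finrank F V = n) (hn' : finrank F V' = n),
    ∃ φ : V ≃ₗ[F] V', ∀ x y, B' (φ x) (φ y) = B x y := by
  induction n using Nat.strong_induction_on with
  | _ n ih =>
  intro V V' _ _ _ _ _ _ B B' h h' hn hn'
  rcases Nat.eq_zero_or_pos n with rfl | hpos
  · have := Module.finrank_zero_iff.1 hn
    exact ⟨LinearEquiv.ofFinrankEq V V' (hn.trans hn'.symm), fun x y => by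
      rw [Subsingleton.elim x 0]; simp⟩
  · obtain ⟨W, e, hW, he⟩ := h.split (hn ▸ hpos)
    obtain ⟨W', e', hW', he'⟩ := h'.split (hn' ▸ hpos)
    have d := e.finrank_eq
    have d' := e'.finrank_eq
    simp only [Module.finrank_prod, Module.finrank_self] at d d'
    obtain ⟨φ, hφ⟩ := ih (finrank F W) (by omega) hW hW' rfl (by omega)
    refine ⟨(e.trans ((LinearEquiv.refl F F).prodCongr ((LinearEquiv.refl F F).prodCongr φ))).trans e'.symm, fun x y => ?_⟩
    rw [he', he]
    have := hφ (e x).2.2 (e y).2.2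
    simp only [LinearMap.domRestrict₁₂_apply] at this
    simp [this]

end symp

section rho
variable {F : Type} [Field F] {m : ℕ}

abbrev V0 (F : Type) (m : ℕ) := Fin m ⊕ Fin m → F
abbrev SpG (m : ℕ) (F : Type) [Field F] := Matrix.symplecticGroup (Fin m) F

noncomputable def B0 (F : Type) [Field F] (m : ℕ) : V0 F m →ₗ[F] V0 F m →ₗ[F] F := toLinearMap₂' F (Matrix.J (Fin m) F)

lemma B0_apply (x y : V0 F m) : B0 F m x y = x ⬝ᵥ (Matrix.J (Fin m) F).mulVec y := by
  rw [B0, Matrix.toLinearMap₂'_apply']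

lemma mem_Sp_iff (M : Matrix (Fin m ⊕ Fin m) (Fin m ⊕ Fin m) F) :
    M ∈ Matrix.symplecticGroup (Fin m) F ↔ ∀ x y, B0 F m (M.mulVec x) (M.mulVec y) = B0 F m x y := by
  rw [SymplecticGroup.mem_iff']
  have : ∀ x y, B0 F m (M.mulVec x) (M.mulVec y) = toLinearMap₂' F (M.transpose * Matrix.J (Fin m) F * M) x y := by
    intro x y
    rw [B0_apply, Matrix.toLinearMap₂'_apply', ← mulVec_mulVec, ← mulVec_mulVec,
      Matrix.dotProduct_mulVec x, Matrix.vecMul_transpose]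
  simp only [this]
  constructor
  · intro h x y; rw [h]; rfl
  · intro h
    exact (toLinearMap₂' F).injective (LinearMap.ext₂ h)

lemma B0_SF [CharP F 2] : SF (B0 F m) := by
  constructor
  · intro x
    rw [B0_apply]
    simp only [Matrix.J, dotProduct, Fintype.sum_sum_type, Matrix.mulVec, Matrix.fromBlocks_apply₁₁, Matrix.fromBlocks_apply₁₂, Matrix.fromBlocks_apply₂₁, Matrix.fromBlocks_apply₂₂, Matrix.zero_apply, zero_mul, Finset.sum_const_zero, Matrix.neg_apply, Matrix.one_apply]
    simp [Finset.sum_ite_eq, mul_comm]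
  · intro x hx
    have : (Matrix.J (Fin m) F).vecMul x = 0 := by
      ext i
      have := hx (Pi.single i 1)
      rw [B0_apply, Matrix.dotProduct_mulVec, dotProduct_single_one] at this
      exact this
    have h2 := congrArg (fun v => Matrix.vecMul v (Matrix.J (Fin m) F)) this
    simp only [Matrix.vecMul_vecMul, Matrix.J_squared, Matrix.zero_vecMul, Matrix.vecMul_neg, Matrix.vecMul_one, neg_eq_zero] at h2
    exact h2

variable {A : Type} [AddCommGroup A] [Module F A]

noncomputable def rho (φ : V0 F m ≃ₗ[F] A) : SpG m F →* (End F A)ˣ :=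
  MonoidHom.toHomUnits
  { toFun := fun M => φ.conj (Matrix.toLin' M.1)
    map_one' := by simp [LinearEquiv.conj_id]; rfl
    map_mul' := fun M N => by
      simp only [Submonoid.coe_mul, Matrix.toLin'_mul, LinearEquiv.conj_comp]; rfl }

lemma rho_apply (φ : V0 F m ≃ₗ[F] A) (M : SpG m F) (a : A) :
    (rho φ M : End F A) a = φ (M.1.mulVec (φ.symm a)) := rfl

lemma rho_inj (φ : V0 F m ≃ₗ[F] A) : Injective (rho (m := m) φ) := by
  intro M N h
  apply Subtype.ext
  apply Matrix.toLin'.injective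
  apply φ.conj.injective
  exact congrArg Units.val h

lemma rho_iso {B : A →ₗ[F] A →ₗ[F] F} {φ : V0 F m ≃ₗ[F] A} (hφ : ∀ x y, B (φ x) (φ y) = B0 F m x y) (M : SpG m F) (a b : A) :
    B ((rho φ M : End F A) a) ((rho φ M : End F A) b) = B a b := by
  rw [rho_apply, rho_apply, hφ, (mem_Sp_iff M.1).1 M.2, ← hφ]; simp

lemma rho_surj {B : A →ₗ[F] A →ₗ[F] F} {φ : V0 F m ≃ₗ[F] A} (hφ : ∀ x y, B (φ x) (φ y) = B0 F m x y) (k : (End F A)ˣ)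
    (hk : ∀ a b, B ((k : End F A) a) ((k : End F A) b) = B a b) : ∃ M, rho φ M = k := by
  have h : ∀ v, (LinearMap.toMatrix' (φ.symm.conj (k : End F A))).mulVec v = φ.symm ((k : End F A) (φ v)) := by
    intro v; rw [LinearMap.toMatrix'_mulVec]; rfl
  refine ⟨⟨LinearMap.toMatrix' (φ.symm.conj (k : End F A)), (mem_Sp_iff _).2 fun x y => ?_⟩, ?_⟩
  · rw [h, h, ← hφ, apply_symm_apply, apply_symm_apply, hk, hφ]
  · apply Units.ext; apply LinearMap.ext; intro a
    rw [rho_apply, h]; simp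

end rho
end QM

namespace QM

lemma SF.nondeg {F V : Type*} [Field F] [AddCommGroup V] [Module F V] {B : V →ₗ[F] V →ₗ[F] F} (h : SF B) :
    BilinForm.Nondegenerate B :=
  ⟨fun x hx => h.nd x hx, fun x hx => h.nd x fun y => by rw [h.neg, hx, neg_zero]⟩

variable {F A R : Type} [Field F] [CommRing A] [Algebra F A] [CommRing R] [Algebra F R]
  {D : QM F A} {D' : QM F R} [CharP A 2] [CharP R 2] [CharP F 2] [Fintype A] [Fintype F] [Fintype R]

lemma sfB : SF D.B := ⟨D.B_self, D.B_nondeg⟩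

lemma SF.half {V : Type*} [AddCommGroup V] [Module F V] [FiniteDimensional F V]
    {B : V →ₗ[F] V →ₗ[F] F} (h : SF B) (Y : Submodule F V) (hY : ∀ x, x ∈ Y ↔ ∀ y ∈ Y, B y x = 0) :
    2 * finrank F Y = finrank F V := by
  have h1 : BilinForm.orthogonal B Y = Y := by
    ext x; rw [BilinForm.mem_orthogonal_iff, ← hY]
  have h2 := BilinForm.finrank_orthogonal h.nondeg Y
  rw [h1] at h2
  have := finrank_le Y
  omega

lemma ideal_perp (hX : D.IsX) (Y : Submodule F A) (hY : ∀ a, ∀ y ∈ Y, a * y ∈ Y) (h0 : Y ≠ ⊥) (h1 : Y ≠ ⊤) :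
    ∀ x, x ∈ Y ↔ ∀ y ∈ Y, D.B y x = 0 := by
  have iso : ∀ Z : Submodule F A, (∀ a, ∀ y ∈ Z, a * y ∈ Z) → Z ≠ ⊤ → ∀ x ∈ Z, ∀ y ∈ Z, D.B x y = 0 := by
    intro Z hZ hZ1 x hx y hy
    have nu : ∀ x ∈ Z, x * D.σ x = 0 := by
      intro x hx
      refine (hX x).resolve_right fun hu => hZ1 ?_
      rw [eq_top_iff]; intro b _
      obtain ⟨c, rfl⟩ := hu.dvd (a := b)
      rw [mul_comm]; exact hZ _ _ hx
    rw [B_apply]; apply D.lam_fix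
    have a := nu _ (Z.add_mem hx hy)
    rw [map_add] at a
    rw [map_mul, D.inv]
    linear_combination a - nu x hx - nu y hy
  let P : Submodule F A := BilinForm.orthogonal D.B Y
  have hP : ∀ x, x ∈ P ↔ ∀ y ∈ Y, D.B y x = 0 := fun x => BilinForm.mem_orthogonal_iff
  have hle : Y ≤ P := fun x hx => (hP x).2 fun y hy => iso Y hY h1 y hy x hx
  have hPi : ∀ a, ∀ y ∈ P, a * y ∈ P := by
    intro a y hy; rw [hP] at hy ⊢
    intro x hx; rw [D.B_symm, B_mul, D.B_symm]; exact hy _ (hY _ _ hx)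
  have hP1 : P ≠ ⊤ := by
    intro h; apply h0; rw [eq_bot_iff]; intro y hy
    exact (mem_bot F).2 (D.B_nondeg y fun x => (hP x).1 (h ▸ mem_top) y hy)
  have d1 : finrank F P = _ := BilinForm.finrank_orthogonal sfB.nondeg Y
  have d2 := BilinForm.finrank_orthogonal (sfB (D := D)).nondeg P
  have d3 : finrank F P ≤ finrank F (BilinForm.orthogonal D.B P) :=
    finrank_mono fun x hx => BilinForm.mem_orthogonal_iff.2 fun y hy => iso P hPi hP1 y hy x hx
  have d4 := finrank_le Y
  have d5 := finrank_le P
  have : Y = P := Submodule.eq_of_le_of_finrank_le hle (by omega)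
  intro x; rw [← hP, ← this]

/-- transported multiplication -/
noncomputable def Mu (ψ : R ≃ₗ[F] A) : R →ₐ[F] End F A :=
  (ψ.conjAlgEquiv F).toAlgHom.comp (lmul F R)

lemma Mu_apply (ψ : R ≃ₗ[F] A) (r : R) (a : A) : Mu ψ r a = ψ (r * ψ.symm a) := rfl

lemma Mu_adj {ψ : R ≃ₗ[F] A} (hψ : ∀ x y, D.B (ψ x) (ψ y) = D'.B x y) (r : R) (a b : A) :
    D.B (Mu ψ r a) b = D.B a (Mu ψ (D'.σ r) b) := by
  obtain ⟨a, rfl⟩ := ψ.surjective a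
  obtain ⟨b, rfl⟩ := ψ.surjective b
  rw [Mu_apply, Mu_apply, hψ, hψ, ψ.symm_apply_apply, ψ.symm_apply_apply, B_mul]

lemma Mu_range (ψ : R ≃ₗ[F] A) (r : R) :
    Nat.card (range (Mu ψ r)) = Nat.card (range (lmul F R r)) := by
  apply card_congr
  refine (Equiv.subtypeEquiv ψ.symm.toEquiv fun a => ?_)
  simp only [LinearMap.mem_range, Mu_apply]
  constructor
  · rintro ⟨y, rfl⟩; exact ⟨ψ.symm y, by simp⟩
  · rintro ⟨y, hy⟩; exact ⟨ψ y, by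
      have : r * y = ψ.symm a := hy
      simp [this]⟩

structure Blk (D' : QM F R) (z ε : R) (d : ℕ) : Prop where
  T : D'.IsT z
  ee : ε * ε = ε
  st : D'.σ ε = ε
  ze : ε * (z - 1) = z - 1
  pol : ε ∈ adjoin F {z}
  dv : ∃ w, ε = w * (z - 1)
  card : Nat.card (range (lmul F R ε)) = fcd F ^ (2 * d)
  z2 : z * z ≠ 1
  two : 2 ≤ d

lemma adjoin_stable {ψ : R ≃ₗ[F] A} {z x : R} (hx : x ∈ adjoin F {z}) {Y : Submodule F A}
    (hY : ∀ y ∈ Y, Mu ψ z y ∈ Y) : ∀ y ∈ Y, Mu ψ x y ∈ Y := by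
  induction hx using adjoin_induction with
  | mem x hx => rw [Set.mem_singleton_iff.1 hx]; exact hY
  | algebraMap r => intro y hy; rw [AlgHom.commutes]; exact Y.smul_mem r hy
  | add x y _ _ hx hy => intro v hv; rw [map_add]; exact Y.add_mem (hx v hv) (hy v hv)
  | mul x y _ _ hx hy => intro v hv; rw [map_mul]; exact hx _ (hy v hv)

/-- irreducibility from a negative block -/
lemma irr (hX : D.IsX) {ψ : R ≃ₗ[F] A} (hψ : ∀ x y, D.B (ψ x) (ψ y) = D'.B x y) {z ε : R} {d : ℕ}
    (b : Blk D' z ε d) (fld : ∀ a, ε * a ≠ 0 → ∃ b, a * b * ε = ε) (ord : z ^ (fcd F ^ d + 1) = 1)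
    (Y : Submodule F A) (hY : ∀ a, ∀ y ∈ Y, a * y ∈ Y) (hz : ∀ y ∈ Y, Mu ψ z y ∈ Y) : Y = ⊥ ∨ Y = ⊤ := by
  by_contra hc
  push Not at hc
  have hp := ideal_perp hX Y hY hc.1 hc.2
  let e := Mu ψ ε
  have hee : ∀ v, e (e v) = e v := fun v => by
    change (e * e) v = _; simp only [e]; rw [← map_mul, b.ee]
  have hadj : ∀ x y, D.B (e x) y = D.B x (e y) := fun x y => by
    simp only [e]; rw [Mu_adj hψ, b.st]
  let W : Submodule F A := range e
  have hW : ∀ x : W, e x = x := by rintro ⟨_, v, rfl⟩; exact hee v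
  have sf : SF (D.B.domRestrict₁₂ W W) := ⟨fun x => D.B_self x, fun x hx => by
    apply Subtype.ext; apply D.B_nondeg; intro y
    rw [← hW x, hadj]; exact hx ⟨e y, y, rfl⟩⟩
  let Y1 : Submodule F W := Y.comap W.subtype
  have h2 := sf.half Y1 fun x => by
    change (x : A) ∈ Y ↔ _
    rw [hp]
    constructor
    · intro h y hy; exact h y hy
    · intro h y hy
      rw [← hW x, ← hadj]
      exact h ⟨e y, y, rfl⟩ (adjoin_stable b.pol hz y hy)
  have hcW : Nat.card W = fcd F ^ (2 * d) := (Mu_range ψ ε).trans b.card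
  have hq : 1 < fcd F := one_lt_card
  have hcY : Nat.card Y1 = fcd F ^ d := by
    rw [natCard_eq_pow_finrank (K := F), card_eq_fintype_card] at hcW ⊢
    have := pow_right_injective hq hcW
    congr 1; omega
  have hz1 : z ≠ 1 := fun h => b.z2 (by rw [h, one_mul])
  have ho1 : orderOf z ≠ 1 := fun h => hz1 (orderOf_eq_one_iff.1 h)
  obtain ⟨p, hpp, hpd⟩ := Nat.exists_prime_and_dvd ho1
  have hdv := orderOf_dvd_of_pow_eq_one ord
  have hpos : 0 < orderOf z := Nat.pos_of_ne_zero fun h => by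
    rw [h, zero_dvd_iff] at hdv; omega
  obtain ⟨r, hr⟩ := hpd
  set z' := z ^ r with hz'
  have hz'1 : z' ≠ 1 := by
    intro h
    have h3 := orderOf_dvd_of_pow_eq_one h
    have hr0 : 0 < r := Nat.pos_of_ne_zero fun h => by rw [h] at hr; omega
    have h4 := Nat.le_of_dvd hr0 h3
    have := hpp.two_le
    nlinarith
  have hz'p : z' ^ p = 1 := by rw [hz', ← pow_mul, mul_comm, ← hr, pow_orderOf_eq_one]
  have hez' : ε * (z' - 1) = z' - 1 := by
    obtain ⟨c, hc⟩ := sub_one_dvd_pow_sub_one z r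
    rw [hz', hc, ← mul_assoc, b.ze]
  obtain ⟨w, hw⟩ := fld (z' - 1) (by rw [hez']; exact sub_ne_zero.2 hz'1)
  haveI := Fact.mk hpp
  have hz'Y : ∀ y ∈ Y, Mu ψ z' y ∈ Y := adjoin_stable (pow_mem (Algebra.self_mem_adjoin_singleton F z) r) hz
  have hz'W : ∀ y ∈ W, Mu ψ z' y ∈ W := by
    intro y hy
    refine ⟨Mu ψ z' y, ?_⟩
    have hy' : y = Mu ψ ε y := (hW ⟨y, hy⟩).symm
    conv_rhs => rw [hy']
    change (Mu ψ ε * Mu ψ z') y = (Mu ψ z' * Mu ψ ε) y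
    rw [← map_mul, ← map_mul, mul_comm]
  let f : Function.End Y1 := fun y => ⟨⟨Mu ψ z' y.1.1, hz'W _ y.1.2⟩, hz'Y _ y.2⟩
  have hf : ∀ n (y : Y1), ((f ^ n) y).1.1 = Mu ψ (z' ^ n) y.1.1 := by
    intro n; induction n with
    | zero => intro y; rw [pow_zero, pow_zero, map_one]; rfl
    | succ n ih =>
      intro y; rw [pow_succ, pow_succ, map_mul]; exact ih (f y)
  have hfp : f ^ p ^ 1 = 1 := by
    rw [pow_one]; funext y; apply Subtype.ext; apply Subtype.ext; rw [hf, hz'p, map_one]; rfl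
  have hmod := Equiv.Perm.card_fixedPoints_modEq hfp
  have hfix : fcd f.fixedPoints = 1 := by
    rw [Fintype.card_eq_one_iff]
    refine ⟨⟨0, ?_⟩, ?_⟩
    · apply Subtype.ext; apply Subtype.ext
      change Mu ψ z' 0 = 0; rw [map_zero]
    · rintro ⟨y, hy⟩
      have hy' : Mu ψ z' y.1.1 = y.1.1 := congrArg (fun t : Y1 => t.1.1) hy
      apply Subtype.ext; apply Subtype.ext; apply Subtype.ext
      change y.1.1 = 0
      rw [← hW y.1]; simp only [e]
      rw [← hw, mul_assoc, mul_comm, mul_assoc, map_mul, map_mul]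
      have : Mu ψ (z' - 1) y.1.1 = 0 := by
        rw [map_sub, map_one, lsa, hy']; exact sub_self _
      have h5 : (Mu ψ w * (Mu ψ ε * Mu ψ (z' - 1))) y.1.1 = 0 := by
        rw [End.mul_apply, End.mul_apply, this, map_zero, map_zero]
      exact h5
  rw [hfix, ← card_eq_fintype_card, hcY] at hmod
  have h6 : p ∣ fcd F ^ d - 1 := (Nat.modEq_iff_dvd' (one_le_pow _ _ (by omega))).1 hmod.symm
  have h7 : p ∣ fcd F ^ d + 1 := (Dvd.intro _ hr.symm).trans hdv
  have hev : Even (fcd F ^ d) := by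
    rw [Nat.even_pow]
    refine ⟨?_, by have := b.two; omega⟩
    have h := (FiniteField.even_card_iff_char_two (F := F)).1 (ringChar.eq F 2 ▸ rfl)
    exact Nat.even_iff.2 h
  have h8 : p ∣ 2 := by
    have := (Nat.dvd_sub h7 h6)
    have h9 : 1 ≤ fcd F ^ d := one_le_pow _ _ (by omega)
    rwa [show fcd F ^ d + 1 - (fcd F ^ d - 1) = 2 by omega] at this
  have h10 : p = 2 := (Nat.prime_dvd_prime_iff_eq hpp Nat.prime_two).1 h8
  subst h10
  rcases hev with ⟨j, hj⟩
  omega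

end QM

namespace QM
variable {F A R : Type} [Field F] [CommRing A] [Algebra F A] [CommRing R] [Algebra F R]
  {D : QM F A} {D' : QM F R} [CharP A 2] [CharP R 2] [CharP F 2] [Fintype A] [Fintype F] [Fintype R]

structure Pos (D' : QM F R) (z ε e1 : R) : Prop where
  pol : e1 ∈ adjoin F {z}
  ee : e1 * e1 = e1
  o : e1 * D'.σ e1 = 0
  s : e1 + D'.σ e1 = ε

lemma pow_inj_card {V : Type*} [AddCommGroup V] [Module F V] [Finite V] {n : ℕ} : Nat.card V = fcd F ^ n ↔
    finrank F V = n := by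
  rw [natCard_eq_pow_finrank (K := F), card_eq_fintype_card]
  exact ⟨fun h => pow_right_injective one_lt_card h, fun h => by rw [h]⟩

lemma Pos.rank {z ε e1 : R} {d : ℕ} (b : Blk D' z ε d) (p : Pos D' z ε e1) :
    finrank F (range (lmul F R e1)) = d := by
  have h1 := pow_inj_card.1 b.card
  have h2 : Nat.card (range (lmul F R e1)) = Nat.card (range (lmul F R (D'.σ e1))) := by
    apply card_congr
    refine Equiv.subtypeEquiv ⟨D'.σ, D'.σ, D'.inv, D'.inv⟩ fun a => ?_
    simp only [LinearMap.mem_range, Equiv.coe_fn_mk]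
    constructor
    · rintro ⟨y, rfl⟩; exact ⟨D'.σ y, (map_mul _ _ _).symm⟩
    · rintro ⟨y, hy⟩; exact ⟨D'.σ y, by
        rw [← D'.inv a, ← hy]; simp [D'.inv]⟩
  rw [natCard_eq_pow_finrank (K := F), card_eq_fintype_card,
    natCard_eq_pow_finrank (K := F), card_eq_fintype_card] at h2
  have h2 := pow_right_injective one_lt_card h2
  have h3 := Submodule.finrank_sup_add_finrank_inf_eq (range (lmul F R e1)) (range (lmul F R (D'.σ e1)))
  have h4 : range (lmul F R e1) ⊔ range (lmul F R (D'.σ e1)) = range (lmul F R ε) := by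
    apply le_antisymm
    · rw [sup_le_iff]
      constructor
      · rintro _ ⟨y, rfl⟩; exact ⟨e1 * y, by
          simp only [coe_lmul_eq_mul, mul_apply']
          rw [← p.s]; linear_combination y * p.ee + y * p.o⟩
      · rintro _ ⟨y, rfl⟩; exact ⟨D'.σ e1 * y, by
          simp only [coe_lmul_eq_mul, mul_apply']
          have := congrArg D'.σ p.ee
          rw [map_mul] at this
          rw [← p.s]; linear_combination y * this + y * p.o⟩
    · rintro _ ⟨y, rfl⟩
      rw [coe_lmul_eq_mul, mul_apply', ← p.s, add_mul]
      exact Submodule.add_mem_sup ⟨y, rfl⟩ ⟨y, rfl⟩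
  have h5 : range (lmul F R e1) ⊓ range (lmul F R (D'.σ e1)) = ⊥ := by
    rw [eq_bot_iff]
    rintro x ⟨⟨y, hy⟩, ⟨w, hw⟩⟩
    rw [mem_bot]
    have hy' : e1 * y = x := hy
    have hw' : D'.σ e1 * w = x := hw
    have h6 : e1 * x = x := by rw [← hy', ← mul_assoc, p.ee]
    rw [← h6, ← hw', ← mul_assoc, p.o, zero_mul]
  rw [h4, h5, finrank_bot, h1] at h3
  omega

lemma finrank_dvd (S : Subalgebra F A) [IsDomain S] (W : Submodule F A) (hW : ∀ s ∈ S, ∀ w ∈ W, s * w ∈ W) :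
    finrank F S ∣ finrank F W := by
  let W' : Submodule S A := { W with smul_mem' := fun s w hw => hW s s.2 w hw }
  have hf : IsField S := Finite.isDomain_to_isField S
  haveI : Module.Free S W' := by
    letI := hf.toField
    exact inferInstanceAs (Module.Free S W')
  have h1 : finrank F S * finrank S W' = finrank F W' := Module.finrank_mul_finrank F S W'
  exact ⟨_, h1.symm⟩

/-- generation of the full endomorphism algebra -/
lemma gen_top [Nontrivial A] (hX : D.IsX) {ψ : R ≃ₗ[F] A} (hψ : ∀ x y, D.B (ψ x) (ψ y) = D'.B x y) {Z : Set R}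
    (hneg : ∃ z ∈ Z, ∃ ε d, Blk D' z ε d ∧ (∀ a, ε * a ≠ 0 → ∃ b, a * b * ε = ε) ∧ z ^ (fcd F ^ d + 1) = 1)
    (hpos : ∀ p : ℕ, p.Prime → p ∣ finrank F A → ∃ z ∈ Z, ∃ ε e1 d, Blk D' z ε d ∧ Pos D' z ε e1 ∧ ¬ p ∣ d) :
    adjoin F (Set.range (lmul F A) ∪ (Mu ψ) '' Z) = ⊤ := by
  set S := adjoin F (Set.range (lmul F A) ∪ (Mu ψ) '' Z) with hS
  have hlS : ∀ a, lmul F A a ∈ S := fun a => Algebra.subset_adjoin (Or.inl ⟨a, rfl⟩)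
  have hzS : ∀ z ∈ Z, Mu ψ z ∈ S := fun z hz => Algebra.subset_adjoin (Or.inr ⟨z, hz, rfl⟩)
  have hirr : ∀ Y : Submodule F A, (∀ a, ∀ y ∈ Y, a * y ∈ Y) → (∀ z ∈ Z, ∀ y ∈ Y, Mu ψ z y ∈ Y) → Y = ⊥ ∨ Y = ⊤ := by
    obtain ⟨z, hz, ε, d, b, fld, ord⟩ := hneg
    intro Y h1 h2
    exact irr hX hψ b fld ord Y h1 (h2 z hz)
  let K : Subalgebra F A := (Subalgebra.centralizer F ((Mu ψ) '' Z)).comap (lmul F A)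
  have hK : ∀ x, x ∈ K ↔ ∀ z ∈ Z, ∀ v, Mu ψ z (x * v) = x * Mu ψ z v := by
    intro x
    simp only [K, Subalgebra.mem_comap, Subalgebra.mem_centralizer_iff, Set.forall_mem_image]
    refine forall₂_congr fun z hz => ?_
    rw [LinearMap.ext_iff]; rfl
  haveI : IsDomain K := by
    haveI : NoZeroDivisors K := ⟨by
      rintro ⟨x, hx⟩ ⟨y, hy⟩ hxy
      have hxy' : x * y = 0 := congrArg Subtype.val hxy
      rcases hirr (LinearMap.ker (lmul F A x)) (fun a y hy => by
          have : x * y = 0 := hy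
          change x * (a * y) = 0; rw [mul_left_comm, this, mul_zero])
        (fun z hz y hy => by
          have : x * y = 0 := hy
          change x * (Mu ψ z y) = 0
          rw [← (hK x).1 hx z hz, this, map_zero]) with h | h
      · right; apply Subtype.ext
        have : y ∈ LinearMap.ker (lmul F A x) := hxy'
        rw [h] at this; exact (mem_bot F).1 this
      · left; apply Subtype.ext
        have : (1 : A) ∈ LinearMap.ker (lmul F A x) := h ▸ mem_top
        have : x * 1 = 0 := this
        rwa [mul_one] at this⟩
    exact NoZeroDivisors.to_isDomain K
  have hK1 : finrank F K = 1 := by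
    by_contra hne
    obtain ⟨p, hp, hpd⟩ := Nat.exists_prime_and_dvd hne
    have h1 := finrank_dvd K ⊤ (fun _ _ _ _ => mem_top)
    rw [finrank_top] at h1
    obtain ⟨z, hz, ε, e1, d, b, po, hnd⟩ := hpos p hp (hpd.trans h1)
    apply hnd
    have h2 := finrank_dvd K (range (Mu ψ e1)) (by
      rintro s hs _ ⟨v, rfl⟩
      refine ⟨s * v, ?_⟩
      have : ∀ x ∈ adjoin F {z}, ∀ v, Mu ψ x (s * v) = s * Mu ψ x v := by
        intro x hx
        induction hx using adjoin_induction with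
        | mem x hx => rw [Set.mem_singleton_iff.1 hx]; exact (hK s).1 hs z hz
        | algebraMap r => intro v; rw [AlgHom.commutes]; exact (mul_smul_comm r s v).symm
        | add x y _ _ hx hy => intro v; rw [map_add, laa, laa, hx, hy, mul_add]
        | mul x y _ _ hx hy => intro v; rw [map_mul (Mu ψ), End.mul_apply, End.mul_apply, hy, hx]
      exact this e1 po.pol v)
    have h3 : finrank F (range (Mu ψ e1)) = d := by
      rw [← pow_inj_card, Mu_range, pow_inj_card]; exact po.rank b
    rw [h3] at h2
    exact hpd.trans h2
  have hKb : K = ⊥ := Subalgebra.eq_bot_of_finrank_one hK1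
  haveI : IsSimpleModule S A := by
    rw [isSimpleModule_iff]
    refine { eq_bot_or_eq_top := fun N => ?_ }
    rcases hirr (N.restrictScalars F) (fun a y hy => N.smul_mem ⟨_, hlS a⟩ hy)
      (fun z hz y hy => N.smul_mem ⟨_, hzS z hz⟩ hy) with h | h
    · left; exact (Submodule.restrictScalars_eq_bot_iff _ _ _).1 h
    · right; exact (Submodule.restrictScalars_eq_top_iff _ _ _).1 h
  have hsc : ∀ X : End S A, ∃ c : F, ∀ v, X v = c • v := by
    intro X
    have hX1 : ∀ a v, X (a * v) = a * X v := fun a v => X.map_smul ⟨_, hlS a⟩ v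
    have hX0 : ∀ a, X a = X 1 * a := fun a => by
      have := hX1 a 1; rw [mul_one] at this; rw [this, mul_comm]
    have : X 1 ∈ K := (hK _).2 fun z hz v => by
      rw [← hX0, ← hX0]; exact (X.map_smul ⟨_, hzS z hz⟩ v).symm
    rw [hKb, Algebra.mem_bot] at this
    obtain ⟨c, hc⟩ := this
    exact ⟨c, fun v => by rw [hX0, ← hc, smul_def]⟩
  rw [eq_top_iff]
  intro f _
  let g : End (End S A) A :=
    { toFun := f, map_add' := f.map_add, map_smul' := fun X v => by
        obtain ⟨c, hc⟩ := hsc X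
        simp only [End.smul_def, RingHom.id_apply]
        rw [hc, hc, map_smul] }
  haveI : Module.Finite (End S A) A := Module.Finite.of_finite
  obtain ⟨s, hs⟩ := Module.Finite.toModuleEnd_moduleEnd_surjective (R := S) (M := A) g
  have : (s : End F A) = f := by
    ext v; exact congrArg (fun h : End (End S A) A => h v) hs
  rw [← this]; exact s.2

end QM

namespace QM
variable {F A R : Type} [Field F] [CommRing A] [Algebra F A] [CommRing R] [Algebra F R]
  {D : QM F A} {D' : QM F R} [CharP A 2] [CharP R 2] [CharP F 2] [Fintype A] [Fintype F] [Fintype R]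

lemma blk_tot {ι : Type} {z ε : ι → R} {d : ι → ℕ} (I : Finset ι) (hb : ∀ i ∈ I, Blk D' (z i) (ε i) (d i)) :
    ∃ e : R, e * e = e ∧ D'.σ e = e ∧ (∀ i ∈ I, e * ε i = ε i) ∧
      finrank F (range (lmul F R e)) ≤ 2 * ∑ i ∈ I, d i := by
  induction I using Finset.induction_on with
  | empty => exact ⟨0, by simp, by simp, by simp, by rw [map_zero, LinearMap.range_zero]; simp⟩
  | insert i I hi ih =>
    obtain ⟨e, h1, h2, h3, h4⟩ := ih fun j hj => hb j (mem_insert_of_mem hj)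
    have b := hb i (mem_insert_self _ _)
    refine ⟨e + ε i * (1 - e), ?_, ?_, ?_, ?_⟩
    · linear_combination (1 - ε i) * h1 + (1 - e) ^ 2 * b.ee
    · rw [map_add, map_mul, map_sub, map_one, h2, b.st]
    · intro j hj
      rcases mem_insert.1 hj with rfl | hj
      · linear_combination (1 - e) * b.ee
      · linear_combination (1 - ε i) * h3 j hj
    · rw [Finset.sum_insert hi, mul_add]
      have h5 : range (lmul F R (e + ε i * (1 - e))) ≤
          range (lmul F R (ε i)) ⊔ range (lmul F R e) := by
        rintro _ ⟨y, rfl⟩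
        have : lmul F R (e + ε i * (1 - e)) y = ε i * ((1 - e) * y) + e * y := by
          rw [coe_lmul_eq_mul, mul_apply']; ring
        rw [this]
        exact Submodule.add_mem_sup ⟨(1 - e) * y, rfl⟩ ⟨y, rfl⟩
      have h6 := pow_inj_card.1 b.card
      calc _ ≤ _ := finrank_mono h5
        _ ≤ _ := Submodule.finrank_add_le_finrank_add_finrank _ _
        _ ≤ _ := by rw [h6]; omega

lemma card_mulLR (e : End F A) :
    Nat.card (range (mulLeftRight F (e, e))) ≤ fcd F ^ (finrank F (range e) ^ 2) := by
  have hc : Nat.card (range e →ₗ[F] range e) = fcd F ^ (finrank F (range e) ^ 2) := by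
    haveI : Finite (range e →ₗ[F] range e) := finite_of_finite F
    rw [pow_inj_card, Module.finrank_linearMap, sq]
  haveI : Finite (range e →ₗ[F] range e) := finite_of_finite F
  rw [← hc]
  let g : (range e →ₗ[F] range e) → End F A := fun f =>
    (range e).subtype ∘ₗ f ∘ₗ e.rangeRestrict
  have hsub : (range (mulLeftRight F (e, e)) : Set (End F A)) ⊆ Set.range g := by
    rintro _ ⟨X, rfl⟩
    refine ⟨e.rangeRestrict ∘ₗ X ∘ₗ (range e).subtype, ?_⟩
    ext v
    simp [g, LinearMap.mulLeftRight_apply]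
  calc Nat.card (range (mulLeftRight F (e, e))) ≤ Nat.card (Set.range g) :=
        Nat.card_mono (Set.finite_range g) hsub
    _ ≤ _ := Finite.card_range_le g

lemma blk_vec {z ε : R} {d : ℕ} (b : Blk D' z ε d) : ∃ c, ε * c = c ∧ c ≠ 0 ∧ D'.B c (z * c) = 0 := by
  let W := range (lmul F R ε)
  have hW : ∀ x ∈ W, ε * x = x := by
    rintro _ ⟨y, rfl⟩; change ε * (ε * y) = ε * y; rw [← mul_assoc, b.ee]
  let t : W →ₗ[F] R := (LinearMap.id + D'.σ.toLinearMap) ∘ₗ W.subtype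
  have ht : ∀ x : W, t x = x + D'.σ x := fun x => rfl
  let Fx : Submodule F R := W ⊓ LinearMap.ker (LinearMap.id + D'.σ.toLinearMap : R →ₗ[F] R)
  have hFx : ∀ x, x ∈ Fx ↔ x ∈ W ∧ x + D'.σ x = 0 := fun x => Iff.rfl
  have h1 := LinearMap.finrank_range_add_finrank_ker t
  have h2 : finrank F W = 2 * d := pow_inj_card.1 b.card
  have h3 : finrank F (range t) ≤ finrank F Fx := by
    apply finrank_mono
    rintro _ ⟨x, rfl⟩
    rw [hFx, ht, map_add, D'.inv]
    refine ⟨?_, by rw [add_comm (D'.σ (x:R))]; exact cse _⟩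
    refine ⟨x + D'.σ x, ?_⟩
    have := hW x x.2
    have h' := congrArg D'.σ this
    rw [map_mul, b.st] at h'
    change ε * _ = _
    rw [mul_add, this, h']
  have h4 : finrank F (LinearMap.ker t) ≤ finrank F Fx := by
    have : (LinearMap.ker t).map W.subtype ≤ Fx := by
      rintro _ ⟨x, hx, rfl⟩
      exact (hFx _).2 ⟨x.2, hx⟩
    rw [← Submodule.finrank_map_subtype_eq W (LinearMap.ker t)]
    exact finrank_mono this
  have h5 : d ≤ finrank F Fx := by omega
  let f : Fx → F := fun c => D'.B c (z * c)
  have hf : ∀ x y : Fx, f (x - y) = f x - f y := by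
    intro x y
    have hs : ∀ x : Fx, D'.σ (x : R) = x := fun x => by
      have := ((hFx x).1 x.2).2
      exact (CharTwo.add_eq_zero.1 this).symm
    have e1 : D'.B (x : R) (z * y) = D'.B (y : R) (z * x) := by
      rw [B_apply, B_apply, map_mul D'.σ, map_mul D'.σ, hs, hs]; congr 1; ring
    simp only [f, Submodule.coe_sub, mul_sub, map_sub, lsa, e1]
    have := cse (D'.B (y:R) (z * x))
    have h2 := cse (D'.B (y:R) (z * y))
    linear_combination h2 - this
  have hcard : fcd F < fcd Fx := by
    rw [← card_eq_fintype_card (α := Fx), natCard_eq_pow_finrank (K := F), card_eq_fintype_card]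
    calc fcd F = fcd F ^ 1 := (pow_one _).symm
      _ < _ := Nat.pow_lt_pow_right one_lt_card (by have := b.two; omega)
  obtain ⟨x, y, hxy, he⟩ := Fintype.exists_ne_map_eq_of_card_lt f hcard
  refine ⟨(x - y : Fx), hW _ ((hFx _).1 (x - y).2).1, ?_, ?_⟩
  · intro h; exact hxy (sub_eq_zero.1 (Subtype.ext h))
  · have := hf x y; rw [he, sub_self] at this; exact this

theorem part2 [Nontrivial A] {N N0 : ℕ} {H : Subgroup (End F A)ˣ} (hn : Num D N N0) (hG : Grp D H)
    {ψ : R ≃ₗ[F] A} (hψ : ∀ x y, D.B (ψ x) (ψ y) = D'.B x y) {ι : Type} (I : Finset ι) {z ε : ι → R} {d : ι → ℕ}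
    (hb : ∀ i ∈ I, Blk D' (z i) (ε i) (d i))
    (hneg : ∃ i ∈ I, (∀ a, ε i * a ≠ 0 → ∃ b, a * b * ε i = ε i) ∧ z i ^ (fcd F ^ d i + 1) = 1)
    (hpos : ∀ p : ℕ, p.Prime → p ∣ finrank F A → ∃ i ∈ I, ∃ e1, Pos D' (z i) (ε i) e1 ∧ ¬ p ∣ d i)
    (hN0 : fcd F ^ ((2 * ∑ i ∈ I, d i) ^ 2) ≤ N0) {y : (End F A)ˣ} (hy : y ∈ H) (k : ι → ℕ)
    (hz : ∀ i ∈ I, Mu ψ (z i) = (y : End F A) ^ k i) (hQ : ∃ b, D.Q ((y : End F A) b) ≠ D.Q b)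
    (κ : (End F A)ˣ) (hκ : ∀ a b, D.B ((κ : End F A) a) ((κ : End F A) b) = D.B a b) : κ ∈ H := by
  obtain ⟨e, h1, h2, h3, h4⟩ := blk_tot I hb
  have hez : ∀ i ∈ I, e * (z i - 1) = z i - 1 := fun i hi => by
    rw [← (hb i hi).ze, ← mul_assoc, h3 i hi]
  have hyk : ∀ i ∈ I, ((y ^ k i : (End F A)ˣ) : End F A) = Mu ψ (z i) := fun i hi => by
    rw [val_pow_eq_pow_val, hz i hi]
  have hS : Sm D H (Mu ψ e) ((fun i => y ^ k i) '' (I : Set ι)) N0 := by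
    refine ⟨by rw [← map_mul, h1], fun x y => by rw [Mu_adj hψ, h2], ?_, ?_, ?_, ?_, ?_⟩
    · rintro _ ⟨i, hi, rfl⟩; exact H.pow_mem hy _
    · rintro _ ⟨i, hi, rfl⟩; rw [hyk i hi, ← map_one (Mu ψ), ← map_sub, ← map_mul, hez i hi]
    · rintro _ ⟨i, hi, rfl⟩; rw [hyk i hi, ← map_one (Mu ψ), ← map_sub, ← map_mul, mul_comm, hez i hi]
    · refine (card_mulLR _).trans (le_trans ?_ hN0)
      apply pow_le_pow_right card_pos
      apply pow_le_pow_left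
      have : finrank F (range (Mu ψ e)) = finrank F (range (lmul F R e)) := by
        rw [← pow_inj_card, Mu_range, pow_inj_card]
      rw [this]; exact h4
    · have : (fun z : (End F A)ˣ => (z : End F A)) '' ((fun i => y ^ k i) '' (I : Set ι)) = Mu ψ '' (z '' (I : Set ι)) := by
        rw [Set.image_image, Set.image_image]
        exact Set.image_congr fun i hi => hyk i hi
      rw [this]
      apply gen_top hn.hX hψ
      · obtain ⟨i, hi, h⟩ := hneg
        exact ⟨z i, ⟨i, hi, rfl⟩, ε i, d i, hb i hi, h⟩
      · intro p hp hd
        obtain ⟨i, hi, e1, h⟩ := hpos p hp hd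
        exact ⟨z i, ⟨i, hi, rfl⟩, ε i, e1, d i, hb i hi, h⟩
  obtain ⟨i, hi, -⟩ := hneg
  have b := hb i hi
  obtain ⟨c, c1, c2, c3⟩ := blk_vec b
  have hinj : Injective (Mu ψ) := fun r r' h => by
    have := LinearMap.congr_fun h (ψ 1)
    simpa [Mu_apply] using this
  have hMc : ∀ r, Mu ψ r (ψ c) = ψ (r * c) := fun r => by rw [Mu_apply, ψ.symm_apply_apply]
  refine structural hn hG hS (y ^ k i) ⟨i, hi, rfl⟩ ?_ (ψ c) ?_ ?_ ?_ y hy hQ κ hκ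
  · intro h
    apply b.z2
    apply hinj
    have := congrArg Units.val h
    rw [val_mul, hyk i hi, ← map_mul] at this
    rw [this, map_one]; rfl
  · rw [hMc, ← c1, ← mul_assoc, h3 i hi]
  · rw [hyk i hi, hMc, hψ, c3]
  · rw [hyk i hi, hMc]
    intro h
    have h := ψ.injective h
    obtain ⟨w, hw⟩ := b.dv
    apply c2
    rw [← c1, hw]; linear_combination w * h

end QM

namespace QM
open QuadraticAlgebra Polynomial
section
variable {F K : Type} [Field F] [Field K] [Algebra F K] [CharP K 2] [Fintype K] (s : K)

noncomputable def ev {t : K} (ht : t * t + s * t + 1 = 0) : QA K s →ₐ[K] K :=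
  QuadraticAlgebra.lift ⟨t, by
    simp only [smul_eq_mul, mul_one]
    linear_combination ht - cse (s * t) - cse (1 : K)⟩

lemma ev_apply {t : K} (ht : t * t + s * t + 1 = 0) (a : QA K s) : ev s ht a = a.re + a.im * t := by
  simp [ev, smul_def, QuadraticAlgebra.lift, algebraMap_eq_smul_one]

lemma ev_star {t : K} (ht : t * t + s * t + 1 = 0) (ht' : (t + s) * (t + s) + s * (t + s) + 1 = 0) (a : QA K s) :
    ev s ht (star a) = ev s ht' a := by
  simp only [ev_apply, re_star, im_star]
  linear_combination -cse (a.im * t)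

lemma ht' {t : K} (ht : t * t + s * t + 1 = 0) : (t + s) * (t + s) + s * (t + s) + 1 = 0 := by
  linear_combination ht + cse (s * t) + cse (s * s)

lemma ev_ext (hs : s ≠ 0) {t : K} (ht : t * t + s * t + 1 = 0) {a b : QA K s} (h : ev s ht a = ev s ht b)
    (h' : ev s (ht' s ht) a = ev s (ht' s ht) b) : a = b := by
  simp only [ev_apply] at h h'
  have : (a.im - b.im) * s = 0 := by linear_combination h' - h
  rcases mul_eq_zero.1 this with h1 | h1
  · have h1 := sub_eq_zero.1 h1
    ext
    · rw [h1] at h; exact add_right_cancel h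
    · exact h1
  · exact absurd h1 hs

lemma omega_norm : norm (ω : QA K s) = 1 := by
  simp [norm_def, neg_eq]

lemma omega_pow_split (hs : s ≠ 0) {t : K} (ht : t * t + s * t + 1 = 0) : (ω : QA K s) ^ (fcd K - 1) = 1 := by
  have key : ∀ {t : K} (ht : t * t + s * t + 1 = 0), ev s ht ((ω : QA K s) ^ (fcd K - 1)) = ev s ht 1 := by
    intro t ht
    rw [map_pow, map_one]
    apply FiniteField.pow_card_sub_one_eq_one
    rw [ev_apply]
    rintro h
    simp at h
    simp [h] at ht
  exact ev_ext s hs ht (key ht) (key _)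

lemma omega_pow_inert (h : ∀ t : K, t * t + s * t + 1 ≠ 0) : (ω : QA K s) ^ (fcd K + 1) = 1 := by
  let T : Subgroup (QA K s)ˣ := (Units.map (norm : QA K s →* K)).ker
  have hT : Nat.card T = fcd K + 1 := by
    have h1 : Nat.card T = (univ.filter fun a : QA K s => norm a = 1).card := by
      rw [← card_subtype, ← card_eq_fintype_card]
      refine card_congr (Equiv.ofBijective (fun u : T => (⟨u.1.1, ?_⟩ : {a : QA K s // norm a = 1})) ⟨?_, ?_⟩)
      · simpa [Units.ext_iff] using MonoidHom.mem_ker.1 u.2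
      · intro u v h
        exact Subtype.ext (Units.ext (congrArg Subtype.val h))
      · rintro ⟨a, ha⟩
        exact ⟨⟨(norm_unit s (a := a) (by rw [ha]; exact one_ne_zero)).unit, by
          rw [MonoidHom.mem_ker]; ext; simpa using ha⟩, rfl⟩
    have := card_norm_all s
    rw [card_norm_zero_inert s h, ← h1] at this
    have h2 : 1 < fcd K := one_lt_card
    obtain ⟨c, hc⟩ := Nat.exists_eq_add_of_lt h2
    rw [hc] at this ⊢
    have : (c + 1) * (Nat.card T) = (c + 1) * (1 + c + 1 + 1) := by
      simp only [Nat.add_sub_cancel, show 1 + c + 1 - 1 = c + 1 by omega] at this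
      nlinarith
    exact eq_of_mul_eq_mul_left (by omega) this
  let w : T := ⟨(norm_unit s (a := ω) (by rw [omega_norm]; exact one_ne_zero)).unit, by
    rw [MonoidHom.mem_ker]; ext; simpa using omega_norm s⟩
  have := pow_card_eq_one' (x := w)
  rw [hT] at this
  simpa [w, Subtype.ext_iff, Units.ext_iff] using this

lemma pos_idem [Fintype F] (hs : s ≠ 0) {t : K} (ht : t * t + s * t + 1 = 0) (hd : Odd (finrank F K)) {z : QA K s}
    (hz : z * star z = 1) (hz2 : z * z ≠ 1) : ∃ f : F[X], ∃ e : QA K s, e = aeval z f ^ (fcd K - 1) ∧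
      e * e = e ∧ e * star e = 0 ∧ e + star e = 1 := by
  set ζ := ev s ht z with hζ
  set ζ' := ev s (ht' s ht) z with hζ'
  have hzz : ζ * ζ' = 1 := by
    rw [hζ', ← ev_star s ht, ← map_mul, hz, map_one]
  have hae : ∀ {t : K} (ht : t * t + s * t + 1 = 0) (f : F[X]), ev s ht (aeval z f) = aeval (ev s ht z) f := fun ht f => by
    have := aeval_algHom_apply ((ev s ht).restrictScalars F) z f
    exact this.symm
  have h0 : aeval ζ' (minpoly F ζ) ≠ 0 := by
    intro h
    obtain ⟨g, hg⟩ := minpoly.exists_algEquiv_of_root (K := F) (L := K) (Algebra.IsAlgebraic.isAlgebraic ζ) h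
    have hg' : g ζ = ζ' := by
      have h1 : g ζ' * g ζ = 1 := by rw [mul_comm, ← map_mul, hzz, map_one]
      rw [hg] at h1
      exact mul_left_cancel₀ (left_ne_zero_of_mul_eq_one hzz) (h1.trans hzz.symm)
    have hc : Odd (Nat.card Gal(K/F)) := by
      rw [IsGalois.card_aut_eq_finrank]; exact hd
    have hgp : g ^ (Nat.card Gal(K/F)) = 1 := pow_card_eq_one'
    have h2 : ∀ n, (g ^ (2 * n)) ζ = ζ := by
      intro n
      induction n with
      | zero => rfl
      | succ n ih => rw [show 2 * (n + 1) = 2 * n + 1 + 1 by ring, pow_succ, pow_succ, AlgEquiv.mul_apply, AlgEquiv.mul_apply, hg', hg, ih]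
    obtain ⟨n, hn⟩ := hc
    rw [hn, pow_succ] at hgp
    have h3 := congrArg (fun h : Gal(K/F) => h ζ') hgp
    simp only [AlgEquiv.mul_apply, hg, h2, AlgEquiv.one_apply] at h3
    apply hz2
    apply ev_ext s hs ht
    · rw [map_mul, map_one, ← hζ]; nth_rewrite 2 [h3]; exact hzz
    · rw [map_mul, map_one, ← hζ']; nth_rewrite 1 [← h3]; exact hzz
  have hcard : fcd K - 1 ≠ 0 := by have := one_lt_card (α := K); omega
  refine ⟨minpoly F ζ, _, rfl, ?_⟩
  have e1 : ev s ht (aeval z (minpoly F ζ) ^ (fcd K - 1)) = 0 := by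
    rw [map_pow, hae, ← hζ, minpoly.aeval, zero_pow hcard]
  have e2 : ev s (ht' s ht) (aeval z (minpoly F ζ) ^ (fcd K - 1)) = 1 := by
    rw [map_pow, hae, ← hζ', FiniteField.pow_card_sub_one_eq_one _ h0]
  have hst : ∀ a, ev s (ht' s ht) (star a) = ev s ht a := fun a => by rw [← ev_star s ht, star_star]
  generalize aeval z (minpoly F ζ) ^ (fcd K - 1) = e at *
  refine ⟨ev_ext s hs ht ?_ ?_, ev_ext s hs ht ?_ ?_, ev_ext s hs ht ?_ ?_⟩ <;>
    simp [ev_star s ht (ht' s ht), hst, e1, e2]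

lemma T_cyc (hs : s ≠ 0) : ∃ τ : QA K s, norm τ = 1 ∧ ∀ a : QA K s, norm a = 1 → ∃ n : ℕ, a = τ ^ n := by
  obtain ⟨t, ht⟩ : ∃ t : AlgebraicClosure K, t * t = 1 + algebraMap K _ s * t := by
    obtain ⟨t, ht⟩ := IsAlgClosed.exists_root (X ^ 2 - C (algebraMap K (AlgebraicClosure K) s) * X - 1) (by
      have : (X ^ 2 - C (algebraMap K (AlgebraicClosure K) s) * X - 1).degree = 2 := by compute_degree!
      rw [this]; decide)
    refine ⟨t, ?_⟩
    simp [IsRoot] at ht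
    linear_combination ht
  let f : QA K s →ₐ[K] AlgebraicClosure K := QuadraticAlgebra.lift ⟨t, by simp [ht, smul_def]⟩
  have hf : ∀ a, f a = algebraMap K _ a.re + algebraMap K _ a.im * t := fun a => by
    simp [f, smul_def, QuadraticAlgebra.lift]
  let T : Subgroup (QA K s)ˣ := (Units.map (norm : QA K s →* K)).ker
  have hT : ∀ a : T, norm (a.1.1) = 1 := fun a => by simpa [Units.ext_iff] using MonoidHom.mem_ker.1 a.2
  have : IsCyclic T := by
    apply isCyclic_of_injective_ringHom ((f : QA K s →* AlgebraicClosure K).comp ((Units.coeHom _).comp T.subtype))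
    rw [injective_iff_map_eq_one]
    intro a ha
    have h1 : f a.1.1 = 1 := ha
    have h2 : f (star a.1.1) = 1 := by
      have := congrArg f (algebraMap_norm_eq_mul_star (z := a.1.1))
      rw [hT, map_mul, h1, one_mul, map_one, map_one] at this
      exact this.symm
    rw [hf] at h1 h2
    simp only [re_star, im_star, map_add, map_mul, map_neg] at h2
    have h3 : (2 : AlgebraicClosure K) = 0 := by
      rw [← map_ofNat (algebraMap K _) 2, two_eq_zero, map_zero]
    have h4 : algebraMap K (AlgebraicClosure K) (s * a.1.1.im) = 0 := by
      rw [map_mul]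
      linear_combination h2 - h1 + algebraMap K _ a.1.1.im * t * h3
    have h5 : a.1.1.im = 0 := by
      have := (map_eq_zero _).1 h4
      exact (mul_eq_zero.1 this).resolve_left hs
    rw [h5, map_zero, zero_mul, add_zero] at h1
    have h6 : a.1.1.re = 1 := (algebraMap K (AlgebraicClosure K)).injective (h1.trans (map_one _).symm)
    apply Subtype.ext; apply Units.ext
    ext
    · exact h6
    · exact h5
  obtain ⟨τ, hτ⟩ := this.exists_generator
  refine ⟨τ.1.1, hT τ, fun a ha => ?_⟩
  obtain ⟨n, hn⟩ := (mem_powers_iff_mem_zpowers (x := τ)).2 (hτ ⟨(norm_unit s (a := a) (by rw [ha]; exact one_ne_zero)).unit, by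
          rw [MonoidHom.mem_ker]; ext; simpa using ha⟩)
  refine ⟨n, ?_⟩
  have := congrArg (fun u : T => u.1.1) hn
  simpa using this.symm

end
end QM

namespace QM
open QuadraticAlgebra Polynomial
section
variable {F E K : Type} [Field F] [CommRing E] [Algebra F E] [CharP E 2] [Fintype E] [IsReduced E] [Fintype F] [CharP F 2]
  [Field K] [Algebra F K] [CharP K 2] [Fintype K] {s : E} (p : E →ₐ[F] K)

noncomputable def pr : QA E s →ₐ[F] QA K (p s) where
  toFun a := ⟨p a.re, p a.im⟩
  map_one' := by ext <;> simp
  map_mul' a b := by ext <;> simp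
  map_zero' := by ext <;> simp
  map_add' a b := by ext <;> simp
  commutes' c := by
    ext
    · simp [IsScalarTower.algebraMap_apply F E (QA E s), IsScalarTower.algebraMap_apply F K (QA K (p s))]
    · simp [IsScalarTower.algebraMap_apply F E (QA E s), IsScalarTower.algebraMap_apply F K (QA K (p s))]

lemma pr_star (a : QA E s) : pr p (star a) = star (pr p a) := by
  ext <;> simp [pr]

lemma pr_omega : pr p (ω : QA E s) = ω := by
  ext <;> simp [pr]

lemma pr_surj (hp : Surjective p) : Surjective (pr (s := s) p) := fun b => by
  obtain ⟨x, hx⟩ := hp b.re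
  obtain ⟨y, hy⟩ := hp b.im
  exact ⟨⟨x, y⟩, by ext <;> simp [pr, hx, hy]⟩

lemma pr_e {e : E} (he : ∀ a, e * a = 0 ↔ p a = 0) (a : QA E s) : algebraMap E (QA E s) e * a = 0 ↔ pr p a = 0 := by
  simp only [QuadraticAlgebra.ext_iff, pr]
  simp [he]

variable (hs : IsUnit s) (ℓ : E →ₗ[F] F) (hℓ : ∀ a, (∀ b, ℓ (a * b) = 0) → a = 0)

include hs ℓ hℓ in
lemma QA_red {a : QA E s} (h : a * a = 0) : a = 0 := by
  have h1 : a * star a = 0 := by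
    rw [← algebraMap_norm_eq_mul_star]
    have : norm a * norm a = 0 := by rw [← map_mul, h]; simp [norm_def]
    rw [IsReduced.eq_zero _ ⟨2, (pow_two _).trans this⟩, map_zero]
  have h2 : a + star a = 0 := by
    rw [← algebraMap_trace_eq_add_star]
    have : trace a * trace a = 0 := by
      apply algebraMap_injective (a := 1) (b := s)
      rw [map_mul, algebraMap_trace_eq_add_star, map_zero]
      have h3 : star a * star a = 0 := by rw [← star_mul, h, star_zero]
      linear_combination h + h3 + 2 * h1
    rw [IsReduced.eq_zero _ ⟨2, (pow_two _).trans this⟩, map_zero]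
  exact (mk' s hs ℓ hℓ).red a h1 h2

variable {e Δ : E} {k d : ℕ}

structure BD (p : E →ₐ[F] K) (s e Δ : E) (k d : ℕ) : Prop where
  surj : Surjective p
  he : ∀ a, e * a = 0 ↔ p a = 0
  pe : p e = 1
  hΔ : ((ω : QA E s) ^ k - 1) ^ 2 = ω ^ k * algebraMap E (QA E s) Δ
  eΔ : e * Δ = Δ
  pΔ : p Δ ≠ 0
  card : fcd K = fcd F ^ d
  two : 2 ≤ d

variable {p} (h : BD p s e Δ k d)
local notation "ε" => algebraMap E (QA E s) e
local notation "zz" => (ω : QA E s) ^ k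
include h

lemma BD.ext (a b : QA E s) : ε * a = ε * b ↔ pr p a = pr p b := by
  rw [← sub_eq_zero, ← mul_sub, pr_e p h.he, map_sub, sub_eq_zero]

lemma BD.prε : pr p ε = 1 := by
  ext <;> simp [pr, h.pe]

lemma BD.idem : ε * ε = ε := by
  have := (h.ext ε 1).2 (by rw [h.prε, map_one])
  rwa [mul_one] at this

lemma BD.zunit : IsUnit (pr p (zz - 1)) := by
  have h1 := congrArg (pr p) h.hΔ
  have h2 : IsUnit (pr p (zz * algebraMap E (QA E s) Δ)) := by
    rw [map_mul]
    apply IsUnit.mul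
    · rw [map_pow, pr_omega]
      exact (norm_unit _ (by rw [omega_norm]; exact one_ne_zero)).pow _
    · apply norm_unit
      simp [pr, norm_def, h.pΔ]
  rw [← h1, map_pow] at h2
  exact (isUnit_pow_iff two_ne_zero).1 h2

include hs ℓ hℓ in
lemma BD.ze : ε * (zz - 1) = zz - 1 := by
  have : (1 - ε) * (zz - 1) = 0 := by
    apply QA_red hs ℓ hℓ
    have h1 : ε * algebraMap E (QA E s) Δ = algebraMap E (QA E s) Δ := by rw [← map_mul, h.eΔ]
    linear_combination (1 - ε) ^ 2 * h.hΔ - (1 - ε) * zz * h1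
  linear_combination -this

include hs ℓ hℓ in
lemma BD.pw : ∃ M, (zz - 1) ^ (M + 1) = ε := by
  obtain ⟨u, hu⟩ := h.zunit
  have h1 : u ^ (Nat.card (QA K (p s))ˣ) = 1 := pow_card_eq_one'
  obtain ⟨M, hM⟩ := exists_eq_succ_of_ne_zero (Nat.card_pos (α := (QA K (p s))ˣ)).ne'
  refine ⟨M, ?_⟩
  rw [hM] at h1
  have h2 : ε * (zz - 1) ^ (M + 1) = ε * 1 := by
    rw [h.ext, map_pow, ← hu, ← val_pow_eq_pow_val, h1, map_one, Units.val_one]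
  rw [mul_one, pow_succ', ← mul_assoc, h.ze hs ℓ hℓ] at h2
  rw [pow_succ', h2]

theorem BD.blk : Blk (mk' s hs ℓ hℓ) zz ε d := by
  obtain ⟨M, hM⟩ := h.pw hs ℓ hℓ
  have hzm : zz - 1 ∈ adjoin F {zz} :=
    sub_mem (Algebra.self_mem_adjoin_singleton F _) (one_mem _)
  refine ⟨?_, h.idem, ?_, h.ze hs ℓ hℓ, hM ▸ pow_mem hzm _, ⟨_, (hM.symm.trans (pow_succ _ _))⟩, ?_, ?_, h.two⟩
  · rw [isT_iff, map_pow]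
    simp [norm_def, neg_eq]
  · show star ε = ε
    ext <;> simp
  · have h1 : Nat.card (QA K (p s)) = fcd F ^ (2 * d) := by
      rw [card_eq_fintype_card, card_QA, h.card, ← pow_mul, mul_comm]
    rw [← h1]
    refine card_congr (Equiv.ofBijective (fun a => pr p a.1) ⟨?_, ?_⟩)
    · rintro ⟨_, a, rfl⟩ ⟨_, b, rfl⟩ hab
      apply Subtype.ext
      have := (h.ext _ _).2 hab
      simpa [← mul_assoc, h.idem] using this
    · intro b
      obtain ⟨a, rfl⟩ := pr_surj (s := s) p h.surj b
      exact ⟨⟨_, a, rfl⟩, by simp [h.prε]⟩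
  · intro h1
    have h2 : (zz - 1) * (zz - 1) = 0 := by
      linear_combination h1 - cse (zz - 1)
    have h3 := h.zunit
    rw [QA_red hs ℓ hℓ h2, map_zero, isUnit_zero_iff] at h3
    exact zero_ne_one h3

include hs ℓ hℓ in
theorem BD.neg (hi : ∀ t : K, t * t + p s * t + 1 ≠ 0) :
    (∀ a, ε * a ≠ 0 → ∃ b, a * b * ε = ε) ∧ (zz : QA E s) ^ (fcd F ^ d + 1) = 1 := by
  constructor
  · intro a ha
    rw [Ne, pr_e p h.he] at ha
    have : norm (pr p a) ≠ 0 := by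
      intro h0
      have h1 := Finset.card_le_one.1 (card_norm_zero_inert (p s) hi).le (pr p a) (by simpa using h0) 0 (by simp [norm_def])
      exact ha h1
    obtain ⟨b, hb⟩ := (norm_unit _ this).exists_right_inv
    obtain ⟨b, rfl⟩ := pr_surj (s := s) p h.surj b
    refine ⟨b, ?_⟩
    rw [mul_comm, (h.ext (a * b) 1).2 (by rw [map_mul, hb, map_one]), mul_one]
  · have h1 : ε * (zz : QA E s) ^ (fcd F ^ d + 1) = ε * 1 := by
      rw [h.ext, map_pow, map_pow, pr_omega, ← h.card, ← pow_mul, mul_comm, pow_mul, omega_pow_inert _ hi, one_pow, map_one]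
    have h2 : (1 - ε) * (zz : QA E s) = 1 - ε := by linear_combination - h.ze hs ℓ hℓ
    have h3 : ∀ n, (1 - ε) * (zz : QA E s) ^ n = 1 - ε := fun n => by
      induction n with
      | zero => simp
      | succ n ih => rw [pow_succ, ← mul_assoc, ih, h2]
    linear_combination h1 + h3 (fcd F ^ d + 1)

theorem BD.pos {t : K} (ht : t * t + p s * t + 1 = 0) (hd : Odd d) : ∃ e1, Pos (mk' s hs ℓ hℓ) zz ε e1 := by
  have hb := h.blk hs ℓ hℓ
  have hd' : Odd (finrank F K) := by
    rwa [pow_inj_card.1 (by rw [card_eq_fintype_card, h.card])]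
  have hps : p s ≠ 0 := (hs.map p).ne_zero
  obtain ⟨f, e0, h0, h1, h2, h3⟩ := pos_idem (p s) hps ht hd' (z := pr p zz) (by
    rw [← pr_star, ← map_mul]
    exact (congrArg (pr p) hb.T).trans (map_one _)) (by
    intro h1
    have h3 := h.zunit
    have h4 : pr p (zz - 1) * pr p (zz - 1) = 0 := by
      rw [map_sub, map_one]
      linear_combination h1 - cse (pr p zz - 1)
    rw [h3.mul_right_eq_zero, ← map_zero (pr p)] at h4
    rw [h4, map_zero, isUnit_zero_iff] at h3
    exact zero_ne_one h3)
  have h4 : pr p (aeval zz f ^ (fcd K - 1)) = e0 := by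
    rw [h0, map_pow, aeval_algHom_apply]
  set x := aeval zz f ^ (fcd K - 1) with hx
  have hxm : x ∈ adjoin F {zz} := pow_mem (aeval_mem_adjoin_singleton _ _) _
  have hst : star (ε * x) = ε * star x := by
    rw [star_mul, mul_comm]; congr 1; ext <;> simp
  refine ⟨ε * x, mul_mem hb.pol hxm, ?_, ?_, ?_⟩
  · have := (h.ext (x * x) x).2 (by rw [map_mul, h4, h1])
    linear_combination this + x * x * h.idem
  · show _ * star _ = (0 : QA E s)
    have := (pr_e p h.he (x * star x)).2 (by rw [map_mul, pr_star, h4, h2])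
    rw [hst]
    linear_combination this + x * star x * h.idem
  · show _ + star _ = ε
    have := (h.ext (x + star x) 1).2 (by rw [map_add, pr_star, h4, h3, map_one])
    rw [hst]
    linear_combination this

end
end QM

namespace QM
open QuadraticAlgebra Polynomial
section
variable {F : Type} [Field F]

class MP (g : F[X]) : Prop where
  monic : g.Monic
  deg : g.natDegree ≠ 0
  sq : Squarefree g
  X : ¬ X ∣ g

lemma MP.of_dvd {g P : F[X]} [MP g] (hP : P.Monic) (h : P ∣ g) (hi : Irreducible P) : MP P :=
  ⟨hP, hi.natDegree_pos.ne', (MP.sq (g := g)).squarefree_of_dvd h, fun h' => MP.X (g := g) (h'.trans h)⟩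

section
variable [Fintype F] [CharP F 2] (g : F[X]) [MP g]

noncomputable instance : Fintype (AdjoinRoot g) :=
  have := (MP.monic (g := g)).finite_adjoinRoot
  have := finite_of_finite F (M := AdjoinRoot g)
  ofFinite _

instance : Nontrivial (AdjoinRoot g) := AdjoinRoot.nontrivial (f := g) fun h => MP.deg (g := g) (natDegree_eq_of_degree_eq_some h)

instance : CharP (AdjoinRoot g) 2 := charP_of_injective_algebraMap (algebraMap F (AdjoinRoot g)).injective 2

instance : IsReduced (AdjoinRoot g) := by
  constructor
  rintro x ⟨n, hx⟩
  obtain ⟨f, rfl⟩ := mk_surjective x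
  rw [← map_pow, mk_eq_zero] at hx
  rw [mk_eq_zero]
  by_cases hn : n = 0
  · subst hn; exact (dvd_trans hx (by simp))
  · exact (MP.sq.dvd_pow_iff_dvd hn).1 hx

lemma card_AR : fcd (AdjoinRoot g) = fcd F ^ g.natDegree := by
  have := (MP.monic (g := g)).finite_adjoinRoot
  rw [← card_eq_fintype_card, pow_inj_card]
  rw [PowerBasis.finrank (AdjoinRoot.powerBasis' MP.monic)]
  rfl

lemma root_unit : IsUnit (root g) := by
  have : IsCoprime (X : F[X]) g := (irreducible_X.coprime_iff_not_dvd).2 MP.X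
  obtain ⟨u, v, h⟩ := this
  refine IsUnit.of_mul_eq_one (AdjoinRoot.mk g u) ?_
  have := congrArg (AdjoinRoot.mk g) h
  simp at this
  rw [mul_comm, this]

noncomputable def lg : AdjoinRoot g →ₗ[F] F := (lcoeff F (g.natDegree - 1)).comp (AdjoinRoot.modByMonicHom MP.monic)

lemma lg_nd (a : AdjoinRoot g) (h : ∀ b, lg g (a * b) = 0) : a = 0 := by
  by_contra ha
  set f := AdjoinRoot.modByMonicHom (MP.monic (g := g)) a with hf
  have hfa : AdjoinRoot.mk g f = a := AdjoinRoot.mk_leftInverse MP.monic a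
  have hf0 : f ≠ 0 := by rintro h0; rw [h0, map_zero] at hfa; exact ha hfa.symm
  have hfd : f.natDegree < g.natDegree := by
    obtain ⟨f', hf'⟩ := mk_surjective a
    rw [hf, ← hf', AdjoinRoot.modByMonicHom_mk]
    exact natDegree_modByMonic_lt _ MP.monic (fun h1 => MP.deg (g := g) (by rw [h1, natDegree_one]))
  have := h (AdjoinRoot.mk g (X ^ (g.natDegree - 1 - f.natDegree)))
  rw [← hfa, ← map_mul, lg, comp_apply, AdjoinRoot.modByMonicHom_mk, (modByMonic_eq_self_iff MP.monic).2, lcoeff_apply] at this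
  · obtain ⟨j, hj⟩ : ∃ j, g.natDegree - 1 = f.natDegree + j := ⟨_, (Nat.add_sub_cancel' (by omega)).symm⟩
    rw [hj, Nat.add_sub_cancel_left, coeff_mul_X_pow] at this
    · exact hf0 (leadingCoeff_eq_zero.1 this)
  · rw [degree_mul, degree_X_pow, degree_eq_natDegree hf0, degree_eq_natDegree (MP.monic (g := g)).ne_zero]
    norm_cast; omega

noncomputable abbrev Dg : QM F (QA (AdjoinRoot g) (root g)) := mk' _ (root_unit g) (lg g) (lg_nd g)

end

noncomputable def Dl (F : Type) [Field F] (k : ℕ) : F[X] := dickson 1 (1 : F) k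

lemma Dl_spec {E : Type} [CommRing E] [Algebra F E] [CharP E 2] (s : E) (k : ℕ) :
    ((ω : QA E s) ^ k - 1) ^ 2 = ω ^ k * algebraMap E (QA E s) (aeval s (Dl F k)) := by
  have h1 : (ω : QA E s) * star ω = 1 := by
    rw [← algebraMap_norm_eq_mul_star]; simp [norm_def, neg_eq]
  have h2 : (ω : QA E s) + star ω = algebraMap E _ s := by
    rw [← algebraMap_trace_eq_add_star]; simp [trace_def]
  have h3 := dickson_one_one_eval_add_inv (ω : QA E s) (star ω) h1 k
  have h4 : algebraMap E (QA E s) (aeval s (Dl F k)) = (dickson 1 (1 : QA E s) k).eval ((ω : QA E s) + star ω) := by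
    rw [h2, ← aeval_algebraMap_apply, Dl, aeval_def, eval₂_eq_eval_map, map_dickson, map_one]
  rw [h4, h3, mul_add, ← mul_pow ω (star ω), h1, one_pow]
  linear_combination - cse ((ω : QA E s) ^ k)

lemma Dl_deg {k : ℕ} (hk : k ≠ 0) : (Dl F k).natDegree = k ∧ (Dl F k).Monic := by
  have h2 : ∀ k : ℕ, (Dl F (k + 1)).Monic ∧ (Dl F (k + 1)).natDegree = k + 1 ∧ (Dl F (k + 2)).Monic ∧ (Dl F (k + 2)).natDegree = k + 2 := by
    intro k
    induction k with
    | zero =>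
      have : Dl F (0 + 2) = X ^ 2 - C 2 := by
        rw [Dl, zero_add, dickson_two]
        simp only [map_one, one_mul, map_ofNat]; push_cast; ring
      have h1 : Dl F (0 + 1) = X := by rw [Dl, zero_add, dickson_one]
      rw [this, h1]
      exact ⟨monic_X, natDegree_X, by monicity!, by compute_degree!⟩
    | succ k ih =>
      obtain ⟨h1, h2, h3, h4⟩ := ih
      have h5 : Dl F (k + 1 + 2) = X * Dl F (k + 2) - Dl F (k + 1) := by
        simp only [Dl]; rw [dickson_add_two, map_one, one_mul]
      have h6 : (Dl F (k + 1)).degree < (X * Dl F (k + 2)).degree := by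
        rw [degree_mul, degree_X, degree_eq_natDegree h1.ne_zero, degree_eq_natDegree h3.ne_zero, h2, h4]
        norm_cast; omega
      refine ⟨h3, h4, ?_, ?_⟩
      · rw [h5]; exact (monic_X.mul h3).sub_of_left h6
      · rw [h5, natDegree_sub_eq_left_of_natDegree_lt (natDegree_lt_natDegree h1.ne_zero h6), monic_X.natDegree_mul h3, h4, natDegree_X]; ring
  obtain ⟨k, rfl⟩ := exists_eq_succ_of_ne_zero hk
  exact ⟨(h2 k).2.1, (h2 k).1⟩

variable [Fintype F] [CharP F 2]

lemma Dl_dvd (P : F[X]) [MP P] (n : ℕ) : P ∣ Dl F n ↔ (ω : QA (AdjoinRoot P) (root P)) ^ n = 1 := by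
  have h := Dl_spec (F := F) (root P) n
  rw [aeval_eq] at h
  rw [← mk_eq_zero]
  constructor
  · intro h1
    rw [h1, map_zero, mul_zero, pow_two] at h
    exact sub_eq_zero.1 (QA_red (root_unit P) (lg P) (lg_nd P) h)
  · intro h1
    rw [h1, sub_self, one_mul, zero_pow two_ne_zero] at h
    exact algebraMap_injective (h.symm.trans (map_zero _).symm)

def IsoP (P g : F[X]) (k : ℕ) : Prop := g ∣ P * Dl F k ∧ ¬ P ∣ Dl F k

theorem mkBD {g P : F[X]} [MP g] [MP P] [Fact (Irreducible P)] (hPg : P ∣ g) {k : ℕ} (hk : IsoP P g k) (h2 : 2 ≤ P.natDegree) :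
    ∃ e, BD (algHomOfDvd F g P hPg) (root g) e (aeval (root g) (Dl F k)) k P.natDegree := by
  obtain ⟨R, hR⟩ := id hPg
  have hcop : IsCoprime R P := by
    have := MP.sq (g := g)
    rw [hR, mul_comm] at this
    exact (squarefree_mul_iff.1 this).1.isCoprime
  obtain ⟨u, v, huv⟩ := hcop
  have hP0 : P ≠ 0 := MP.monic.ne_zero
  have hp : ∀ f, algHomOfDvd F g P hPg (AdjoinRoot.mk g f) = AdjoinRoot.mk P f := fun f => by
    rw [← aeval_eq, ← aeval_algHom_apply, algHomOfDvd_root, aeval_eq]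
  refine ⟨AdjoinRoot.mk g (u * R), ?_, ?_, ?_, Dl_spec _ k, ?_, ?_, card_AR P, h2⟩
  · intro b
    obtain ⟨f, rfl⟩ := mk_surjective b
    exact ⟨_, hp f⟩
  · intro a
    obtain ⟨f, rfl⟩ := mk_surjective a
    rw [hp, ← map_mul, mk_eq_zero, mk_eq_zero, hR]
    constructor
    · intro h
      have h3 : P ∣ u * R * f := (dvd_mul_right _ _).trans h
      have : f = u * R * f + P * (v * f) := by linear_combination -f * huv
      rw [this]; exact dvd_add h3 (dvd_mul_right _ _)
    · rintro ⟨f, rfl⟩; exact ⟨u * f, by ring⟩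
  · rw [hp, ← map_one (AdjoinRoot.mk P), AdjoinRoot.mk_eq_mk]
    exact ⟨-v, by linear_combination huv⟩
  · rw [aeval_eq, ← map_mul, AdjoinRoot.mk_eq_mk]
    obtain ⟨w, hw⟩ := hk.1
    exact ⟨-v * w, by linear_combination -v * hw + Dl F k * huv⟩
  · rw [aeval_eq, hp, Ne, mk_eq_zero]; exact hk.2

end
end QM

namespace QM
open QuadraticAlgebra Polynomial
section
variable {F : Type} [Field F] [Fintype F] [CharP F 2] {m : ℕ}

def HasType (g : F[X]) [MP g] (y : SpG m F) : Prop :=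
  ∃ φ : V0 F m ≃ₗ[F] QA (AdjoinRoot g) (root g), (∀ x y, (Dg g).B (φ x) (φ y) = B0 F m x y) ∧
    ∀ v, φ (y.1.mulVec v) = ω * φ v

omit [Fintype F] [CharP F 2] in
lemma conj_mulVec (h y : SpG m F) (v : V0 F m) : (h * y * h⁻¹).1.mulVec (h.1.mulVec v) = h.1.mulVec (y.1.mulVec v) := by
  rw [mulVec_mulVec, mulVec_mulVec, ← Submonoid.coe_mul, ← Submonoid.coe_mul]; simp

lemma HasType.conj {g : F[X]} [MP g] {y : SpG m F} (hy : HasType g y) (h : SpG m F) : HasType g (h * y * h⁻¹) := by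
  obtain ⟨φ, h1, h2⟩ := hy
  let L : V0 F m ≃ₗ[F] V0 F m := LinearMap.GeneralLinearGroup.toLinearEquiv (rho (LinearEquiv.refl F (V0 F m)) h)
  have hL : ∀ v, L v = h.1.mulVec v := fun v => rfl
  refine ⟨L.symm.trans φ, fun x y => ?_, fun v => ?_⟩
  · obtain ⟨x, rfl⟩ := L.surjective x
    obtain ⟨y, rfl⟩ := L.surjective y
    simp only [trans_apply, symm_apply_apply]
    rw [h1, hL, hL, (mem_Sp_iff h.1).1 h.2]
  · obtain ⟨v, rfl⟩ := L.surjective v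
    simp only [trans_apply, symm_apply_apply]
    rw [hL, conj_mulVec, ← hL, symm_apply_apply, h2]

def pos (P : F[X]) : Prop := ∃ t : AdjoinRoot P, t * t + root P * t + 1 = 0

structure GoodI (m : ℕ) (g : F[X]) (I : Finset F[X]) : Prop where
  a : ∀ P ∈ I, P.Monic ∧ Irreducible P ∧ P ∣ g ∧ 2 ≤ P.natDegree ∧ ∃ k, IsoP P g k
  neg : ∃ P ∈ I, ¬ pos P
  pos : ∀ p : ℕ, p.Prime → p ∣ 2 * m → ∃ P ∈ I, pos P ∧ Odd P.natDegree ∧ ¬ p ∣ P.natDegree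
  sm : 41 + 32 * (∑ P ∈ I, P.natDegree) ^ 2 ≤ m

structure XM (K : Type) [Field K] [Fintype K] [Algebra F K] [CharP K 2] (m : ℕ) (s : K) (x : SpG m F) (D : QM F (QA K s))
    (φ : V0 F m ≃ₗ[F] QA K s) : Prop where
  s0 : s ≠ 0
  card : fcd K = fcd F ^ m
  σ : ∀ a : QA K s, D.IsT a ↔ QuadraticAlgebra.norm a = 1
  isX : D.IsX
  iso : ∀ x y, D.B (φ x) (φ y) = B0 F m x y
  gx : ∃ τ : QA K s, (∀ a : QA K s, QuadraticAlgebra.norm a = 1 → ∃ n : ℕ, a = τ ^ n) ∧ ∀ v, φ (x.1.mulVec v) = τ * φ v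

theorem gen {K : Type} [Field K] [Fintype K] [Algebra F K] [CharP K 2] {s : K} {x : SpG m F} {D : QM F (QA K s)}
    {φ : V0 F m ≃ₗ[F] QA K s} (hX : XM K m s x D φ) {g : F[X]} [MP g] {I : Finset F[X]} (hI : GoodI m g I)
    {y : SpG m F} (hy : HasType g y) (hQ : ∀ h : SpG m F, ∃ v, D.Q (φ ((h * y * h⁻¹).1.mulVec v)) ≠ D.Q (φ v)) : InvGen x y := by
  have main : ∀ y : SpG m F, HasType g y → (∃ v, D.Q (φ (y.1.mulVec v)) ≠ D.Q (φ v)) → Subgroup.closure {x, y} = ⊤ := by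
    clear hQ hy y
    rintro y ⟨φ', hφ', hy⟩ ⟨v, hv⟩
    have key : ∀ P : F[X], ∃ k : ℕ, ∃ e, P ∈ I → (Blk (Dg g) (ω ^ k) e P.natDegree ∧
        (¬ QM.pos P → (∀ a, e * a ≠ 0 → ∃ b, a * b * e = e) ∧ (ω ^ k) ^ (fcd F ^ P.natDegree + 1) = (1 : QA (AdjoinRoot g) (root g))) ∧
        (QM.pos P → Odd P.natDegree → ∃ e1, Pos (Dg g) (ω ^ k) e e1)) := by
      intro P
      by_cases hP : P ∈ I
      · obtain ⟨h1, h2, h3, h4, k, h5⟩ := hI.a P hP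
        have := MP.of_dvd h1 h3 h2
        have := Fact.mk h2
        obtain ⟨e, he⟩ := mkBD h3 h5 h4
        refine ⟨k, _, fun _ => ⟨he.blk (root_unit g) (lg g) (lg_nd g), fun h => he.neg (root_unit g) (lg g) (lg_nd g) ?_, ?_⟩⟩
        · intro t ht
          rw [algHomOfDvd_root] at ht
          exact h ⟨t, ht⟩
        · rintro ⟨t, ht⟩ ho
          exact he.pos (root_unit g) (lg g) (lg_nd g) (t := t) (by rwa [algHomOfDvd_root]) ho
      · exact ⟨0, 0, fun h => absurd h hP⟩
    choose k e hke using key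
    let H := (Subgroup.closure {x, y}).map (rho φ)
    obtain ⟨τ, hτ, hxτ⟩ := hX.gx
    have hqpos : 2 ≤ fcd F := one_lt_card
    have hG : Grp D H := by
      refine ⟨?_, ?_⟩
      · rintro _ ⟨M, _, rfl⟩ a b
        exact rho_iso hX.iso M a b
      · intro a ha
        obtain ⟨n, rfl⟩ := hτ a ((hX.σ a).1 ha)
        refine ⟨x ^ n, pow_mem (Subgroup.subset_closure (by simp)) _, ?_⟩
        apply Units.ext; apply LinearMap.ext; intro b
        show _ = τ ^ n * b
        rw [map_pow, val_pow_eq_pow_val]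
        clear ha
        induction n with
        | zero => simp
        | succ n ih =>
          rw [pow_succ', End.mul_apply, ih, rho_apply, hxτ, apply_symm_apply, pow_succ', mul_assoc]
    have hfr : finrank F (QA K s) = 2 * m := by
      rw [← pow_inj_card, card_eq_fintype_card, card_QA, hX.card, ← pow_mul, mul_comm]
    have hS1 : 2 ≤ (2 * ∑ P ∈ I, P.natDegree) ^ 2 := by
      obtain ⟨P, hP, _⟩ := hI.neg
      have := Finset.single_le_sum (f := fun P : F[X] => P.natDegree) (fun _ _ => Nat.zero_le _) hP
      have := (hI.a P hP).2.2.2.1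
      nlinarith
    have hn : Num D (2 * fcd F ^ 4 * fcd F ^ ((2 * ∑ P ∈ I, P.natDegree) ^ 2)) (fcd F ^ ((2 * ∑ P ∈ I, P.natDegree) ^ 2)) := by
      have hT : fcd K ≤ D.Tf.card + 1 := by
        have := card_T_ge s hX.s0
        have h2 : D.Tf.card = (univ.filter fun a : QA K s => norm a = 1).card := by
          congr 1; ext a; simp [mem_Tf, hX.σ]
        rwa [h2]
      have h2 : 2 ≤ fcd F ^ ((2 * ∑ P ∈ I, P.natDegree) ^ 2) := hqpos.trans (Nat.le_self_pow (by omega) _)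
      refine ⟨hX.isX, ?_, ?_, ?_, h2, le_rfl⟩
      · rw [card_QA]; exact pow_le_pow_left hT 2
      · have : 1 ≤ fcd F ^ 4 := one_le_pow _ _ (by omega)
        nlinarith
      · have h3 : 2 * fcd F ^ 4 * fcd F ^ ((2 * ∑ P ∈ I, P.natDegree) ^ 2) ≤ fcd F ^ (5 + 4 * (∑ P ∈ I, P.natDegree) ^ 2) := by
          rw [show 5 + 4 * (∑ P ∈ I, P.natDegree) ^ 2 = 1 + 4 + (2 * ∑ P ∈ I, P.natDegree) ^ 2 by ring, pow_add, pow_add, pow_one]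
          gcongr
        have h4 := pow_le_pow_left h3 8
        rw [← pow_mul] at h4
        have h5 : fcd F ^ ((5 + 4 * (∑ P ∈ I, P.natDegree) ^ 2) * 8) * 2 ≤ fcd F ^ m := by
          refine le_trans ?_ (pow_le_pow_right (by omega : 0 < fcd F) hI.sm)
          rw [show 41 + 32 * (∑ P ∈ I, P.natDegree) ^ 2 = (5 + 4 * (∑ P ∈ I, P.natDegree) ^ 2) * 8 + 1 by ring, pow_succ]
          exact Nat.mul_le_mul_left _ hqpos
        rw [← hX.card] at h5
        have h6 : 1 ≤ fcd F ^ ((5 + 4 * (∑ P ∈ I, P.natDegree) ^ 2) * 8) := one_le_pow _ _ (by omega)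
        omega
    rw [eq_top_iff]
    intro M _
    have hp := part2 hn hG (ψ := φ'.symm.trans φ) (D' := Dg g) (by
        intro a b
        obtain ⟨a, rfl⟩ := φ'.surjective a
        obtain ⟨b, rfl⟩ := φ'.surjective b
        simp [hX.iso, hφ']) I (z := fun P => ω ^ k P) (ε := e) (d := fun P => P.natDegree)
        (fun P hP => (hke P hP).1) (by
          obtain ⟨P, hP, h⟩ := hI.neg
          exact ⟨P, hP, (hke P hP).2.1 h⟩) (by
          intro p hp hpd
          rw [hfr] at hpd
          obtain ⟨P, hP, h1, h2, h3⟩ := hI.pos p hp hpd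
          obtain ⟨e1, he1⟩ := (hke P hP).2.2 h1 h2
          exact ⟨P, hP, e1, he1, h3⟩) le_rfl (y := rho φ y) ⟨y, Subgroup.subset_closure (by simp), rfl⟩ k (by
          intro P hP
          rw [map_pow]
          congr 1
          apply LinearMap.ext; intro a
          obtain ⟨a, rfl⟩ := φ.surjective a
          rw [rho_apply, Mu_apply]
          simp [← hy]) ⟨φ v, by rw [rho_apply]; simpa using hv⟩ (rho φ M) (fun a b => rho_iso hX.iso M a b)
    obtain ⟨M', hM', h⟩ := hp
    rwa [← rho_inj φ h]
  intro g' h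
  have h1 := main _ (hy.conj (g'⁻¹ * h)) (hQ _)
  rw [eq_top_iff]
  intro M _
  have h2 : g'⁻¹ * M * g' ∈ Subgroup.closure {x, g'⁻¹ * h * y * (g'⁻¹ * h)⁻¹} := h1 ▸ Subgroup.mem_top _
  have h3 := Subgroup.mem_map_of_mem (MulAut.conj g').toMonoidHom h2
  rw [MonoidHom.map_closure, Set.image_pair] at h3
  have e1 : (MulAut.conj g').toMonoidHom (g'⁻¹ * M * g') = M := by simp [mul_assoc]
  have e2 : (MulAut.conj g').toMonoidHom (g'⁻¹ * h * y * (g'⁻¹ * h)⁻¹) = h * y * h⁻¹ := by simp [mul_assoc]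
  rw [e1, e2] at h3
  exact h3

end
end QM

namespace QM
open QuadraticAlgebra Polynomial
section
variable {F : Type} [Field F] [Fintype F] [CharP F 2] {m : ℕ}

lemma exXM {K : Type} [Field K] [Fintype K] [Algebra F K] [CharP K 2] (hc : fcd K = fcd F ^ m) {s : K} (hs : s ≠ 0)
    (ℓ : K →ₗ[F] F) (hℓ : ∀ a, (∀ b, ℓ (a * b) = 0) → a = 0) :
    ∃ x φ, XM K m s x (mk' s hs.isUnit ℓ hℓ) φ := by
  have : FiniteDimensional F (QA K s) := Module.Finite.of_finite
  obtain ⟨φ, hφ⟩ := exists_isom (2 * m) (B0_SF (F := F) (m := m)) (mk' s hs.isUnit ℓ hℓ).sfB (by simp; ring) (by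
    rw [← pow_inj_card, card_eq_fintype_card, card_QA, hc, ← pow_mul, mul_comm])
  obtain ⟨τ, h1, h2⟩ := T_cyc s hs
  have hT : (mk' s hs.isUnit ℓ hℓ).IsT τ := (isT_iff s _ ℓ hℓ τ).2 h1
  obtain ⟨x, hx⟩ := rho_surj hφ (mT τ hT) (fun a b => B_T _ hT a b)
  refine ⟨x, φ, hs, hc, isT_iff s _ ℓ hℓ, isX s _ ℓ hℓ, hφ, τ, h2, fun v => ?_⟩
  have := congrArg (fun u : (End F (QA K s))ˣ => (u : End F (QA K s)) (φ v)) hx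
  simp only [rho_apply, symm_apply_apply] at this
  exact this

lemma exs (K : Type) [Field K] [Fintype K] [CharP K 2] (hK : 2 < fcd K) : ∃ s₁ s₂ t : K, s₁ ≠ 0 ∧ s₂ ≠ 0 ∧
    (∀ t : K, t * t + s₁ * t + 1 ≠ 0) ∧ t * t + s₂ * t + 1 = 0 := by
  have h2 : (1 : K) + 1 = 0 := cse 1
  obtain ⟨s₁, h1⟩ : ∃ s₁ : K, ∀ t : K, t * t + s₁ * t + 1 ≠ 0 := by
    by_contra! h
    choose f hf using h
    have hi : Injective f := by
      intro a b hab
      have ha := hf a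
      have hb := hf b
      rw [← hab] at hb
      have h0 : f a ≠ 0 := by intro h0; simp [h0] at ha
      exact mul_right_cancel₀ h0 (by linear_combination ha - hb)
    obtain ⟨a, ha⟩ := (Finite.injective_iff_surjective.1 hi) 0
    have := hf a
    simp [ha] at this
  obtain ⟨t, ht⟩ : ∃ t : K, t ∉ ({0, 1} : Finset K) := by
    by_contra! h
    have := card_le_card (s := univ) (t := ({0, 1} : Finset K)) (fun t _ => h t)
    have h3 := Finset.card_le_two (a := (0 : K)) (b := 1)
    rw [card_univ] at this; omega
  simp only [mem_insert, mem_singleton, not_or] at ht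
  refine ⟨s₁, t + t⁻¹, t, ?_, ?_, h1, ?_⟩
  · rintro rfl; exact h1 1 (by linear_combination h2)
  · intro h
    have h3 : (t + 1) * (t + 1) = 0 := by
      have : t * (t + t⁻¹) = 0 := by rw [h, mul_zero]
      rw [mul_add, mul_inv_cancel₀ ht.1] at this
      linear_combination this + t * h2
    have h4 := mul_self_eq_zero.1 h3
    exact ht.2 (by linear_combination h4 - h2)
  · have : t⁻¹ * t = 1 := inv_mul_cancel₀ ht.1
    linear_combination this + h2 * (1 + t * t)

lemma qeq {y : SpG m F} (hs : ∀ v : V0 F m, ∃ u, v = y.1.mulVec u + u) {q1 q2 : V0 F m → F}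
    (h1 : ∀ u v, q1 (u + v) = q1 u + q1 v + B0 F m u v) (h2 : ∀ u v, q2 (u + v) = q2 u + q2 v + B0 F m u v)
    (i1 : ∀ v, q1 (y.1.mulVec v) = q1 v) (i2 : ∀ v, q2 (y.1.mulVec v) = q2 v) : q1 = q2 := by
  funext v
  obtain ⟨u, rfl⟩ := hs v
  rw [h1, h2, i1, i2]
  linear_combination cse (q1 u) - cse (q2 u)

lemma HasType.surj {g : F[X]} [MP g] {y : SpG m F} (hy : HasType g y) (v : V0 F m) : ∃ u, v = y.1.mulVec u + u := by
  obtain ⟨φ, _, h⟩ := hy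
  have h1 := Dl_spec (F := F) (root g) 1
  have h2 : IsUnit ((ω : QA (AdjoinRoot g) (root g)) ^ 1 - 1) := by
    rw [← isUnit_pow_iff two_ne_zero, h1]
    refine IsUnit.mul ?_ ?_
    · rw [isUnit_iff_norm_isUnit]; simp [norm_def, neg_eq]
    · apply IsUnit.map
      simp [Dl, root_unit]
  obtain ⟨w, hw⟩ := h2.exists_right_inv
  refine ⟨φ.symm (w * φ v), φ.injective ?_⟩
  rw [map_add, h, apply_symm_apply]
  have h3 : (1 : QA (AdjoinRoot g) (root g)) + 1 = 0 := cse 1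
  linear_combination -φ v * hw - w * φ v * h3

lemma cardq (A : Type) [AddCommGroup A] [Module F A] [Fintype A] (φ : V0 F m ≃ₗ[F] A) (q : A → F) (h : SpG m F) :
    Nat.card {v // q (φ (h.1.mulVec v)) = 0} = (univ.filter fun a : A => q a = 0).card := by
  rw [← card_subtype, ← card_eq_fintype_card]
  let L : V0 F m ≃ₗ[F] V0 F m := LinearMap.GeneralLinearGroup.toLinearEquiv (rho (LinearEquiv.refl F (V0 F m)) h)
  exact card_congr ((L.trans φ).toEquiv.subtypeEquiv fun v => Iff.rfl)

theorem exA (hm : 2 ≤ m) : ∃ A : Finset (SpG m F), A.card ≤ 2 ∧ ∀ (g : F[X]) [MP g] (I : Finset F[X]), GoodI m g I →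
    ∀ y : SpG m F, HasType g y → ∃ x ∈ A, InvGen x y := by
  have : NeZero m := ⟨by omega⟩
  let K := FiniteField.Extension F 2 m
  let _ : Fintype K := ofFinite K
  have : CharP K 2 := charP_of_injective_algebraMap (algebraMap F K).injective 2
  have hc : fcd K = fcd F ^ m := by
    rw [← card_eq_fintype_card, FiniteField.natCard_extension, card_eq_fintype_card]
  obtain ⟨s₁, s₂, t, h1, h2, h3, h4⟩ := exs K (by
    rw [hc]
    have := one_lt_card (α := F)
    calc 2 < 2 ^ 2 := by norm_num
      _ ≤ fcd F ^ 2 := pow_le_pow_left this 2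
      _ ≤ _ := pow_le_pow_right (by omega) hm)
  let ℓ := Algebra.trace F K
  have hℓ0 : ℓ ≠ 0 := Algebra.trace_ne_zero F K
  have hℓ : ∀ a, (∀ b, ℓ (a * b) = 0) → a = 0 := by
    intro a ha
    by_contra h
    apply hℓ0
    ext c
    have := ha (a⁻¹ * c)
    rwa [mul_inv_cancel_left₀ h] at this
  obtain ⟨x1, φ1, hx1⟩ := exXM hc h1 ℓ hℓ
  obtain ⟨x2, φ2, hx2⟩ := exXM hc h2 ℓ hℓ
  refine ⟨{x1, x2}, Finset.card_le_two, fun g _ I hI y hy => ?_⟩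
  by_contra! hcon
  have e1 := fun h => hcon x1 (by simp) (gen hx1 hI hy h)
  have e2 := fun h => hcon x2 (by simp) (gen hx2 hI hy h)
  obtain ⟨k1, e1⟩ := not_forall.1 e1
  obtain ⟨k2, e2⟩ := not_forall.1 e2
  push Not at e1 e2
  have key : ∀ {s : K} {x : SpG m F} {D : QM F (QA K s)} {φ : V0 F m ≃ₗ[F] QA K s} (hX : XM K m s x D φ) (k : SpG m F),
      (∀ u v, D.Q (φ (k.1.mulVec (u + v))) = D.Q (φ (k.1.mulVec u)) + D.Q (φ (k.1.mulVec v)) + B0 F m u v) := by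
    intro s x D φ hX k u v
    rw [Matrix.mulVec_add, map_add, D.Q_add, ← D.B_apply, hX.iso, (mem_Sp_iff k.1).1 k.2]
  have := qeq hy.surj (q1 := fun v => (mk' s₁ h1.isUnit ℓ hℓ).Q (φ1 (k1.1.mulVec v))) (q2 := fun v => (mk' s₂ h2.isUnit ℓ hℓ).Q (φ2 (k2.1.mulVec v)))
    (key hx1 k1) (key hx2 k2) (fun v => by rw [← conj_mulVec, e1]) (fun v => by rw [← conj_mulVec, e2])
  have c1 := cardq _ φ1 (mk' s₁ h1.isUnit ℓ hℓ).Q k1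
  have c2 := cardq _ φ2 (mk' s₂ h2.isUnit ℓ hℓ).Q k2
  have hh : Nat.card {v // (mk' s₁ h1.isUnit ℓ hℓ).Q (φ1 (k1.1.mulVec v)) = 0} = Nat.card {v // (mk' s₂ h2.isUnit ℓ hℓ).Q (φ2 (k2.1.mulVec v)) = 0} := by
    congr! 3 with v
    have := congrFun this v
    rw [this]
  rw [c1, c2] at hh
  exact zeros_ne s₁ ℓ h2 h3 h4 hℓ0 hh

end
end QM

namespace QM
open QuadraticAlgebra Polynomial
section
variable {F : Type} [Field F] [Fintype F] [CharP F 2] {m : ℕ}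

abbrev Ag (g : F[X]) := QA (AdjoinRoot g) (root g)
noncomputable abbrev sg (g : F[X]) : Ag g := algebraMap (AdjoinRoot g) (Ag g) (root g)

lemma om_s (g : F[X]) [MP g] : (ω : Ag g) * sg g = ω * ω + 1 := by
  have := omega_mul_omega_eq_add (R := AdjoinRoot g) (a := 1) (b := root g)
  rw [this]
  simp only [sg, algebraMap_eq_smul_one, one_smul]
  rw [mul_smul_comm, mul_one]
  linear_combination - cse (1 : Ag g)

lemma om_unit (g : F[X]) [MP g] : IsUnit (ω : Ag g) := by
  rw [isUnit_iff_norm_isUnit]; simp [norm_def, neg_eq]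

lemma th_f {g g' : F[X]} [MP g] [MP g'] (θ : Ag g →ₗ[F] Ag g') (h : ∀ a, θ (ω * a) = ω * θ a) (f : F[X]) (a : Ag g) :
    θ (aeval (sg g) f * a) = aeval (sg g') f * θ a := by
  have h1 : ∀ a, θ (sg g * a) = sg g' * θ a := by
    intro a
    apply (om_unit g').mul_left_cancel
    rw [← h, ← mul_assoc, ← mul_assoc, om_s, om_s, add_mul, one_mul, mul_assoc, map_add, h, h]
    ring
  induction f using Polynomial.induction_on' generalizing a with
  | add p q hp hq => rw [map_add, map_add, add_mul, add_mul, map_add, hp, hq]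
  | monomial n c =>
    simp only [aeval_monomial]
    rw [← smul_def, ← smul_def, smul_mul_assoc, smul_mul_assoc, map_smul]
    congr 1
    induction n generalizing a with
    | zero => simp
    | succ n ih => rw [pow_succ, mul_assoc, ih, h1, pow_succ, mul_assoc]

lemma aeval_sg (g : F[X]) [MP g] (f : F[X]) : aeval (sg g) f = algebraMap (AdjoinRoot g) (Ag g) (AdjoinRoot.mk g f) := by
  rw [sg, aeval_algebraMap_apply, aeval_eq]

lemma th_lin {g : F[X]} [MP g] (θ : Ag g →ₗ[F] Ag g) (h : ∀ a, θ (ω * a) = ω * θ a) (a b : Ag g) : θ (b * a) = b * θ a := by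
  obtain ⟨f1, h1⟩ := mk_surjective b.re
  obtain ⟨f2, h2⟩ := mk_surjective b.im
  have hb : b = aeval (sg g) f1 + aeval (sg g) f2 * ω := by
    rw [aeval_sg, aeval_sg, h1, h2]
    ext <;> simp
  rw [hb, add_mul, map_add, mul_assoc, th_f θ h, th_f θ h, h]
  ring

lemma type_unique {g g' : F[X]} [MP g] [MP g'] {y : SpG m F} (h : HasType g y) (h' : HasType g' y) (hd : g.natDegree = g'.natDegree) : g = g' := by
  obtain ⟨φ, _, h⟩ := h
  obtain ⟨φ', _, h'⟩ := h'
  have h1 := th_f (φ.symm.trans φ').toLinearMap (fun a => by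
    obtain ⟨v, rfl⟩ := φ.surjective a
    rw [← h]; simp [h']) g (φ (φ'.symm 1))
  rw [aeval_sg, aeval_sg, AdjoinRoot.mk_self] at h1
  simp only [map_zero, zero_mul, LinearEquiv.coe_coe, trans_apply, symm_apply_apply, apply_symm_apply, mul_one] at h1
  have h2 : g' ∣ g := by
    rw [← mk_eq_zero]
    exact algebraMap_injective (h1.symm.trans (map_zero _).symm)
  exact eq_of_monic_of_dvd_of_natDegree_le MP.monic MP.monic h2 hd.le

noncomputable def Tg (g : F[X]) [MP g] : Finset (Ag g) := univ.filter fun a => QuadraticAlgebra.norm a = 1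

lemma type_card1 (g : F[X]) [MP g] (hd : g.natDegree = m) :
    Nat.card (SpG m F) ≤ Nat.card {y : SpG m F // HasType g y} * (Tg g).card := by
  have : FiniteDimensional F (Ag g) := Module.Finite.of_finite
  obtain ⟨φ, hφ⟩ := exists_isom (2 * m) (B0_SF (F := F) (m := m)) (Dg g).sfB (by simp; ring) (by
    rw [← pow_inj_card, card_eq_fintype_card, card_QA, card_AR, hd, ← pow_mul, mul_comm])
  have hT : (Dg g).IsT ω := isT_omega _ _ _ _
  obtain ⟨y, hy⟩ := rho_surj hφ (mT ω hT) (fun a b => B_T _ hT a b)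
  have hy' : ∀ v, φ (y.1.mulVec v) = ω * φ v := fun v => by
    have := congrArg (fun u : (End F (Ag g))ˣ => (u : End F (Ag g)) (φ v)) hy
    simp only [rho_apply, symm_apply_apply] at this
    exact this
  have hty : HasType g y := ⟨φ, hφ, hy'⟩
  let f : SpG m F → {y : SpG m F // HasType g y} := fun h => ⟨h * y * h⁻¹, hty.conj h⟩
  rw [card_eq_fintype_card, card_eq_fintype_card, ← card_univ, ← card_univ, mul_comm]
  refine card_le_mul_card_image_of_maps_to (f := f) (fun _ _ => mem_univ _) _ ?_
  rintro ⟨y', _⟩ _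
  by_cases hne : ∃ h1, f h1 = ⟨y', ‹_›⟩
  · obtain ⟨h1, hh1⟩ := hne
    refine card_le_card_of_injOn (fun h => (rho φ (h1⁻¹ * h) : End F (Ag g)) 1) ?_ ?_
    all_goals
      have key : ∀ h, f h = ⟨y', ‹_›⟩ → ∀ a, (rho φ (h1⁻¹ * h) : End F (Ag g)) a = a * (rho φ (h1⁻¹ * h) : End F (Ag g)) 1 := by
        intro h hh a
        have hc : Commute (h1⁻¹ * h) y := by
          have := congrArg Subtype.val (hh.trans hh1.symm)
          simp only [f] at this
          show h1⁻¹ * h * y = y * (h1⁻¹ * h)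
          have h3 := congrArg (fun x => h1⁻¹ * x * h) this
          simpa [mul_assoc] using h3
        have hc2 : Commute (rho φ (h1⁻¹ * h) : End F (Ag g)) (rho φ y : End F (Ag g)) := by
          have := hc.map (rho φ)
          exact congrArg Units.val this
        have := th_lin (rho φ (h1⁻¹ * h) : End F (Ag g)) (fun a => by
          have := congrArg (fun u : End F (Ag g) => u a) hc2
          rw [hy] at this
          exact this) 1 a
        rwa [mul_one] at this
    · intro h hh
      have hh : f h = ⟨y', ‹_›⟩ := by simpa using hh
      simp only [Tg, coe_filter, mem_univ, true_and, mem_ofPred_eq]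
      have k := key h hh
      set c := (rho φ (h1⁻¹ * h) : End F (Ag g)) 1
      rw [← isT_iff _ (root_unit g) (lg g) (lg_nd g)]
      show c * (Dg g).σ c = 1
      rw [← sub_eq_zero]
      apply (Dg g).nondeg
      intro b
      have h3 := rho_iso hφ (h1⁻¹ * h) b 1
      rw [k b, B_apply, B_apply] at h3
      rw [sub_mul, one_mul, map_sub, sub_eq_zero]
      rw [map_one (Dg g).σ, mul_one] at h3
      refine Eq.trans (congrArg _ ?_) h3
      show c * (Dg g).σ c * b = b * c * (Dg g).σ c; ring
    · intro h hh h' hh' he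
      have hh : f h = ⟨y', ‹_›⟩ := by simpa using hh
      have hh' : f h' = ⟨y', ‹_›⟩ := by simpa using hh'
      have : rho φ (h1⁻¹ * h) = rho φ (h1⁻¹ * h') := by
        apply Units.ext; apply LinearMap.ext; intro a
        rw [key h hh, key h' hh']
        simp only at he
        rw [he]
      exact mul_left_cancel (rho_inj φ this)
  · rw [Finset.card_eq_zero.2]
    · exact Nat.zero_le _
    · rw [filter_eq_empty_iff]
      intro h _ hh
      exact hne ⟨h, hh⟩

lemma Tg_card (g : F[X]) [MP g] : (Tg g).card * fcd (AdjoinRoot g)ˣ ≤ fcd F ^ (2 * g.natDegree) := by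
  rw [mul_comm 2, pow_mul, ← card_AR, ← card_QA (root g), ← card_univ, ← card_univ, ← Finset.card_product]
  refine card_le_card_of_injOn (fun x => x.2.1 • x.1) (fun _ _ => by simp) ?_
  rintro ⟨a, c⟩ ha ⟨a', c'⟩ ha' h
  simp only [Tg, Finset.coe_product, coe_filter, mem_univ, true_and, Finset.coe_univ, Set.mem_prod, mem_ofPred_eq, Set.mem_univ, and_true] at ha ha' h
  have hn : ∀ (c : AdjoinRoot g) (a : Ag g), norm (c • a) = c ^ 2 * norm a := by
    intro c a; simp only [norm_def, re_smul, im_smul, smul_eq_mul]; ring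
  have h1 := congrArg QuadraticAlgebra.norm h
  rw [hn, hn, ha, ha', mul_one, mul_one] at h1
  have h2 : c.1 = c'.1 := by
    have : (c.1 - c'.1) ^ 2 = 0 := by
      linear_combination h1 - c.1 * cse c'.1 + cse (c'.1 ^ 2)
    exact sub_eq_zero.1 (pow_eq_zero_iff two_ne_zero |>.1 this)
  have h2 := Units.ext h2
  subst h2
  have : a = a' := by
    have := congrArg (fun x => (↑c⁻¹ : AdjoinRoot g) • x) h
    simpa [smul_smul] using this
  rw [this]

end
end QM

namespace QM
open QuadraticAlgebra Polynomial
section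
variable {F : Type} [Field F] [Fintype F] {m : ℕ}

lemma Mn_fin (i : ℕ) : Set.Finite {p : F[X] | p.Monic ∧ p.natDegree = i} :=
  (Finite.of_equiv (Fin i → F) ((monicEquivDegreeLT i).trans (degreeLTEquiv F i).toEquiv).symm)

noncomputable def Mn (F : Type) [Field F] [Fintype F] (i : ℕ) : Finset F[X] := (Mn_fin (F := F) i).toFinset

@[simp] lemma mem_Mn {i : ℕ} {p : F[X]} : p ∈ Mn F i ↔ p.Monic ∧ p.natDegree = i := by simp [Mn]

lemma card_Mn (i : ℕ) : (Mn F i).card = fcd F ^ i := by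
  rw [Mn, ← Set.ncard_eq_toFinset_card _ (Mn_fin i)]
  have := card_congr ((monicEquivDegreeLT (R := F) i).trans (degreeLTEquiv F i).toEquiv)
  rw [Nat.card_fun, Nat.card_fin, card_eq_fintype_card (α := F)] at this
  exact this

noncomputable def Ir (F : Type) [Field F] [Fintype F] (d : ℕ) : Finset F[X] := (Mn F d).filter Irreducible

lemma mem_Ir {d : ℕ} {p : F[X]} : p ∈ Ir F d ↔ (p.Monic ∧ p.natDegree = d) ∧ Irreducible p := by simp [Ir]

lemma ir_dvd {P Q : F[X]} (hP : P.Monic ∧ Irreducible P) (hQ : Q.Monic ∧ Irreducible Q) (h : P ∣ Q) : P = Q :=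
  eq_of_monic_of_associated hP.1 hQ.1 (hP.2.associated_of_dvd hQ.2 h)

lemma ir_count (S : Finset F[X]) (d : ℕ) (hS : S ⊆ Ir F d) (D : F[X]) (hD : D ≠ 0) (h : ∀ P ∈ S, P ∣ D) : d * S.card ≤ D.natDegree := by
  have h1 : ∏ P ∈ S, P ∣ D := by
    apply prod_dvd_of_coprime _ h
    intro P hP Q hQ hne
    have hP := mem_Ir.1 (hS hP)
    have hQ := mem_Ir.1 (hS hQ)
    exact (hP.2.coprime_iff_not_dvd).2 fun h => hne (ir_dvd ⟨hP.1.1, hP.2⟩ ⟨hQ.1.1, hQ.2⟩ h)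
  have h2 := natDegree_le_of_dvd h1 hD
  rw [natDegree_prod_of_monic _ _ fun P hP => (mem_Ir.1 (hS hP)).1.1,
    sum_congr rfl fun P hP => (mem_Ir.1 (hS hP)).1.2, sum_const, smul_eq_mul] at h2
  linarith

lemma Ir_card (d : ℕ) (hd : d ≠ 0) : d * (Ir F d).card ≤ fcd F ^ d := by
  rw [← FiniteField.X_pow_card_pow_sub_X_natDegree_eq F hd one_lt_card]
  refine ir_count _ d subset_rfl _ (FiniteField.X_pow_card_pow_sub_X_ne_zero F hd one_lt_card) fun P hP => ?_
  rw [mem_Ir] at hP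
  rw [← card_eq_fintype_card]
  exact (Irreducible.natDegree_dvd_iff_dvd_X_pow_card_pow_sub_X hP.2).1 (by rw [hP.1.2])

noncomputable abbrev w (P : F[X]) : ℝ := ((fcd F : ℝ) ^ P.natDegree)⁻¹

lemma q_pos : (0 : ℝ) < fcd F := by exact_mod_cast card_pos

lemma w_nn (P : F[X]) : 0 ≤ w P := by unfold w; have := q_pos (F := F); positivity

lemma w_Ir (d : ℕ) (hd : d ≠ 0) : ∑ P ∈ Ir F d, w P ≤ 1 / d := by
  rw [sum_congr rfl fun P hP => by rw [w, (mem_Ir.1 hP).1.2], sum_const, nsmul_eq_mul,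
    ← div_eq_mul_inv, div_le_div_iff₀ (by have := q_pos (F := F); positivity) (by positivity), one_mul, mul_comm]
  exact_mod_cast Ir_card d hd

lemma dvd_count (m : ℕ) (Q : F[X]) (hQ : Q.Monic) : (((Mn F m).filter (Q ∣ ·)).card : ℝ) ≤ (fcd F : ℝ) ^ m * w Q := by
  by_cases h : Q.natDegree ≤ m
  · have h1 : ((Mn F m).filter (Q ∣ ·)).card ≤ (Mn F (m - Q.natDegree)).card := by
      refine card_le_card_of_injOn (fun g => g /ₘ Q) ?_ ?_
      · intro g hg
        simp only [coe_filter, mem_Mn, mem_ofPred_eq] at hg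
        obtain ⟨⟨hg, hd⟩, f, rfl⟩ := hg
        simp only [Finset.mem_coe, mem_Mn, mul_divByMonic_cancel_left _ hQ]
        have hf := hQ.of_mul_monic_left hg
        rw [hQ.natDegree_mul hf] at hd
        exact ⟨hf, by omega⟩
      · rintro g hg g' hg' h
        simp only [coe_filter, mem_Mn, mem_ofPred_eq] at hg hg'
        obtain ⟨⟨hg, hd⟩, f, rfl⟩ := hg
        obtain ⟨⟨hg, hd⟩, f', rfl⟩ := hg'
        simp only [mul_divByMonic_cancel_left _ hQ] at h
        rw [h]
    rw [card_Mn] at h1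
    have h2 : (((Mn F m).filter (Q ∣ ·)).card : ℝ) ≤ (fcd F : ℝ) ^ (m - Q.natDegree) := by exact_mod_cast h1
    rwa [pow_sub₀ _ q_pos.ne' h] at h2
  · rw [filter_eq_empty_iff.2]
    · have := w_nn Q; have := q_pos (F := F); simp; positivity
    · intro g hg hd
      rw [mem_Mn] at hg
      exact h (hg.2 ▸ natDegree_le_of_dvd hd hg.1.ne_zero)

noncomputable def Ps (F : Type) [Field F] [Fintype F] (m : ℕ) : Finset F[X] := (Finset.Icc 1 m).biUnion (Ir F)

lemma mem_Ps {P : F[X]} : P ∈ Ps F m ↔ P.Monic ∧ Irreducible P ∧ P.natDegree ≤ m := by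
  simp only [Ps, mem_biUnion, mem_Icc, mem_Ir]
  exact ⟨fun ⟨d, h1, h2⟩ => ⟨h2.1.1, h2.2, by omega⟩, fun h => ⟨_, ⟨h.2.1.natDegree_pos, h.2.2⟩, ⟨h.1, rfl⟩, h.2.1⟩⟩

lemma sum_Ps (f : F[X] → ℝ) : ∑ P ∈ Ps F m, f P = ∑ d ∈ Finset.Icc 1 m, ∑ P ∈ Ir F d, f P :=
  sum_biUnion fun d _ d' _ h => disjoint_left.2 fun P h1 h2 => h ((mem_Ir.1 h1).1.2.symm.trans (mem_Ir.1 h2).1.2)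

lemma sq_sum : ∑ P ∈ Ps F m, w P * w P ≤ 1 / ((fcd F : ℝ) - 1) := by
  have hq : (1 : ℝ) < fcd F := by exact_mod_cast one_lt_card
  rw [sum_Ps]
  have h1 : ∀ n : ℕ, ∑ d ∈ Finset.Icc 1 n, ((fcd F : ℝ) ^ d)⁻¹ ≤ (1 - ((fcd F : ℝ) ^ n)⁻¹) / ((fcd F : ℝ) - 1) := by
    intro n
    induction n with
    | zero => simp
    | succ n ih =>
      rw [Finset.sum_Icc_succ_top (by omega)]
      refine (add_le_add_left ih _).trans (le_of_eq ?_)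
      have : (fcd F : ℝ) - 1 ≠ 0 := by linarith
      field_simp
      ring
  have h2 : ∀ d ∈ Finset.Icc 1 m, ∑ P ∈ Ir F d, w P * w P ≤ ((fcd F : ℝ) ^ d)⁻¹ := by
    intro d hd
    rw [mem_Icc] at hd
    have h3 := w_Ir (F := F) d (by omega)
    rw [sum_congr rfl fun P hP => show w P * w P = ((fcd F : ℝ) ^ d)⁻¹ * w P by rw [← (mem_Ir.1 hP).1.2], ← mul_sum]
    refine mul_le_of_le_one_right (by positivity) (h3.trans ?_)
    rw [div_le_one (by have := hd.1; positivity)]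
    exact_mod_cast hd.1
  refine (sum_le_sum h2).trans ((h1 m).trans ?_)
  have : 0 < ((fcd F : ℝ) ^ m)⁻¹ := by positivity
  gcongr; linarith


lemma exP {g : F[X]} (hg : g ∈ Mn F m) (f : F[X]) (hf : ¬ IsCoprime g f) : ∃ P ∈ Ps F m, P ∣ g ∧ P ∣ f := by
  rw [mem_Mn] at hg
  obtain ⟨P, hP, h1, h2⟩ : ∃ P, Irreducible P ∧ P ∣ g ∧ P ∣ f := by
    by_contra h
    push Not at h
    exact hf (isCoprime_of_irreducible_dvd (fun h => hg.1.ne_zero h.1) fun z hz h1 h2 => h z hz h1 h2)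
  refine ⟨normalize P, mem_Ps.2 ⟨monic_normalize hP.ne_zero, (associated_normalize P).irreducible hP, ?_⟩,
    (normalize_associated P).dvd.trans h1, (normalize_associated P).dvd.trans h2⟩
  exact hg.2 ▸ natDegree_le_of_dvd ((normalize_associated P).dvd.trans h1) hg.1.ne_zero

variable [CharP F 2]

lemma aHD (g P f : F[X]) (h : P ∣ g) : algHomOfDvd F g P h (AdjoinRoot.mk g f) = AdjoinRoot.mk P f := by
  rw [← aeval_eq, ← aeval_algHom_apply, algHomOfDvd_root, aeval_eq]

lemma ker_card (g P : F[X]) [MP g] [MP P] (h : P ∣ g) :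
    ((univ.filter fun a => algHomOfDvd F g P h a = 0).card : ℝ) = (fcd F : ℝ) ^ g.natDegree * w P := by
  let φ := (algHomOfDvd F g P h).toAddMonoidHom
  have h1 := φ.ker.card_mul_index
  rw [AddSubgroup.index_ker, AddMonoidHom.range_eq_top.2, card_congr (AddSubgroup.topEquiv).toEquiv, card_eq_fintype_card,
    card_eq_fintype_card, card_eq_fintype_card, card_AR, card_AR] at h1
  · have h2 : (univ.filter fun a => algHomOfDvd F g P h a = 0).card = fcd φ.ker := by
      rw [card_subtype]; congr 1; ext a; simp [φ, AddMonoidHom.mem_ker]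
    rw [h2, w, eq_mul_inv_iff_mul_eq₀ (pow_ne_zero _ q_pos.ne')]
    exact_mod_cast h1
  · intro x
    obtain ⟨f, rfl⟩ := mk_surjective x
    exact ⟨AdjoinRoot.mk g f, aHD g P f h⟩

lemma type_card (g : F[X]) [MP g] (hd : g.natDegree = m) :
    (Nat.card (SpG m F) : ℝ) * ((fcd F : ℝ) ^ m)⁻¹ * (1 - ∑ P ∈ (Ps F m).filter (· ∣ g), w P) ≤ Nat.card {y : SpG m F // HasType g y} := by
  have hgm : g ∈ Mn F m := mem_Mn.2 ⟨MP.monic, hd⟩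
  have hq := pow_pos (q_pos (F := F)) m
  have h0 : ((univ.filter fun a : AdjoinRoot g => ¬ IsUnit a).card : ℝ) ≤ (fcd F : ℝ) ^ m * ∑ P ∈ (Ps F m).filter (· ∣ g), w P := by
    have hsub : (univ.filter fun a : AdjoinRoot g => ¬ IsUnit a) ⊆ ((Ps F m).filter (· ∣ g)).biUnion fun P =>
        univ.filter fun a => ∃ f, P ∣ f ∧ a = AdjoinRoot.mk g f := by
      intro a ha
      obtain ⟨f, rfl⟩ := mk_surjective a
      obtain ⟨P, hP, h1, h2⟩ := exP hgm f fun hc => by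
        obtain ⟨u, v, h⟩ := hc
        have := congrArg (AdjoinRoot.mk g) h
        simp only [map_add, map_mul, AdjoinRoot.mk_self, mul_zero, zero_add, map_one] at this
        exact (mem_filter.1 ha).2 (IsUnit.of_mul_eq_one_right _ this)
      simp only [mem_biUnion, mem_filter, mem_univ, true_and]
      exact ⟨P, ⟨hP, h1⟩, f, h2, rfl⟩
    refine (cast_le.2 ((card_le_card hsub).trans card_biUnion_le)).trans ?_
    rw [cast_sum, mul_sum]
    refine sum_le_sum fun P hP => ?_
    rw [mem_filter, mem_Ps] at hP
    have := MP.of_dvd hP.1.1 hP.2 hP.1.2.1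
    rw [← hd, ← ker_card g P hP.2]
    gcongr with a
    rintro ⟨f, hf, rfl⟩
    rw [aHD]; exact mk_eq_zero.2 hf
  have h1 : (fcd (AdjoinRoot g)ˣ : ℝ) + ((univ.filter fun a : AdjoinRoot g => ¬ IsUnit a).card : ℝ) = (fcd F : ℝ) ^ m := by
    have h2 : fcd (AdjoinRoot g)ˣ = (univ.filter fun a : AdjoinRoot g => IsUnit a).card := by
      rw [← card_univ, ← card_image_of_injective _ Units.val_injective]
      congr 1; ext a
      simp only [mem_image, mem_univ, true_and, mem_filter]; rfl
    rw [h2, ← Nat.cast_add, card_filter_add_card_filter_not, card_univ, card_AR, hd]; push_cast; rfl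
  have h2 : ((Tg g).card : ℝ) * fcd (AdjoinRoot g)ˣ ≤ ((fcd F : ℝ) ^ m) ^ 2 := by
    have := Tg_card g
    rw [hd, mul_comm 2, pow_mul] at this; exact_mod_cast this
  have h3 : (Nat.card (SpG m F) : ℝ) ≤ Nat.card {y : SpG m F // HasType g y} * (Tg g).card := by exact_mod_cast type_card1 g hd
  have hN0 : (0 : ℝ) ≤ Nat.card (SpG m F) := by positivity
  generalize (Nat.card (SpG m F) : ℝ) = N at *
  have hK : (0 : ℝ) ≤ Nat.card {y : SpG m F // HasType g y} := by positivity
  have hN : (0 : ℝ) ≤ fcd (AdjoinRoot g)ˣ := by positivity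
  have hT : (0 : ℝ) ≤ (Tg g).card := by positivity
  generalize (Nat.card {y : SpG m F // HasType g y} : ℝ) = K at *
  generalize (fcd (AdjoinRoot g)ˣ : ℝ) = U at *
  generalize ((Tg g).card : ℝ) = T at *
  generalize ((univ.filter fun a : AdjoinRoot g => ¬ IsUnit a).card : ℝ) = V at *
  generalize (∑ P ∈ (Ps F m).filter (· ∣ g), w P) = W at *
  generalize (fcd F : ℝ) ^ m = Q at *
  by_cases hW : 1 - W ≤ 0
  · exact (mul_nonpos_of_nonneg_of_nonpos (by positivity) hW).trans hK
  have h4 : Q * (1 - W) ≤ U := by linarith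
  rw [mul_comm N, mul_assoc, inv_mul_le_iff₀ hq]
  have h5 : N * (1 - W) * Q ≤ Q * K * Q := calc
    _ = N * (Q * (1 - W)) := by ring
    _ ≤ (K * T) * U := by push Not at hW; gcongr
    _ = K * (T * U) := by ring
    _ ≤ K * Q ^ 2 := by gcongr
    _ = _ := by ring
  exact le_of_mul_le_mul_right h5 hq

end
end QM

namespace QM
open Polynomial
section
variable {F : Type} [Field F] [Fintype F] {m : ℕ}

lemma deg_sum {g : F[X]} (hg : g ∈ Mn F m) (hs : Squarefree g) : m ≤ ∑ P ∈ (Ps F m).filter (· ∣ g), P.natDegree := by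
  rw [mem_Mn] at hg
  have h0 := hg.1.ne_zero
  have h1 := UniqueFactorizationMonoid.prod_normalizedFactors h0
  have hmon : ∀ P ∈ normalizedFactors g, P.Monic := fun P hP => by
    rw [← UniqueFactorizationMonoid.normalize_normalized_factor P hP]
    exact monic_normalize (UniqueFactorizationMonoid.irreducible_of_normalized_factor P hP).ne_zero
  have h2 := natDegree_multiset_prod_of_monic _ hmon
  rw [natDegree_eq_of_degree_eq (degree_eq_degree_of_associated h1), hg.2] at h2
  have hnd := (UniqueFactorizationMonoid.squarefree_iff_nodup_normalizedFactors h0).1 hs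
  have h3 : (Multiset.map natDegree (normalizedFactors g)).sum = ∑ P ∈ (normalizedFactors g).toFinset, P.natDegree := by
    rw [Finset.sum, Multiset.toFinset_val, hnd.dedup]
  refine (h2.trans h3).le.trans ?_
  refine Finset.sum_le_sum_of_subset fun P hP => ?_
  rw [Multiset.mem_toFinset] at hP
  have hd := UniqueFactorizationMonoid.dvd_of_mem_normalizedFactors hP
  exact mem_filter.2 ⟨mem_Ps.2 ⟨hmon P hP, UniqueFactorizationMonoid.irreducible_of_normalized_factor P hP, hg.2 ▸ natDegree_le_of_dvd hd h0⟩, hd⟩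

noncomputable def Sq (T : Finset F[X]) (i : ℕ) : Finset F[X] := (Mn F i).filter fun g => Squarefree g ∧ ∀ P ∈ T, ¬ P ∣ g

lemma Sq_div (T : Finset F[X]) (Q : F[X]) (hQ : Q.Monic) : ((Sq T m).filter (Q ∣ ·)).card ≤ (Sq T (m - Q.natDegree)).card := by
  refine card_le_card_of_injOn (fun g => g /ₘ Q) ?_ ?_
  · intro g hg
    simp only [coe_filter, Sq, mem_filter, mem_Mn, mem_ofPred_eq] at hg
    obtain ⟨⟨⟨hg, hd⟩, hs, hn⟩, f, rfl⟩ := hg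
    simp only [Finset.mem_coe, Sq, mem_filter, mem_Mn, mul_divByMonic_cancel_left _ hQ]
    have hf := hQ.of_mul_monic_left hg
    rw [hQ.natDegree_mul hf] at hd
    exact ⟨⟨hf, by omega⟩, hs.squarefree_of_dvd (dvd_mul_left _ _), fun P hP h => hn P hP (h.mul_left _)⟩
  · rintro g hg g' hg' h
    obtain ⟨f, rfl⟩ := (mem_filter.1 hg).2
    obtain ⟨f', rfl⟩ := (mem_filter.1 hg').2
    simp only [mul_divByMonic_cancel_left _ hQ] at h
    rw [h]

lemma sieve1 (T : Finset F[X]) : (m : ℝ) * ((Sq T m).card * ((fcd F : ℝ) ^ m)⁻¹) ≤ ∑ i ∈ Finset.range m, (Sq T i).card * ((fcd F : ℝ) ^ i)⁻¹ := by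
  have h1 : m * (Sq T m).card ≤ ∑ d ∈ Finset.Icc 1 m, fcd F ^ d * (Sq T (m - d)).card := calc
    m * (Sq T m).card = ∑ g ∈ Sq T m, m := by rw [sum_const, smul_eq_mul, mul_comm]
    _ ≤ ∑ g ∈ Sq T m, ∑ P ∈ Ps F m, if P ∣ g then P.natDegree else 0 := by
      refine sum_le_sum fun g hg => ?_
      rw [← sum_filter]
      simp only [Sq, mem_filter] at hg
      exact deg_sum hg.1 hg.2.1
    _ = ∑ P ∈ Ps F m, P.natDegree * ((Sq T m).filter (P ∣ ·)).card := by
      rw [sum_comm]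
      refine sum_congr rfl fun P _ => ?_
      rw [← sum_filter, sum_const, smul_eq_mul, mul_comm]
    _ ≤ ∑ P ∈ Ps F m, P.natDegree * (Sq T (m - P.natDegree)).card :=
      sum_le_sum fun P hP => Nat.mul_le_mul_left _ (Sq_div T P (mem_Ps.1 hP).1)
    _ = ∑ d ∈ Finset.Icc 1 m, ∑ P ∈ Ir F d, P.natDegree * (Sq T (m - P.natDegree)).card := by
      have := sum_Ps (F := F) (m := m) fun P => ((P.natDegree * (Sq T (m - P.natDegree)).card : ℕ) : ℝ)
      exact_mod_cast this
    _ ≤ _ := by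
      refine sum_le_sum fun d hd => ?_
      rw [sum_congr rfl fun P hP => by rw [(mem_Ir.1 hP).1.2], sum_const, smul_eq_mul, ← mul_assoc, mul_comm _ d]
      exact Nat.mul_le_mul_right _ (Ir_card d (by have := mem_Icc.1 hd; omega))
  have hq := q_pos (F := F)
  have h2 : ∑ i ∈ Finset.range m, (Sq T i).card * ((fcd F : ℝ) ^ i)⁻¹ = ∑ d ∈ Finset.Icc 1 m, (fcd F : ℝ) ^ d * (Sq T (m - d)).card * ((fcd F : ℝ) ^ m)⁻¹ := by
    refine Finset.sum_nbij' (m - ·) (m - ·) ?_ ?_ ?_ ?_ ?_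
    · intro i hi; rw [mem_range] at hi; rw [mem_Icc]; omega
    · intro i hi; rw [mem_Icc] at hi; rw [mem_range]; omega
    · intro i hi; rw [mem_range] at hi; omega
    · intro i hi; rw [mem_Icc] at hi; omega
    · intro i hi
      rw [mem_range] at hi
      rw [Nat.sub_sub_self hi.le, pow_sub₀ _ hq.ne' hi.le]
      field_simp
  rw [h2, ← sum_mul, ← mul_assoc]
  gcongr
  exact_mod_cast h1

noncomputable def U (T : Finset F[X]) (m L j : ℕ) : Finset F[X] :=
  ((Finset.range (m + j * L)).biUnion (Mn F)).filter fun f => (T.filter (· ∣ f)).card ≤ j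

lemma mem_U {T : Finset F[X]} {L j : ℕ} {f : F[X]} : f ∈ U T m L j ↔ (f.Monic ∧ f.natDegree < m + j * L) ∧ (T.filter (· ∣ f)).card ≤ j := by
  simp only [U, mem_filter, mem_biUnion, mem_range, mem_Mn]
  exact and_congr_left fun _ => ⟨fun ⟨i, h, h1, h2⟩ => ⟨h1, h2 ▸ h⟩, fun h => ⟨_, h.2, h.1, rfl⟩⟩

lemma sum_Mn (n : ℕ) (f : F[X] → ℝ) : ∑ P ∈ (Finset.range n).biUnion (Mn F), f P = ∑ d ∈ Finset.range n, ∑ P ∈ Mn F d, f P :=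
  sum_biUnion fun d _ d' _ h => disjoint_left.2 fun P h1 h2 => h ((mem_Mn.1 h1).2.symm.trans (mem_Mn.1 h2).2)

lemma U_top (T : Finset F[X]) (L j : ℕ) : ∑ f ∈ U T m L j, w f ≤ m + j * L := by
  refine (sum_le_sum_of_subset_of_nonneg (filter_subset _ _) fun f _ _ => w_nn f).trans ?_
  rw [sum_Mn]
  refine (sum_le_sum (g := fun _ => (1 : ℝ)) fun d _ => ?_).trans (by simp)
  rw [sum_congr rfl fun P hP => by rw [w, (mem_Mn.1 hP).2], sum_const, card_Mn, nsmul_eq_mul]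
  push_cast
  rw [mul_inv_cancel₀ (pow_ne_zero _ q_pos.ne')]

lemma U_bot (T : Finset F[X]) (L : ℕ) : ∑ i ∈ Finset.range m, (Sq T i).card * ((fcd F : ℝ) ^ i)⁻¹ ≤ ∑ f ∈ U T m L 0, w f := by
  rw [U, sum_filter, zero_mul, add_zero, sum_Mn]
  refine sum_le_sum fun i _ => ?_
  rw [← sum_filter]
  have h : Sq T i ⊆ (Mn F i).filter fun f => (T.filter (· ∣ f)).card ≤ 0 := by
    intro f hf
    simp only [Sq, mem_filter] at hf ⊢
    refine ⟨hf.1, ?_⟩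
    rw [filter_eq_empty_iff.2 fun P hP => hf.2.2 P hP]; simp
  refine le_trans (le_of_eq ?_) (sum_le_sum_of_subset_of_nonneg h fun f _ _ => w_nn f)
  rw [sum_congr rfl fun P hP => by rw [w, (mem_Mn.1 (mem_filter.1 hP).1).2], sum_const, nsmul_eq_mul]

lemma U_step (T : Finset F[X]) (L j : ℕ) (hT : T ⊆ Ps F L) : (∑ P ∈ T, w P) * ∑ f ∈ U T m L j, w f ≤ (j + 1) * ∑ f ∈ U T m L (j + 1), w f := by
  rw [sum_mul_sum, ← sum_product']
  have h1 : ∀ x ∈ T ×ˢ U T m L j, x.1 * x.2 ∈ U T m L (j + 1) := by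
    rintro ⟨P, f⟩ h
    rw [mem_product, mem_U] at h
    have hP := mem_Ps.1 (hT h.1)
    refine mem_U.2 ⟨⟨hP.1.mul h.2.1.1, ?_⟩, ?_⟩
    · simp only
      rw [hP.1.natDegree_mul h.2.1.1]
      have := h.2.1.2
      linarith [hP.2.2]
    · refine (card_le_card (t := insert P (T.filter (· ∣ f))) fun R hR => ?_).trans ((Finset.card_insert_le _ _).trans (Nat.succ_le_succ h.2.2))
      rw [mem_filter] at hR
      have hR' := mem_Ps.1 (hT hR.1)
      rw [mem_insert, mem_filter]
      exact (hR'.2.1.prime.dvd_or_dvd hR.2).imp (fun h => ir_dvd ⟨hR'.1, hR'.2.1⟩ ⟨hP.1, hP.2.1⟩ h) fun h => ⟨hR.1, h⟩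
  rw [← Finset.sum_fiberwise_of_maps_to h1, mul_sum]
  refine sum_le_sum fun y hy => ?_
  have h2 : ∀ x ∈ (T ×ˢ U T m L j).filter (fun x => x.1 * x.2 = y), w x.1 * w x.2 = w y := by
    rintro ⟨P, f⟩ h
    rw [mem_filter, mem_product, mem_U] at h
    rw [← h.2, w, w, w, (mem_Ps.1 (hT h.1.1)).1.natDegree_mul h.1.2.1.1, pow_add, mul_inv]
  rw [sum_congr rfl h2, sum_const, nsmul_eq_mul]
  refine mul_le_mul_of_nonneg_right ?_ (w_nn y)
  have h3 : ((T ×ˢ U T m L j).filter (fun x => x.1 * x.2 = y)).card ≤ j + 1 := by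
    refine le_trans ?_ (mem_U.1 hy).2
    refine card_le_card_of_injOn Prod.fst ?_ ?_
    · rintro ⟨P, f⟩ h
      simp only [coe_filter, mem_ofPred_eq, mem_product] at h ⊢
      exact ⟨h.1.1, h.2 ▸ dvd_mul_right _ _⟩
    · rintro ⟨P, f⟩ h ⟨P', f'⟩ h' he
      simp only [coe_filter, mem_ofPred_eq, mem_product] at h h' he
      subst he
      rw [mul_left_cancel₀ (mem_Ps.1 (hT h.1.1)).1.ne_zero (h.2.trans h'.2.symm)]
  exact_mod_cast h3

lemma sieve (T : Finset F[X]) (L j : ℕ) (hT : T ⊆ Ps F L) (hs : 2 * (j : ℝ) ≤ ∑ P ∈ T, w P) (hj : j * L ≤ m) (hm : m ≠ 0) :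
    ((Sq T m).card : ℝ) ≤ (fcd F : ℝ) ^ m * (2 / 2 ^ j) := by
  have h1 : ∀ i : ℕ, (∑ P ∈ T, w P) ^ i * ∑ f ∈ U T m L 0, w f ≤ (i.factorial : ℝ) * ∑ f ∈ U T m L i, w f := by
    intro i
    induction i with
    | zero => simp
    | succ i ih =>
      have h0 : 0 ≤ ∑ P ∈ T, w P := sum_nonneg fun P _ => w_nn P
      calc _ = (∑ P ∈ T, w P) * ((∑ P ∈ T, w P) ^ i * ∑ f ∈ U T m L 0, w f) := by ring
        _ ≤ (∑ P ∈ T, w P) * ((i.factorial : ℝ) * ∑ f ∈ U T m L i, w f) := by gcongr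
        _ = (i.factorial : ℝ) * ((∑ P ∈ T, w P) * ∑ f ∈ U T m L i, w f) := by ring
        _ ≤ (i.factorial : ℝ) * ((i + 1) * ∑ f ∈ U T m L (i + 1), w f) := mul_le_mul_of_nonneg_left (U_step T L i hT) (by positivity)
        _ = _ := by rw [Nat.factorial_succ]; push_cast; ring
  have h2 := (sieve1 (m := m) T).trans (U_bot T L)
  have hW : 0 ≤ ∑ f ∈ U T m L 0, w f := sum_nonneg fun P _ => w_nn P
  have hq := pow_pos (q_pos (F := F)) m
  have hjL : (j : ℝ) * L ≤ m := by exact_mod_cast hj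
  have hm' : (0 : ℝ) < m := by positivity
  have h3 : (2 : ℝ) ^ j * ∑ f ∈ U T m L 0, w f ≤ 2 * m := by
    rcases Nat.eq_zero_or_pos j with rfl | hj0
    · have := U_top (m := m) T L 0
      simp only [pow_zero, one_mul, Nat.cast_zero, zero_mul, add_zero] at this ⊢
      linarith
    have hf : (0 : ℝ) < j.factorial := by exact_mod_cast Nat.factorial_pos j
    refine le_of_mul_le_mul_left ?_ hf
    calc _ ≤ ((j : ℝ) ^ j) * (2 ^ j * ∑ f ∈ U T m L 0, w f) := by gcongr; exact_mod_cast Nat.factorial_le_pow j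
      _ = (2 * (j : ℝ)) ^ j * ∑ f ∈ U T m L 0, w f := by rw [mul_pow]; ring
      _ ≤ (∑ P ∈ T, w P) ^ j * ∑ f ∈ U T m L 0, w f := by gcongr
      _ ≤ _ := h1 j
      _ ≤ _ := by gcongr; exact (U_top T L j).trans (by linarith)
  rw [← div_eq_mul_inv, mul_div_assoc', div_le_iff₀ hq] at h2
  rw [mul_div_assoc', le_div_iff₀ (by positivity)]
  refine le_of_mul_le_mul_left ?_ hm'
  calc _ = (m * ((Sq T m).card : ℝ)) * 2 ^ j := by ring
    _ ≤ ((∑ f ∈ U T m L 0, w f) * (fcd F : ℝ) ^ m) * 2 ^ j := by gcongr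
    _ = (2 ^ j * ∑ f ∈ U T m L 0, w f) * (fcd F : ℝ) ^ m := by ring
    _ ≤ (2 * m) * (fcd F : ℝ) ^ m := by gcongr
    _ = _ := by ring

end
end QM

namespace QM
open Polynomial
section

noncomputable def Ph (q d : ℕ) : ℕ := ((cyclotomic d ℤ).eval (q : ℤ)).natAbs
noncomputable def Rp (q d : ℕ) : ℕ := (q ^ d - 1) / Ph q d
noncomputable def Rm (q d : ℕ) : ℕ := (q ^ d + 1) / Ph q (2 * d)

lemma cyc {q d e : ℕ} (hq : q ≠ 0) (h : e ∈ d.properDivisors) : (q ^ e - 1) * Ph q d ∣ q ^ d - 1 := by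
  have h1 := eval_dvd (x := (q : ℤ)) (X_pow_sub_one_mul_cyclotomic_dvd_X_pow_sub_one_of_dvd ℤ h)
  simp only [eval_mul, eval_sub, eval_pow, eval_X, eval_one] at h1
  rw [← Int.natAbs_dvd_natAbs, Int.natAbs_mul] at h1
  have h2 : ∀ k : ℕ, ((q : ℤ) ^ k - 1).natAbs = q ^ k - 1 := fun k => by
    have := one_le_pow k q (Nat.pos_of_ne_zero hq)
    zify [this]; rw [abs_of_nonneg]; have : (1 : ℤ) ≤ (q : ℤ) ^ k := by exact_mod_cast this
    linarith
  rwa [h2, h2] at h1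

lemma cyc_ge {q n : ℕ} (hq : 8 ≤ q) (hn : 2 ≤ n) : 7 ^ n.totient ≤ Ph q n := by
  have h1 := sub_one_pow_totient_lt_cyclotomic_eval (q := (q : ℝ)) hn (by exact_mod_cast (by omega : 1 < q))
  have h2 : (((cyclotomic n ℤ).eval (q : ℤ) : ℤ) : ℝ) = eval (q : ℝ) (cyclotomic n ℝ) := by
    rw [← map_cyclotomic_int n ℝ, eval_natCast_map]; simp
  have h3 : (7 : ℝ) ^ n.totient ≤ ((q : ℝ) - 1) ^ n.totient := by
    gcongr
    have : (8 : ℝ) ≤ q := by exact_mod_cast hq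
    linarith
  have h4 : (7 : ℤ) ^ n.totient ≤ (cyclotomic n ℤ).eval (q : ℤ) := by
    have := h3.trans h1.le
    rw [← h2] at this
    exact_mod_cast this
  unfold Ph
  zify
  exact h4.trans (le_abs_self _)

lemma tot_ge (d : ℕ) : Odd d → d ≤ 7 ^ d.totient := by
  induction d using Nat.recOnPosPrimePosCoprime with
  | prime_pow p n hp hn =>
    intro _
    have h1 : p ^ n ≤ 2 * (p ^ n).totient := by
      rw [Nat.totient_prime_pow hp hn]
      obtain ⟨k, rfl⟩ := exists_eq_succ_of_ne_zero hn.ne'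
      obtain ⟨r, rfl⟩ : ∃ r, p = r + 2 := ⟨p - 2, by have := hp.two_le; omega⟩
      simp only [Nat.succ_eq_add_one, Nat.add_sub_cancel, pow_succ]
      have : r + 2 - 1 = r + 1 := by omega
      rw [this]
      nlinarith [Nat.zero_le ((r + 2) ^ k * r)]
    refine h1.trans ?_
    generalize (p ^ n).totient = x
    induction x with
    | zero => simp
    | succ x ih => rw [pow_succ]; have := one_le_pow x 7 (by norm_num); omega
  | zero => intro h; simp at h
  | one => simp
  | coprime a b ha hb hc iha ihb =>
    intro h
    rw [Nat.odd_mul] at h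
    have two : ∀ a, 1 < a → Odd a → 2 ≤ a.totient := fun a ha ho => by
      have : 2 < a := by rcases ho with ⟨k, rfl⟩; omega
      have h1 := Nat.totient_even this
      have h2 := Nat.totient_pos.2 (by omega : 0 < a)
      rcases h1 with ⟨k, hk⟩; omega
    have h1 := two a ha h.1
    have h2 := two b hb h.2
    rw [Nat.totient_mul hc]
    calc a * b ≤ 7 ^ a.totient * 7 ^ b.totient := Nat.mul_le_mul (iha h.1) (ihb h.2)
      _ = 7 ^ (a.totient + b.totient) := (pow_add _ _ _).symm
      _ ≤ _ := pow_le_pow_right (by norm_num) (by nlinarith)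

lemma lcm_arg {ι : Type} (S : Finset ι) (x : ι → ℕ) (hx : ∀ i ∈ S, x i ≠ 0) {o A R : ℕ} (hA : o ∣ A) (ho : o ∣ S.lcm x) (h : ∀ i ∈ S, Nat.gcd A (x i) ∣ R) : o ∣ R := by
  rw [Nat.dvd_iff_prime_pow_dvd_dvd]
  intro p k hp hk
  have : ∀ S : Finset ι, (∀ i ∈ S, x i ≠ 0) → p ^ k ∣ S.lcm x → p ^ k = 1 ∨ ∃ i ∈ S, p ^ k ∣ x i := by
    intro S
    induction S using Finset.induction with
    | empty => intro _ h; left; simpa using h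
    | insert i S hi ih =>
      intro hx h
      rw [Finset.lcm_insert] at h
      have h0 : S.lcm x ≠ 0 := Finset.lcm_ne_zero_iff.2 fun j hj => hx j (mem_insert_of_mem hj)
      have h1 := hx i (mem_insert_self _ _)
      have h : p ^ k ∣ Nat.lcm (x i) (S.lcm x) := h
      rw [hp.pow_dvd_iff_le_factorization (Nat.lcm_ne_zero h1 h0), Nat.factorization_lcm h1 h0, Finsupp.sup_apply, le_sup_iff,
        ← hp.pow_dvd_iff_le_factorization h1, ← hp.pow_dvd_iff_le_factorization h0] at h
      rcases h with h | h
      · exact Or.inr ⟨i, mem_insert_self _ _, h⟩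
      · exact (ih (fun j hj => hx j (mem_insert_of_mem hj)) h).imp_right fun ⟨j, hj, h⟩ => ⟨j, mem_insert_of_mem hj, h⟩
  rcases this S hx (hk.trans ho) with h1 | ⟨i, hi, h1⟩
  · rw [h1]; exact one_dvd _
  · exact (Nat.dvd_gcd (hk.trans hA) h1).trans (h i hi)

lemma gcd_proper {d e : ℕ} (hd : d ≠ 0) (h : ¬ d ∣ e) : Nat.gcd d e ∈ d.properDivisors := by
  rw [Nat.mem_properDivisors]
  refine ⟨Nat.gcd_dvd_left _ _, lt_of_le_of_ne (Nat.gcd_le_left _ (Nat.pos_of_ne_zero hd)) fun h' => h ?_⟩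
  rw [← h']; exact Nat.gcd_dvd_right _ _

lemma Rp_ne {q d : ℕ} (hq : 8 ≤ q) (hd : 2 ≤ d) : Rp q d ≠ 0 ∧ Rp q d * Ph q d = q ^ d - 1 := by
  have h1 := dvd_of_mul_left_dvd (cyc (by omega : q ≠ 0) (Nat.one_mem_properDivisors_iff_one_lt.2 hd))
  have h2 := Nat.div_mul_cancel h1
  refine ⟨fun h => ?_, h2⟩
  rw [Rp] at h
  rw [h] at h2
  have := one_lt_pow (by omega : d ≠ 0) (by omega : 1 < q)
  omega

lemma Rm_ne {q d : ℕ} (hq : 8 ≤ q) (hd : 2 ≤ d) : Rm q d ≠ 0 ∧ Rm q d * Ph q (2 * d) = q ^ d + 1 := by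
  have h1 := cyc (by omega : q ≠ 0) (Nat.mem_properDivisors.2 ⟨dvd_mul_left d 2, by omega⟩)
  have h3 := one_lt_pow (by omega : d ≠ 0) (by omega : 1 < q)
  have h4 : q ^ (2 * d) - 1 = (q ^ d - 1) * (q ^ d + 1) := by rw [mul_comm 2, pow_mul, mul_comm, ← Nat.sq_sub_sq, one_pow]
  rw [h4] at h1
  have h1 := Nat.dvd_of_mul_dvd_mul_left (by omega) h1
  have h2 := Nat.div_mul_cancel h1
  refine ⟨fun h => ?_, h2⟩
  rw [Rm] at h
  rw [h] at h2
  omega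

lemma ord_p {ι : Type} (S : Finset ι) (e : ι → ℕ) (he : ∀ i ∈ S, e i ≠ 0) {q d o : ℕ} (hq : 8 ≤ q) (hd : 2 ≤ d) (hod : Odd d) (h : ∀ i ∈ S, ¬ d ∣ e i)
    (h1 : o ∣ q ^ d - 1) (h2 : o ∣ S.lcm fun i => q ^ (2 * e i) - 1) : o ∣ Rp q d := by
  refine lcm_arg S _ (fun i hi => ?_) h1 h2 fun i hi => ?_
  · have := one_lt_pow (by have := he i hi; omega : 2 * e i ≠ 0) (by omega : 1 < q); omega
  · rw [Nat.pow_sub_one_gcd_pow_sub_one]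
    have h3 := gcd_proper (by omega : d ≠ 0) (fun h' => h i hi ((Coprime.dvd_mul_left (Nat.coprime_two_right.2 hod)).1 h') : ¬ d ∣ 2 * e i)
    have h4 := cyc (by omega : q ≠ 0) h3
    rw [← (Rp_ne hq hd).2] at h4
    exact Nat.dvd_of_mul_dvd_mul_right (Nat.pos_of_ne_zero fun h0 => by
      have := cyc_ge hq hd; rw [h0] at this; have := one_le_pow d.totient 7 (by norm_num); omega) h4

lemma ord_m {ι : Type} (S : Finset ι) (e : ι → ℕ) (he : ∀ i ∈ S, e i ≠ 0) {q d o : ℕ} (hq : 8 ≤ q) (hqe : Even q) (hd : 2 ≤ d) (h : ∀ i ∈ S, ¬ d ∣ e i)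
    (h1 : o ∣ q ^ d + 1) (h2 : o ∣ S.lcm fun i => q ^ (2 * e i) - 1) : o ∣ Rm q d := by
  have h3 := one_lt_pow (by omega : d ≠ 0) (by omega : 1 < q)
  have h4 : q ^ (2 * d) - 1 = (q ^ d - 1) * (q ^ d + 1) := by rw [mul_comm 2, pow_mul, mul_comm, ← Nat.sq_sub_sq, one_pow]
  have hc : Coprime o (q ^ d - 1) := by
    refine Coprime.coprime_dvd_left h1 ?_
    obtain ⟨x, hx⟩ := hqe.pow_of_ne_zero (by omega : d ≠ 0)
    have h5 : Coprime (q ^ d - 1 + 2) (q ^ d - 1) := by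
      rw [Nat.coprime_self_add_left, Nat.coprime_two_left]; exact ⟨x - 1, by omega⟩
    rwa [show q ^ d - 1 + 2 = q ^ d + 1 by omega] at h5
  refine hc.dvd_of_dvd_mul_left (m := q ^ d - 1) ?_
  refine lcm_arg S _ (fun i hi => ?_) ((h1.mul_left (q ^ d - 1)).trans h4.symm.dvd) h2 fun i hi => ?_
  · have := one_lt_pow (by have := he i hi; omega : 2 * e i ≠ 0) (by omega : 1 < q); omega
  · rw [Nat.pow_sub_one_gcd_pow_sub_one]
    have h3 := gcd_proper (by omega : 2 * d ≠ 0) (fun h' => h i hi (Nat.dvd_of_mul_dvd_mul_left (by norm_num) h') : ¬ 2 * d ∣ 2 * e i)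
    have h5 := cyc (by omega : q ≠ 0) h3
    rw [h4, ← (Rm_ne hq hd).2, ← mul_assoc] at h5
    exact Nat.dvd_of_mul_dvd_mul_right (Nat.pos_of_ne_zero fun h0 => by
      have := cyc_ge hq (by omega : 2 ≤ 2 * d); rw [h0] at this; have := one_le_pow (2 * d).totient 7 (by norm_num); omega) h5

end
end QM

namespace QM
open Polynomial QuadraticAlgebra
section
variable {F : Type} [Field F] [Fintype F] {m : ℕ}

lemma sqf_dvd {g : F[X]} (hg : g ∈ Mn F m) (hs : Squarefree g) (D : F[X]) (h : ∀ P ∈ Ps F m, P ∣ g → P ∣ D) : g ∣ D := by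
  have hc : ((Ps F m).filter (· ∣ g) : Set F[X]).Pairwise (Function.onFun IsCoprime fun P : F[X] => P) := by
    intro P hP Q hQ hne
    have hP := mem_Ps.1 (mem_filter.1 hP).1
    have hQ := mem_Ps.1 (mem_filter.1 hQ).1
    exact (hP.2.1.coprime_iff_not_dvd).2 fun h => hne (ir_dvd ⟨hP.1, hP.2.1⟩ ⟨hQ.1, hQ.2.1⟩ h)
  have hm : ∀ P ∈ (Ps F m).filter (· ∣ g), P.Monic := fun P hP => (mem_Ps.1 (mem_filter.1 hP).1).1
  have h1 : ∏ P ∈ (Ps F m).filter (· ∣ g), P ∣ g := prod_dvd_of_coprime hc fun P hP => (mem_filter.1 hP).2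
  have h2 : ∏ P ∈ (Ps F m).filter (· ∣ g), P ∣ D := prod_dvd_of_coprime hc fun P hP => h P (mem_filter.1 hP).1 (mem_filter.1 hP).2
  rw [mem_Mn] at hg
  rwa [← eq_of_monic_of_dvd_of_natDegree_le (monic_prod_of_monic _ _ hm) hg.1 h1] at h2
  rw [natDegree_prod_of_monic _ _ hm, hg.2]
  exact deg_sum (mem_Mn.2 hg) hs

variable [CharP F 2]

lemma q_even : Even (fcd F) := Nat.even_iff.2 (FiniteField.even_card_iff_char_two.1 (ringChar.eq F 2))

lemma om_pow (P : F[X]) [MP P] (hi : Irreducible P) : (pos P → (ω : QA (AdjoinRoot P) (root P)) ^ (fcd F ^ P.natDegree - 1) = 1) ∧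
    (¬ pos P → (ω : QA (AdjoinRoot P) (root P)) ^ (fcd F ^ P.natDegree + 1) = 1) := by
  haveI : Fact (Irreducible P) := ⟨hi⟩
  rw [← card_AR P]
  constructor
  · rintro ⟨t, ht⟩
    exact omega_pow_split (K := AdjoinRoot P) _ (root_unit P).ne_zero ht
  · intro h
    exact omega_pow_inert (K := AdjoinRoot P) _ fun t ht => h ⟨t, ht⟩

lemma isoP (g P : F[X]) [MP g] (hg : g ∈ Mn F m) (hq : 8 ≤ fcd F) (hP : P.Monic) (hi : Irreducible P) (hPg : P ∣ g) (hd : 2 ≤ P.natDegree) (hod : Odd P.natDegree)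
    (h1 : ∀ Q ∈ Ps F m, Q ∣ g → Q ≠ P → ¬ P.natDegree ∣ Q.natDegree)
    (h2 : ¬ P ∣ Dl F (Rp (fcd F) P.natDegree)) (h3 : ¬ P ∣ Dl F (Rm (fcd F) P.natDegree)) : ∃ k, IsoP P g k := by
  let S := (Ps F m).filter fun Q => Q ∣ g ∧ Q ≠ P
  have hS : ∀ Q ∈ S, (Q.Monic ∧ Irreducible Q) ∧ Q ∣ g ∧ ¬ P.natDegree ∣ Q.natDegree := fun Q hQ => by
    have hQ := mem_filter.1 hQ
    exact ⟨⟨(mem_Ps.1 hQ.1).1, (mem_Ps.1 hQ.1).2.1⟩, hQ.2.1, h1 Q hQ.1 hQ.2.1 hQ.2.2⟩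
  refine ⟨S.lcm fun Q => fcd F ^ (2 * Q.natDegree) - 1, sqf_dvd hg MP.sq _ fun Q hQ hQg => ?_, ?_⟩
  · by_cases hQP : Q = P
    · rw [hQP]; exact dvd_mul_right _ _
    have hQS : Q ∈ S := mem_filter.2 ⟨hQ, hQg, hQP⟩
    have hQ' := mem_Ps.1 hQ
    have := MP.of_dvd hQ'.1 hQg hQ'.2.1
    refine Dvd.dvd.mul_left ((Dl_dvd Q _).2 ?_) _
    rw [← orderOf_dvd_iff_pow_eq_one]
    refine dvd_trans ?_ (Finset.dvd_lcm hQS)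
    have h4 : fcd F ^ (2 * Q.natDegree) - 1 = (fcd F ^ Q.natDegree + 1) * (fcd F ^ Q.natDegree - 1) := by
      rw [mul_comm 2, pow_mul, ← Nat.sq_sub_sq, one_pow]
    rw [h4]
    by_cases hp : pos Q
    · exact (orderOf_dvd_iff_pow_eq_one.2 ((om_pow Q hQ'.2.1).1 hp)).mul_left _
    · exact (orderOf_dvd_iff_pow_eq_one.2 ((om_pow Q hQ'.2.1).2 hp)).mul_right _
  · have := MP.of_dvd hP hPg hi
    rw [Dl_dvd, ← orderOf_dvd_iff_pow_eq_one] at h2 h3 ⊢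
    intro h4
    by_cases hp : pos P
    · exact h2 (ord_p S _ (fun Q hQ => (hS Q hQ).1.2.natDegree_pos.ne') hq hd hod (fun Q hQ => (hS Q hQ).2.2) (orderOf_dvd_iff_pow_eq_one.2 ((om_pow P hi).1 hp)) h4)
    · exact h3 (ord_m S _ (fun Q hQ => (hS Q hQ).1.2.natDegree_pos.ne') hq q_even hd (fun Q hQ => (hS Q hQ).2.2) (orderOf_dvd_iff_pow_eq_one.2 ((om_pow P hi).2 hp)) h4)

noncomputable def Bd (F : Type) [Field F] [Fintype F] (d : ℕ) : Finset F[X] :=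
  (Ir F d).filter fun P => P ∣ Dl F (Rp (fcd F) d) ∨ P ∣ Dl F (Rm (fcd F) d)

lemma Bd_w (hq : 8 ≤ fcd F) (d : ℕ) (hd : 2 ≤ d) (hod : Odd d) : ∑ P ∈ Bd F d, w P ≤ 3 / (d : ℝ) ^ 2 := by
  have hc : ∀ R, R ≠ 0 → d * ((Ir F d).filter fun P => P ∣ Dl F R).card ≤ R := fun R hR => by
    have := ir_count ((Ir F d).filter fun P => P ∣ Dl F R) d (filter_subset _ _) (Dl F R) (Dl_deg hR).2.ne_zero fun P hP => (mem_filter.1 hP).2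
    rwa [(Dl_deg hR).1] at this
  obtain ⟨hp0, hp⟩ := Rp_ne hq hd
  obtain ⟨hm0, hm⟩ := Rm_ne hq hd
  have t1 := (tot_ge d hod).trans (cyc_ge hq hd)
  have t2 : d ≤ Ph (fcd F) (2 * d) := (tot_ge d hod).trans (by
    have := cyc_ge hq (by omega : 2 ≤ 2 * d)
    rwa [Nat.totient_mul (Nat.coprime_two_left.2 hod), Nat.totient_two, one_mul] at this)
  have h1 := hc _ hp0
  have h2 := hc _ hm0
  have h3 : (Bd F d).card ≤ ((Ir F d).filter fun P => P ∣ Dl F (Rp (fcd F) d)).card + ((Ir F d).filter fun P => P ∣ Dl F (Rm (fcd F) d)).card := by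
    rw [Bd, Finset.filter_or]; exact card_union_le _ _
  have hq1 : 1 ≤ fcd F ^ d := one_le_pow _ _ (by omega)
  have h4 : (Bd F d).card * d ^ 2 ≤ 3 * fcd F ^ d := by
    have e1 : Rp (fcd F) d * d ≤ fcd F ^ d := (Nat.mul_le_mul_left _ t1).trans (hp.le.trans (Nat.sub_le _ _))
    have e2 : Rm (fcd F) d * d ≤ 2 * fcd F ^ d := (Nat.mul_le_mul_left _ t2).trans (hm.le.trans (by omega))
    calc _ ≤ d * (d * ((Ir F d).filter fun P => P ∣ Dl F (Rp (fcd F) d)).card + d * ((Ir F d).filter fun P => P ∣ Dl F (Rm (fcd F) d)).card) := by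
          rw [← mul_add, ← mul_assoc, mul_comm, ← pow_two]; gcongr
      _ ≤ d * (Rp (fcd F) d + Rm (fcd F) d) := by gcongr
      _ = Rp (fcd F) d * d + Rm (fcd F) d * d := by ring
      _ ≤ _ := by linarith
  rw [sum_congr rfl fun P hP => by rw [w, (mem_Ir.1 (mem_filter.1 hP).1).1.2], sum_const, nsmul_eq_mul, ← div_eq_mul_inv,
    div_le_div_iff₀ (by have := q_pos (F := F); positivity) (by positivity)]
  exact_mod_cast h4

end
end QM

namespace QM
open Polynomial
section
variable {F : Type} [Field F] [Fintype F] [CharP F 2]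
variable {K : Type} [Field K] [Fintype K] [Algebra F K]

omit [CharP F 2] in
lemma pos_mp (s : K) (h : (minpoly F s).natDegree = finrank F K) : pos (minpoly F s) ↔ ∃ t : K, t * t + s * t + 1 = 0 := by
  have hI : IsIntegral F s := Algebra.IsIntegral.isIntegral s
  haveI : Fact (Irreducible (minpoly F s)) := ⟨minpoly.irreducible hI⟩
  let φ : AdjoinRoot (minpoly F s) →ₐ[F] K := AdjoinRoot.liftAlgHom _ (Algebra.ofId F K) s (minpoly.aeval F s)
  have h1 : φ (root _) = s := AdjoinRoot.liftAlgHom_root _ _ _ _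
  have h2 : Injective φ := φ.toRingHom.injective
  have h3 : Surjective φ := by
    have hn := minpoly.ne_zero hI
    have : FiniteDimensional F (AdjoinRoot (minpoly F s)) := (AdjoinRoot.powerBasis hn).finite
    exact (LinearMap.injective_iff_surjective_of_finrank_eq_finrank (f := φ.toLinearMap) (by rw [← h, (AdjoinRoot.powerBasis hn).finrank, AdjoinRoot.powerBasis_dim])).1 h2
  constructor
  · rintro ⟨t, ht⟩
    refine ⟨φ t, ?_⟩
    have := congrArg φ ht
    simpa only [map_add, map_mul, map_one, map_zero, h1] using this
  · rintro ⟨t, ht⟩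
    obtain ⟨t, rfl⟩ := h3 t
    refine ⟨t, h2 ?_⟩
    simpa only [map_add, map_mul, map_one, map_zero, h1] using ht

lemma img_card [CharP K 2] : fcd K ≤ 2 * (univ.filter fun s : K => ∃ t : K, t * t + s * t + 1 = 0).card + 1 ∧
    2 * (univ.filter fun s : K => ∃ t : K, t * t + s * t + 1 = 0).card ≤ fcd K := by
  set I := univ.filter fun s : K => ∃ t : K, t * t + s * t + 1 = 0
  have hI : ∀ s, s ∈ I ↔ ∃ t : K, t * t + s * t + 1 = 0 := fun s => by simp [I]
  have key : ∀ s t : K, t * t + s * t + 1 = 0 → t ≠ 0 ∧ t + t⁻¹ = s := fun s t h => by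
    have ht : t ≠ 0 := by rintro rfl; simp at h
    refine ⟨ht, ?_⟩
    field_simp
    linear_combination h - cse (s * t)
  have key2 : ∀ t : K, t ≠ 0 → t * t + (t + t⁻¹) * t + 1 = 0 := fun t ht => by
    field_simp
    linear_combination cse (t * t) + cse (1 : K)
  constructor
  · have h1 := card_le_mul_card_image_of_maps_to (s := univ.erase (0 : K)) (t := I) (f := fun t => t + t⁻¹)
      (fun t ht => (hI _).2 ⟨t, key2 t (ne_of_mem_erase ht)⟩) 2 (by
        intro s _
        have hp : (X ^ 2 + C s * X + C 1 : K[X]) ≠ 0 := by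
          intro h; have := congrArg (fun p => coeff p 2) h; simp [coeff_X, coeff_one] at this
        refine le_trans (card_le_card (t := (X ^ 2 + C s * X + C 1 : K[X]).roots.toFinset) ?_) ((toFinset_card_le _).trans ((card_roots' _).trans ?_))
        · intro t ht
          simp only [mem_filter, mem_erase, mem_univ, and_true] at ht
          rw [Multiset.mem_toFinset, mem_roots hp]
          have := key2 t ht.1
          rw [ht.2] at this
          simp [pow_two, this]
        · compute_degree)
    rw [card_erase_of_mem (mem_univ _), card_univ] at h1
    omega
  · have h1 := Finset.mul_card_image_le_card_of_maps_to (s := (univ.erase (0 : K)).erase 1) (t := I.erase 0) (f := fun t => t + t⁻¹)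
      (fun t ht => by
        have h1 := ne_of_mem_erase ht
        have h0 := ne_of_mem_erase (Finset.mem_of_mem_erase ht)
        refine mem_erase.2 ⟨fun h => ?_, (hI _).2 ⟨t, key2 t h0⟩⟩
        field_simp at h
        have h2 : (t + 1) ^ 2 = 0 := by linear_combination h + cse t
        exact h1 (CharTwo.add_eq_zero.1 (pow_eq_zero_iff two_ne_zero |>.1 h2))) 2 (by
        intro s hs
        obtain ⟨hs0, hs⟩ := mem_erase.1 hs
        obtain ⟨t, ht⟩ := (hI s).1 hs
        obtain ⟨ht0, hts⟩ := key s t ht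
        have ht1 : t ≠ t⁻¹ := fun h => hs0 (by rw [← hts, ← h, cse])
        have h1 : t ≠ 1 := by rintro rfl; simp at ht1
        rw [← Finset.card_pair ht1]
        refine card_le_card fun x hx => ?_
        rw [mem_insert, mem_singleton] at hx
        rcases hx with rfl | rfl
        · simp [ht0, h1, hts]
        · simp [ht0, h1, ← hts, add_comm])
    have h0 : (0 : K) ∈ I := (hI 0).2 ⟨1, by simpa using cse (1 : K)⟩
    rw [card_erase_of_mem h0, card_erase_of_mem (by simp), card_erase_of_mem (mem_univ _), card_univ] at h1
    have := one_lt_card (α := K)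
    have := Finset.card_pos.2 ⟨0, h0⟩
    omega

omit [CharP F 2] in
lemma low_card (d : ℕ) (hd : d ≠ 0) (h : finrank F K = d) : (univ.filter fun s : K => (minpoly F s).natDegree ≠ d).card ≤ fcd F ^ (d / 2 + 1) := by
  have hI : ∀ s : K, IsIntegral F s := fun s => Algebra.IsIntegral.isIntegral s
  have h1 : (univ.filter fun s : K => (minpoly F s).natDegree ≠ d) ⊆ (Ps F (d / 2)).biUnion fun P => (P.aroots K).toFinset := by
    intro s hs
    simp only [mem_filter, mem_univ, true_and] at hs
    obtain ⟨k, hk⟩ := minpoly.degree_dvd (hI s)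
    rw [h] at hk
    refine mem_biUnion.2 ⟨minpoly F s, mem_Ps.2 ⟨minpoly.monic (hI s), minpoly.irreducible (hI s), ?_⟩, by simp [minpoly.ne_zero (hI s)]⟩
    rcases k with _ | _ | k
    · omega
    · omega
    · rw [Nat.le_div_iff_mul_le two_pos, hk]; gcongr; omega
  refine (card_le_card h1).trans (card_biUnion_le.trans ?_)
  have h2 : ∑ P ∈ Ps F (d / 2), ((P.aroots K).toFinset).card ≤ ∑ e ∈ Finset.Icc 1 (d / 2), fcd F ^ e := by
    calc _ ≤ ∑ P ∈ Ps F (d / 2), P.natDegree := sum_le_sum fun P _ => (toFinset_card_le _).trans ((card_roots' _).trans natDegree_map_le)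
      _ = ∑ e ∈ Finset.Icc 1 (d / 2), ∑ P ∈ Ir F e, P.natDegree := by
        have := sum_Ps (F := F) (m := d / 2) fun P => (P.natDegree : ℝ)
        exact_mod_cast this
      _ ≤ _ := by
        refine sum_le_sum fun e he => ?_
        rw [sum_congr rfl fun P hP => (mem_Ir.1 hP).1.2, sum_const, smul_eq_mul, mul_comm]
        exact Ir_card e (by have := mem_Icc.1 he; omega)
  refine h2.trans ?_
  have h3 : ∀ n, ∑ e ∈ Finset.Icc 1 n, fcd F ^ e ≤ fcd F ^ (n + 1) := by
    intro n
    induction n with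
    | zero => simp
    | succ n ih =>
      rw [Finset.sum_Icc_succ_top (by omega), pow_succ _ (n + 1)]
      have := one_lt_card (α := F)
      nlinarith [Nat.zero_le (fcd F ^ (n + 1))]
  exact h3 _

def ng (P : F[X]) : Prop := ¬ pos P

lemma sgn_card (d : ℕ) (hd : 8 ≤ d) : fcd F ^ d ≤ 4 * (d * ((Ir F d).filter pos).card) ∧ fcd F ^ d ≤ 4 * (d * ((Ir F d).filter ng).card) := by
  haveI : NeZero d := ⟨by omega⟩
  let K := FiniteField.Extension F 2 d
  haveI : Fintype K := ofFinite K
  haveI : CharP K 2 := charP_of_injective_algebraMap (algebraMap F K).injective 2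
  have hK : fcd K = fcd F ^ d := by
    rw [← card_eq_fintype_card, ← card_eq_fintype_card]; exact FiniteField.natCard_extension F 2 d
  have hfr : finrank F K = d := FiniteField.finrank_extension F 2 d
  have hlow := low_card (F := F) (K := K) d (by omega) hfr
  obtain ⟨hi1, hi2⟩ := img_card (K := K)
  have hI : ∀ s : K, IsIntegral F s := fun s => Algebra.IsIntegral.isIntegral s
  have key : ∀ (S : Finset K) (Q : F[X] → Prop), (∀ s ∈ S, (minpoly F s).natDegree = d → Q (minpoly F s)) → S.card ≤ d * ((Ir F d).filter Q).card + fcd F ^ (d / 2 + 1) := by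
    intro S Q h
    have h1 := card_filter_add_card_filter_not (s := S) fun s => (minpoly F s).natDegree = d
    have h2 : (S.filter fun s => ¬ (minpoly F s).natDegree = d).card ≤ fcd F ^ (d / 2 + 1) := (card_le_card (Finset.filter_subset_filter _ (Finset.subset_univ _))).trans hlow
    have h3 := card_le_mul_card_image_of_maps_to (s := S.filter fun s => (minpoly F s).natDegree = d) (t := (Ir F d).filter Q) (f := fun s => minpoly F s)
      (fun s hs => by
        rw [mem_filter] at hs
        exact mem_filter.2 ⟨mem_Ir.2 ⟨⟨minpoly.monic (hI s), hs.2⟩, minpoly.irreducible (hI s)⟩, h s hs.1 hs.2⟩) d (fun P hP => by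
        have hP := mem_Ir.1 (mem_filter.1 hP).1
        refine (card_le_card (t := (P.aroots K).toFinset) fun s hs => ?_).trans ((toFinset_card_le _).trans ((card_roots' _).trans (natDegree_map_le.trans hP.1.2.le)))
        have := (mem_filter.1 hs).2
        subst this
        simp [minpoly.ne_zero (hI s)])
    omega
  have h1 := key (univ.filter fun s : K => ∃ t : K, t * t + s * t + 1 = 0) pos fun s hs hd => (pos_mp s (hd.trans hfr.symm)).2 (mem_filter.1 hs).2
  have h2 := key (univ.filter fun s : K => ¬ ∃ t : K, t * t + s * t + 1 = 0) ng fun s hs hd => (pos_mp s (hd.trans hfr.symm)).not.2 (mem_filter.1 hs).2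
  have h3 := card_filter_add_card_filter_not (s := (univ : Finset K)) fun s => ∃ t : K, t * t + s * t + 1 = 0
  rw [card_univ] at h3
  have h4 : fcd F ^ (d / 2 + 1) * 8 ≤ fcd F ^ d := calc
    _ ≤ fcd F ^ (d / 2 + 1) * fcd F ^ 3 := by
      gcongr; exact pow_le_pow_left (one_lt_card (α := F)) 3
    _ = fcd F ^ (d / 2 + 1 + 3) := (pow_add _ _ _).symm
    _ ≤ _ := pow_le_pow_right card_pos (by omega)
  have h5 : 1 ≤ fcd F ^ (d / 2 + 1) := one_le_pow _ _ card_pos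
  omega

end
end QM

namespace QM
open Polynomial
section
variable {F : Type} [Field F] [Fintype F] [CharP F 2]

def dd (p k : ℕ) : ℕ := if p ∣ 4 * k + 1 then 4 * k + 3 else 4 * k + 1

lemma dd_eq (p k : ℕ) : dd p k = 4 * k + 1 ∨ dd p k = 4 * k + 3 := by
  unfold dd; split_ifs <;> simp

lemma dd_p {p : ℕ} (hp : p.Prime) (k : ℕ) : ¬ p ∣ dd p k := by
  unfold dd
  split_ifs with h
  · intro h'
    have h2 : p ∣ 2 := by have := Nat.dvd_sub h' h; rwa [show 4 * k + 3 - (4 * k + 1) = 2 by omega] at this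
    rw [(Nat.prime_dvd_prime_iff_eq hp Nat.prime_two).1 h2] at h
    omega
  · exact h

lemma harm (a b : ℕ) (h : a ≤ b) : ((b : ℝ) - a) / 8 ≤ ∑ k ∈ Finset.Ico (2 ^ a : ℕ) (2 ^ b), 1 / (4 * (k : ℝ) + 4) := by
  induction b, h using Nat.le_induction with
  | base => simp
  | succ b h ih =>
    rw [← Finset.sum_Ico_consecutive _ (pow_le_pow_right two_pos h) (pow_le_pow_right two_pos (by omega : b ≤ b + 1))]
    have h1 := Finset.card_nsmul_le_sum (Finset.Ico (2 ^ b : ℕ) (2 ^ (b + 1))) (fun k : ℕ => 1 / (4 * (k : ℝ) + 4)) (1 / (8 * 2 ^ b)) (fun k hk => by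
      have : (k : ℝ) + 1 ≤ 2 ^ (b + 1) := by exact_mod_cast (mem_Ico.1 hk).2
      rw [pow_succ] at this
      exact one_div_le_one_div_of_le (by positivity) (by linarith))
    rw [Nat.card_Ico, nsmul_eq_mul, show 2 ^ (b + 1) - 2 ^ b = 2 ^ b by rw [pow_succ]; omega] at h1
    have h2 : ((2 ^ b : ℕ) : ℝ) * (1 / (8 * 2 ^ b)) = 1 / 8 := by push_cast; field_simp
    push_cast at *
    linarith

noncomputable def Tq (Q : F[X] → Prop) (p t : ℕ) : Finset F[X] := (Finset.Ico (2 ^ (3 * t - 2)) (2 ^ (199 * t - 2))).biUnion fun k => (Ir F (dd p k)).filter Q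

omit [CharP F 2] in
lemma mem_Tq {Q : F[X] → Prop} {p t : ℕ} (ht : 1 ≤ t) {P : F[X]} (h : P ∈ Tq Q p t) : P.Monic ∧ Irreducible P ∧ Q P ∧ Odd P.natDegree ∧ (p.Prime → ¬ p ∣ P.natDegree) ∧ 2 ^ (3 * t) ≤ P.natDegree ∧ P.natDegree ≤ 2 ^ (199 * t) := by
  obtain ⟨k, hk, h⟩ := mem_biUnion.1 h
  obtain ⟨h, hQ⟩ := mem_filter.1 h
  obtain ⟨⟨h1, h2⟩, h3⟩ := mem_Ir.1 h
  rw [mem_Ico] at hk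
  rw [h2]
  have e1 : 2 ^ (3 * t) = 2 ^ (3 * t - 2) * 2 ^ 2 := by rw [← pow_add]; congr 1; omega
  have e2 : 2 ^ (199 * t) = 2 ^ (199 * t - 2) * 2 ^ 2 := by rw [← pow_add]; congr 1; omega
  refine ⟨h1, h3, hQ, ?_, fun hp => dd_p hp k, ?_, ?_⟩
  · rw [Nat.odd_iff]; rcases dd_eq p k with h | h <;> omega
  · rcases dd_eq p k with h | h <;> omega
  · rcases dd_eq p k with h | h <;> omega

omit [CharP F 2] in
lemma fam (Q : F[X] → Prop) (hQ : ∀ d, 8 ≤ d → fcd F ^ d ≤ 4 * (d * ((Ir F d).filter Q).card)) (p t m : ℕ) (ht : 1 ≤ t) (hm : 3 * t * 2 ^ (199 * t) ≤ m) :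
    ((Sq (Tq Q p t) m).card : ℝ) ≤ (fcd F : ℝ) ^ m * (2 / 8 ^ t) := by
  have h1 : ((Sq (Tq Q p t) m).card : ℝ) ≤ (fcd F : ℝ) ^ m * (2 / 2 ^ (3 * t)) := by
    refine sieve (Tq Q p t) (2 ^ (199 * t)) (3 * t) (fun P hP => ?_) ?_ hm ?_
    · obtain ⟨h1, h2, -, -, -, -, h3⟩ := mem_Tq ht hP
      exact mem_Ps.2 ⟨h1, h2, h3⟩
    · unfold Tq
      rw [sum_biUnion]
      · have h1 := harm (3 * t - 2) (199 * t - 2) (by omega)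
        have h2 : ∀ k ∈ Finset.Ico (2 ^ (3 * t - 2) : ℕ) (2 ^ (199 * t - 2)), 1 / (4 * (k : ℝ) + 4) * (1 / 4) ≤ ∑ P ∈ (Ir F (dd p k)).filter Q, w P := by
          intro k hk
          have hk := (mem_Ico.1 hk).1
          have h3 : 2 ^ 1 ≤ 2 ^ (3 * t - 2) := pow_le_pow_right two_pos (by omega)
          have h4 := hQ (dd p k) (by rcases dd_eq p k with h | h <;> omega)
          have h5 : (dd p k : ℝ) ≤ 4 * k + 4 := by
            have : dd p k ≤ 4 * k + 4 := by rcases dd_eq p k with h | h <;> omega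
            exact_mod_cast this
          rw [sum_congr rfl fun P hP => by rw [w, (mem_Ir.1 (mem_filter.1 hP).1).1.2], sum_const, nsmul_eq_mul]
          have h6 : (fcd F : ℝ) ^ dd p k ≤ 4 * (dd p k * ((Ir F (dd p k)).filter Q).card) := by exact_mod_cast h4
          have h7 : (0 : ℝ) < (fcd F : ℝ) ^ dd p k := pow_pos q_pos _
          rw [div_mul_div_comm, ← div_eq_mul_inv, div_le_div_iff₀ (by positivity) h7]
          have h8 : (0 : ℝ) ≤ ((Ir F (dd p k)).filter Q).card := cast_nonneg _
          nlinarith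
        have h3 := sum_le_sum h2
        rw [← sum_mul] at h3
        have e1 : ((3 * t - 2 : ℕ) : ℝ) = 3 * t - 2 := by rw [cast_sub (by omega)]; push_cast; ring
        have e2 : ((199 * t - 2 : ℕ) : ℝ) = 199 * t - 2 := by rw [cast_sub (by omega)]; push_cast; ring
        rw [e1, e2] at h1
        have : (0 : ℝ) ≤ t := cast_nonneg t
        push_cast
        linarith
      · intro k _ l _ hkl
        refine disjoint_left.2 fun P hP hP' => hkl ?_
        have a := (mem_Ir.1 (mem_filter.1 hP).1).1.2
        have b := (mem_Ir.1 (mem_filter.1 hP').1).1.2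
        rcases dd_eq p k with h | h <;> rcases dd_eq p l with h' | h' <;> omega
    · have : 0 < 3 * t * 2 ^ (199 * t) := by positivity
      omega
  rwa [pow_mul, show (2 : ℝ) ^ 3 = 8 by norm_num] at h1

end
end QM

namespace QM
open Polynomial
section
variable {F : Type} [Field F] [Fintype F] {m : ℕ}

noncomputable def cn (F : Type) [Field F] [Fintype F] (m : ℕ) (Q : F[X] → Prop) : ℝ := (((Mn F m).filter Q).card : ℝ) / (fcd F : ℝ) ^ m

lemma cn_le {Q : F[X] → Prop} {b : ℝ} (h : (((Mn F m).filter Q).card : ℝ) ≤ (fcd F : ℝ) ^ m * b) : cn F m Q ≤ b := by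
  have := pow_pos (q_pos (F := F)) m
  rwa [cn, div_le_iff₀ this, mul_comm]

lemma cn_mono {Q Q' : F[X] → Prop} (h : ∀ g, Q g → Q' g) : cn F m Q ≤ cn F m Q' := by
  have := pow_pos (q_pos (F := F)) m
  unfold cn
  gcongr
  exact h _

lemma cn_card {Q : F[X] → Prop} (S : Finset F[X]) (h : ∀ g ∈ Mn F m, Q g → g ∈ S) : cn F m Q ≤ S.card / (fcd F : ℝ) ^ m := by
  have := pow_pos (q_pos (F := F)) m
  unfold cn
  gcongr
  intro g hg
  rw [mem_filter] at hg
  exact h g hg.1 hg.2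

lemma cn_un {ι : Type} (s : Finset ι) (Q : ι → F[X] → Prop) (b : ι → ℝ) (h : ∀ i ∈ s, cn F m (Q i) ≤ b i) : cn F m (fun g => ∃ i ∈ s, Q i g) ≤ ∑ i ∈ s, b i := by
  refine le_trans ?_ (sum_le_sum h)
  have := pow_pos (q_pos (F := F)) m
  refine (cn_card (s.biUnion fun i => (Mn F m).filter (Q i)) fun g hg ⟨i, hi, h⟩ => mem_biUnion.2 ⟨i, hi, mem_filter.2 ⟨hg, h⟩⟩).trans ?_
  simp only [cn]
  rw [← Finset.sum_div, ← cast_sum]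
  gcongr
  exact card_biUnion_le

lemma cn_or (Q Q' : F[X] → Prop) : cn F m (fun g => Q g ∨ Q' g) ≤ cn F m Q + cn F m Q' := by
  have := pow_pos (q_pos (F := F)) m
  refine (cn_card ((Mn F m).filter Q ∪ (Mn F m).filter Q') fun g hg h => by simpa [hg] using h).trans ?_
  simp only [cn]
  rw [← add_div]
  gcongr
  exact_mod_cast card_union_le _ _

lemma cn_dvd (Q : F[X]) (hQ : Q.Monic) : cn F m (Q ∣ ·) ≤ w Q := cn_le (dvd_count m Q hQ)

lemma w_mul {P Q : F[X]} (hP : P.Monic) (hQ : Q.Monic) : w (P * Q) = w P * w Q := by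
  rw [w, w, w, hP.natDegree_mul hQ, pow_add, mul_inv]

def R (t : ℕ) : Finset ℕ := Finset.Ioo (2 ^ (3 * t) - 1) (2 ^ (199 * t) + 1)

lemma mem_R {t d : ℕ} : d ∈ R t ↔ 2 ^ (3 * t) ≤ d ∧ d ≤ 2 ^ (199 * t) := by
  have : 0 < 2 ^ (3 * t) := by positivity
  rw [R, Finset.mem_Ioo]; omega

lemma R_sum (t : ℕ) : ∑ d ∈ R t, ((d : ℝ) ^ 2)⁻¹ ≤ 2 / 8 ^ t := by
  refine (sum_Ioo_inv_sq_le _ _).trans (le_of_eq ?_)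
  rw [cast_sub Nat.one_le_two_pow]
  push_cast
  rw [sub_add_cancel, pow_mul]; norm_num

lemma b1_le (t : ℕ) : cn F m (fun g => ∃ d ∈ R t, ∃ P ∈ Ir F d, ∃ k ∈ Finset.Icc 1 m, ∃ P' ∈ Ir F (d * k), P * P' ∣ g) ≤ (1 + Real.log m) * (2 / 8 ^ t) := by
  have hH : ∑ k ∈ Finset.Icc 1 m, ((k : ℝ))⁻¹ ≤ 1 + Real.log m := by
    have := harmonic_le_one_add_log m
    rw [harmonic_eq_sum_Icc] at this
    push_cast at this
    exact this
  have h0 : (0 : ℝ) ≤ ∑ k ∈ Finset.Icc 1 m, ((k : ℝ))⁻¹ := sum_nonneg fun k _ => by positivity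
  refine (cn_un (R t) _ (fun d => (∑ k ∈ Finset.Icc 1 m, ((k : ℝ))⁻¹) * ((d : ℝ) ^ 2)⁻¹) fun d hd => ?_).trans ?_
  · have hd0 : d ≠ 0 := by have := (mem_R.1 hd).1; have : 0 < 2 ^ (3 * t) := by positivity
                           omega
    refine (cn_un (Ir F d) _ (fun P => w P * ((d : ℝ)⁻¹ * ∑ k ∈ Finset.Icc 1 m, ((k : ℝ))⁻¹)) fun P hP => ?_).trans ?_
    · rw [mul_sum, mul_sum]
      refine cn_un _ _ _ fun k hk => ?_
      refine (cn_un _ _ (fun P' => w P * w P') fun P' hP' => ?_).trans ?_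
      · rw [← w_mul (mem_Ir.1 hP).1.1 (mem_Ir.1 hP').1.1]
        exact cn_dvd _ ((mem_Ir.1 hP).1.1.mul (mem_Ir.1 hP').1.1)
      · rw [← mul_sum]
        have := w_Ir (F := F) (d * k) (mul_ne_zero hd0 (by have := (mem_Icc.1 hk).1; omega))
        rw [Nat.cast_mul, one_div, mul_inv] at this
        exact mul_le_mul_of_nonneg_left this (w_nn P)
    · rw [← sum_mul]
      refine (mul_le_mul_of_nonneg_right (w_Ir d hd0) (by positivity)).trans (le_of_eq ?_)
      rw [one_div, sq, mul_inv]; ring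
  · rw [← mul_sum]
    exact mul_le_mul hH (R_sum t) (sum_nonneg fun k _ => by positivity) (h0.trans hH)

lemma b2_le [CharP F 2] (hq : 8 ≤ fcd F) (t : ℕ) (ht : 1 ≤ t) : cn F m (fun g => ∃ d ∈ R t, Odd d ∧ ∃ P ∈ Bd F d, P ∣ g) ≤ 6 / 8 ^ t := by
  refine (cn_un (R t) _ (fun d => 3 * ((d : ℝ) ^ 2)⁻¹) fun d hd => ?_).trans ?_
  · by_cases ho : Odd d
    · have hd2 : 2 ≤ d := by
        have h1 := (mem_R.1 hd).1
        have : 2 ^ 1 ≤ 2 ^ (3 * t) := pow_le_pow_right two_pos (by omega)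
        omega
      refine (cn_mono fun g h => h.2).trans ((cn_un _ _ w fun P hP => cn_dvd P (mem_Ir.1 (mem_filter.1 hP).1).1.1).trans ((Bd_w hq d hd2 ho).trans (le_of_eq (div_eq_mul_inv _ _))))
    · refine cn_le ?_
      simp only [ho, false_and, Finset.filter_false, Finset.card_empty, Nat.cast_zero]
      have := q_pos (F := F)
      positivity
  · rw [← mul_sum]
    have := R_sum t
    rw [show (6 : ℝ) / 8 ^ t = 3 * (2 / 8 ^ t) by ring]
    linarith

lemma pf_card (hm : m ≠ 0) {s : ℕ} (h : m < 2 ^ s) : (2 * m).primeFactors.card ≤ s := by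
  have h1 := Finset.pow_card_le_prod (2 * m).primeFactors (fun p => p) 2 fun p hp => (Nat.prime_of_mem_primeFactors hp).two_le
  have h2 := Nat.le_of_dvd (by omega) (Nat.prod_primeFactors_dvd (2 * m))
  have h3 : 2 ^ (2 * m).primeFactors.card < 2 ^ (s + 1) := by rw [pow_succ]; omega
  exact Nat.lt_succ_iff.1 ((Nat.pow_lt_pow_iff_right (by omega)).1 h3)

def bad (m t : ℕ) (g : F[X]) : Prop := (∃ P ∈ Ps F m, P * P ∣ g) ∨ X ∣ g ∨ (∃ d ∈ R t, ∃ P ∈ Ir F d, ∃ k ∈ Finset.Icc 1 m, ∃ P' ∈ Ir F (d * k), P * P' ∣ g) ∨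
  (∃ d ∈ R t, Odd d ∧ ∃ P ∈ Bd F d, P ∣ g) ∨ (∃ p ∈ (2 * m).primeFactors, g ∈ Sq (Tq pos p t) m) ∨ g ∈ Sq (Tq ng 2 t) m

lemma bad_le [CharP F 2] (hq : 8 ≤ fcd F) (t : ℕ) (ht : 1 ≤ t) (hm : 3 * t * 2 ^ (199 * t) ≤ m) (s : ℕ) (hs' : s = 400 * (t + 1)) (hm' : m < 2 ^ s) :
    cn F m (bad m t) ≤ 1 / ((fcd F : ℝ) - 1) + 1 / fcd F + 1612 * (t + 1) / 8 ^ t := by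
  have hm0 : m ≠ 0 := by have : 0 < 3 * t * 2 ^ (199 * t) := by positivity
                         omega
  have h0 : cn F m (fun g => ∃ P ∈ Ps F m, P * P ∣ g) ≤ 1 / ((fcd F : ℝ) - 1) := (cn_un _ _ (fun P => w P * w P) fun P hP => by
    have := (mem_Ps.1 hP).1
    rw [← w_mul this this]; exact cn_dvd _ (this.mul this)).trans sq_sum
  have hX : cn F m (fun g => X ∣ g) ≤ 1 / fcd F := (cn_dvd X monic_X).trans (by rw [w, natDegree_X, pow_one, one_div])
  have hs : ∀ Q p, (∀ d, 8 ≤ d → fcd F ^ d ≤ 4 * (d * ((Ir F d).filter Q).card)) → cn F m (fun g => g ∈ Sq (Tq Q p t) m) ≤ 2 / 8 ^ t := fun Q p h => by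
    have h0 := pow_pos (q_pos (F := F)) m
    refine (cn_card _ fun g _ h => h).trans ?_
    rw [div_le_iff₀ h0, mul_comm]
    exact fam Q h p t m ht hm
  have h3 := cn_un (F := F) (m := m) (2 * m).primeFactors (fun p g => g ∈ Sq (Tq pos p t) m) (fun _ => 2 / 8 ^ t) fun p _ => hs pos p fun d hd => (sgn_card d hd).1
  have h4 := hs ng 2 fun d hd => (sgn_card d hd).2
  have h1 := b1_le (F := F) (m := m) t
  have h2 := b2_le (F := F) (m := m) hq t ht
  rw [sum_const, nsmul_eq_mul] at h3
  have hc : ((2 * m).primeFactors.card : ℝ) ≤ s := by exact_mod_cast pf_card hm0 hm'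
  have hl : Real.log m ≤ s := by
    have h5 : Real.log m ≤ Real.log (2 ^ s) := Real.log_le_log (by positivity) (by exact_mod_cast hm'.le)
    rw [Real.log_pow] at h5
    have := Real.log_two_lt_d9
    nlinarith [(cast_nonneg s : (0 : ℝ) ≤ s)]
  have hs2 : (s : ℝ) = 400 * (t + 1) := by rw [hs']; push_cast; ring
  rw [hs2] at hc hl
  have e : (0 : ℝ) < 2 / 8 ^ t := by positivity
  have h1' := mul_le_mul_of_nonneg_right (add_le_add_right hl 1) e.le
  have h3' := mul_le_mul_of_nonneg_right hc e.le
  rw [show (1612 : ℝ) * (t + 1) / 8 ^ t = 806 * (t + 1) * (2 / 8 ^ t) by ring]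
  rw [show (6 : ℝ) / 8 ^ t = 3 * (2 / 8 ^ t) by ring] at h2
  have e2 : 0 ≤ (t : ℝ) * (2 / 8 ^ t) := by positivity
  unfold bad
  refine (cn_or _ _).trans ?_
  refine (add_le_add_right ((cn_or _ _).trans (add_le_add_right ((cn_or _ _).trans (add_le_add_right ((cn_or _ _).trans (add_le_add_right (cn_or _ _) _)) _)) _)) _).trans ?_
  nlinarith

end
end QM

namespace QM
open Polynomial
section
variable {F : Type} [Field F] [Fintype F] [CharP F 2] {m : ℕ}

lemma num1 (t : ℕ) (ht : 20 ≤ t) : 9 * (400 * (t + 1) + 1) ≤ 2 ^ t := by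
  induction t, ht using Nat.le_induction with
  | base => norm_num
  | succ t h ih =>
    rw [pow_succ 2 t]
    generalize 2 ^ t = T at *
    linarith

lemma tq_ok (hq : 8 ≤ fcd F) {t : ℕ} (ht : 1 ≤ t) {g : F[X]} [MP g] (hg : g ∈ Mn F m) (hb : ¬ bad m t g) {Q : F[X] → Prop} {p : ℕ} {P : F[X]} (hP : P ∈ Tq Q p t) (hPg : P ∣ g) :
    P.Monic ∧ Irreducible P ∧ P ∣ g ∧ 2 ≤ P.natDegree ∧ ∃ k, IsoP P g k := by
  obtain ⟨h1, h2, h3, h4, -, h6⟩ := mem_Tq ht hP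
  have hR := mem_R.2 h6
  have h8 : 2 ^ 1 ≤ 2 ^ (3 * t) := pow_le_pow_right two_pos (by omega)
  have hI : P ∈ Ir F P.natDegree := mem_Ir.2 ⟨⟨h1, rfl⟩, h2⟩
  unfold bad at hb
  push Not at hb
  obtain ⟨-, -, b1, b2, -⟩ := hb
  refine ⟨h1, h2, hPg, by omega, isoP g P hg hq h1 h2 hPg (by omega) h4 ?_ ?_ ?_⟩
  · rintro Q' hQ' hQg hne ⟨k, hk⟩
    obtain ⟨q1, q2, q3⟩ := mem_Ps.1 hQ'
    have h9 := q2.natDegree_pos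
    have hk0 : k ≠ 0 := by rintro rfl; omega
    have hk1 : k ≤ m := le_trans (by rw [hk]; exact Nat.le_mul_of_pos_left k h2.natDegree_pos) q3
    refine b1 _ hR P hI k (mem_Icc.2 ⟨by omega, hk1⟩) Q' (mem_Ir.2 ⟨⟨q1, hk⟩, q2⟩) ?_
    exact ((h2.coprime_iff_not_dvd).2 fun h => hne (ir_dvd ⟨h1, h2⟩ ⟨q1, q2⟩ h).symm).mul_dvd hPg hQg
  · exact fun h => b2 _ hR h4 P (mem_filter.2 ⟨hI, Or.inl h⟩) hPg
  · exact fun h => b2 _ hR h4 P (mem_filter.2 ⟨hI, Or.inr h⟩) hPg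

lemma good_ok (hq : 8 ≤ fcd F) (t : ℕ) (ht : 20 ≤ t) (s : ℕ) (hs' : s = 400 * (t + 1)) (hm' : m < 2 ^ s) (hm : (2 ^ (199 * t)) ^ 2 * (2 ^ t) ^ 2 ≤ m) {g : F[X]} (hg : g ∈ Mn F m) (hb : ¬ bad m t g) : MP g ∧ ∃ I, GoodI m g I := by
  have hb' := hb
  unfold bad at hb'
  push Not at hb'
  obtain ⟨b0, bX, -, -, b3, b4⟩ := hb'
  have hg' := mem_Mn.1 hg
  have hL : 0 < 2 ^ (199 * t) := by positivity
  have hm0 : m ≠ 0 := by have : 0 < (2 ^ (199 * t)) ^ 2 * (2 ^ t) ^ 2 := by positivity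
                         omega
  have hsq : Squarefree g := by
    rw [squarefree_iff_irreducible_sq_not_dvd_of_ne_zero hg'.1.ne_zero]
    intro P hP h
    have hl : P.leadingCoeff⁻¹ ≠ 0 := inv_ne_zero (leadingCoeff_ne_zero.2 hP.ne_zero)
    have hu : IsUnit (C P.leadingCoeff⁻¹) := isUnit_C.2 hl.isUnit
    have hm := monic_mul_leadingCoeff_inv hP.ne_zero
    have ha : Associated P (P * C P.leadingCoeff⁻¹) := associated_mul_unit_right _ _ hu
    have hd : (P * C P.leadingCoeff⁻¹) * (P * C P.leadingCoeff⁻¹) ∣ g := ((ha.mul_mul ha).symm.dvd).trans h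
    refine b0 _ (mem_Ps.2 ⟨hm, ha.irreducible hP, ?_⟩) hd
    rw [← hg'.2]
    exact natDegree_le_of_dvd ((dvd_mul_right _ _).trans hd) hg'.1.ne_zero
  haveI : MP g := ⟨hg'.1, by rw [hg'.2]; exact hm0, hsq, bX⟩
  refine ⟨this, ?_⟩
  have ex : ∀ Q p, g ∉ Sq (Tq Q p t) m → ∃ P ∈ Tq Q p t, P ∣ g := fun Q p h => by
    by_contra hc
    push Not at hc
    exact h (mem_filter.2 ⟨hg, hsq, hc⟩)
  obtain ⟨P0, hP0, hP0g⟩ := ex ng 2 b4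
  have h3 : ∀ p, ∃ P, p ∈ (2 * m).primeFactors → P ∈ Tq pos p t ∧ P ∣ g := fun p => by
    by_cases hp : p ∈ (2 * m).primeFactors
    · obtain ⟨P, h⟩ := ex pos p (b3 p hp); exact ⟨P, fun _ => h⟩
    · exact ⟨0, fun h => absurd h hp⟩
  choose f hf using h3
  have hall : ∀ P ∈ insert P0 ((2 * m).primeFactors.image f), ∃ Q p, P ∈ Tq Q p t ∧ P ∣ g := by
    intro P hP
    rw [mem_insert, mem_image] at hP
    rcases hP with rfl | ⟨p, hp, rfl⟩
    · exact ⟨_, _, hP0, hP0g⟩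
    · exact ⟨_, _, hf p hp⟩
  refine ⟨insert P0 ((2 * m).primeFactors.image f), ⟨fun P hP => ?_, ?_, fun p hp hpm => ?_, ?_⟩⟩
  · obtain ⟨Q, p, h1, h2⟩ := hall P hP
    exact tq_ok hq (by omega) hg hb h1 h2
  · exact ⟨P0, mem_insert_self _ _, (mem_Tq (by omega) hP0).2.2.1⟩
  · have hp' : p ∈ (2 * m).primeFactors := Nat.mem_primeFactors.2 ⟨hp, hpm, by omega⟩
    obtain ⟨-, -, h1, h2, h3, -⟩ := mem_Tq (by omega) (hf p hp').1
    exact ⟨f p, mem_insert_of_mem (Finset.mem_image_of_mem f hp'), h1, h2, h3 hp⟩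
  · have h1 := Finset.sum_le_card_nsmul (insert P0 ((2 * m).primeFactors.image f)) natDegree (2 ^ (199 * t)) fun P hP => by
      obtain ⟨Q, p, h1, h2⟩ := hall P hP
      exact (mem_Tq (by omega) h1).2.2.2.2.2.2
    have h2 := (Finset.card_insert_le P0 ((2 * m).primeFactors.image f)).trans (Nat.add_le_add_right (card_image_le.trans (pf_card hm0 hm')) 1)
    have h3 := h1.trans (Nat.mul_le_mul_right _ h2)
    have h4 := num1 t ht
    rw [← hs'] at h4
    generalize ∑ P ∈ insert P0 ((2 * m).primeFactors.image f), P.natDegree = S at h3 ⊢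
    generalize 2 ^ (199 * t) = L at h3 hm hL
    generalize 2 ^ t = T at h4 hm
    calc 41 + 32 * S ^ 2 ≤ 41 + 32 * ((s + 1) * L) ^ 2 := by gcongr
      _ ≤ 81 * ((s + 1) * L) ^ 2 := by
        have : 1 ≤ ((s + 1) * L) ^ 2 := one_le_pow _ _ (by positivity)
        omega
      _ = L ^ 2 * (9 * (s + 1)) ^ 2 := by ring
      _ ≤ L ^ 2 * T ^ 2 := by gcongr
      _ ≤ m := hm

lemma main_count (hq : 8 ≤ fcd F) (t : ℕ) (ht : 20 ≤ t) (s : ℕ) (hs' : s = 400 * (t + 1)) (hm' : m < 2 ^ s) (hm : (2 ^ (199 * t)) ^ 2 * (2 ^ t) ^ 2 ≤ m) :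
    ∃ A : Finset (SpG m F), A.card ≤ 2 ∧ (Nat.card (SpG m F) : ℝ) * (1 - 6 / fcd F - 1612 * (t + 1) / 8 ^ t) ≤ Nat.card {y : SpG m F // ∃ x ∈ A, InvGen x y} := by
  have hL : 0 < 2 ^ (199 * t) := by positivity
  have hT : 3 * t ≤ 2 ^ t := by have := num1 t ht; omega
  have hm3 : 3 * t * 2 ^ (199 * t) ≤ m := by
    refine le_trans ?_ hm
    generalize 2 ^ (199 * t) = L at hL ⊢
    generalize 2 ^ t = T at hT ⊢
    nlinarith [Nat.mul_le_mul hT hL, Nat.mul_le_mul (show 1 ≤ T by omega) hL, Nat.mul_le_mul_left (L * T) (Nat.mul_le_mul (show 1 ≤ T by omega) hL), Nat.mul_le_mul_left L hT]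
  have hm2 : 2 ≤ m := by have := Nat.mul_le_mul_left (3 * t) hL; omega
  obtain ⟨A, hA, hA'⟩ := exA (F := F) hm2
  refine ⟨A, hA, ?_⟩
  have hb := bad_le (F := F) hq t (by omega) hm3 s hs' hm'
  have hq1 : (8 : ℝ) ≤ fcd F := by exact_mod_cast hq
  have hqm := pow_pos (q_pos (F := F)) m
  let ty : F[X] → Finset (SpG m F) := fun g => univ.filter fun y => ∃ _ : MP g, HasType g y
  let G := (Mn F m).filter fun g => ¬ bad m t g
  have hG : ∀ g ∈ G, g ∈ Mn F m ∧ MP g ∧ ∃ I, GoodI m g I := fun g hg => by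
    obtain ⟨h1, h2⟩ := mem_filter.1 hg
    exact ⟨h1, good_ok hq t ht s hs' hm' hm h1 h2⟩
  have h1 : ∑ g ∈ G, (ty g).card ≤ Nat.card {y : SpG m F // ∃ x ∈ A, InvGen x y} := by
    rw [← Finset.card_biUnion, card_eq_fintype_card, card_subtype]
    · refine card_le_card fun y hy => ?_
      obtain ⟨g, hg, hy⟩ := mem_biUnion.1 hy
      obtain ⟨_, hy⟩ := (mem_filter.1 hy).2
      obtain ⟨-, -, I, hI⟩ := hG g hg
      exact mem_filter.2 ⟨mem_univ _, hA' g I hI y hy⟩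
    · intro g hg g' hg' hne
      refine disjoint_left.2 fun y hy hy' => hne ?_
      obtain ⟨_, hy⟩ := (mem_filter.1 hy).2
      obtain ⟨_, hy'⟩ := (mem_filter.1 hy').2
      exact type_unique hy hy' (((mem_Mn.1 (hG g hg).1).2).trans (mem_Mn.1 (hG g' hg').1).2.symm)
  have h2 : ∀ g ∈ G, (Nat.card (SpG m F) : ℝ) * ((fcd F : ℝ) ^ m)⁻¹ * (1 - ∑ P ∈ (Ps F m).filter (· ∣ g), w P) ≤ (ty g).card := fun g hg => by
    obtain ⟨h1, h2, -⟩ := hG g hg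
    refine (type_card g (mem_Mn.1 h1).2).trans ?_
    rw [card_eq_fintype_card, card_subtype]
    exact cast_le.2 (card_le_card fun y hy => mem_filter.2 ⟨mem_univ _, h2, (mem_filter.1 hy).2⟩)
  have h3 := sum_le_sum h2
  rw [← mul_sum, Finset.sum_sub_distrib, sum_const, nsmul_eq_mul, mul_one, ← cast_sum] at h3
  have h4 : ∑ g ∈ G, ∑ P ∈ (Ps F m).filter (· ∣ g), w P ≤ (fcd F : ℝ) ^ m * (1 / ((fcd F : ℝ) - 1)) := by
    calc _ ≤ ∑ g ∈ Mn F m, ∑ P ∈ (Ps F m).filter (· ∣ g), w P := sum_le_sum_of_subset_of_nonneg (filter_subset _ _) fun g _ _ => sum_nonneg fun P _ => w_nn P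
      _ = ∑ P ∈ Ps F m, ((Mn F m).filter (P ∣ ·)).card * w P := by
        simp_rw [sum_filter]
        rw [sum_comm]
        refine sum_congr rfl fun P _ => ?_
        rw [← sum_filter, sum_const, nsmul_eq_mul]
      _ ≤ ∑ P ∈ Ps F m, (fcd F : ℝ) ^ m * (w P * w P) := sum_le_sum fun P hP => by
        rw [← mul_assoc]
        exact mul_le_mul_of_nonneg_right (dvd_count m P (mem_Ps.1 hP).1) (w_nn P)
      _ ≤ _ := by rw [← mul_sum]; exact mul_le_mul_of_nonneg_left sq_sum hqm.le
  have h5 : (G.card : ℝ) = (fcd F : ℝ) ^ m * (1 - cn F m (bad m t)) := by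
    have h := card_filter_add_card_filter_not (s := Mn F m) (bad m t)
    rw [card_Mn] at h
    have h' : ((((Mn F m).filter (bad m t)).card : ℝ) + G.card) = (fcd F : ℝ) ^ m := by
      rw [← Nat.cast_pow, ← h, Nat.cast_add]
    rw [cn, mul_sub, mul_div_cancel₀ _ hqm.ne', ← h']; ring
  have h6 : (fcd F : ℝ) ^ m * (1 - 6 / fcd F - 1612 * (t + 1) / 8 ^ t) ≤ G.card - ∑ g ∈ G, ∑ P ∈ (Ps F m).filter (· ∣ g), w P := by
    rw [h5]
    have h7 : 2 * (1 / ((fcd F : ℝ) - 1)) + 1 / fcd F ≤ 6 / fcd F := by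
      rw [← mul_one_div (6 : ℝ)]
      have : 1 / ((fcd F : ℝ) - 1) ≤ 2 * (1 / fcd F) := by
        rw [mul_one_div, div_le_div_iff₀ (by linarith) (by linarith)]; linarith
      have : 0 < 1 / (fcd F : ℝ) := by apply one_div_pos.2; linarith
      linarith
    nlinarith
  have h7 : (0 : ℝ) ≤ (Nat.card (SpG m F) : ℝ) * ((fcd F : ℝ) ^ m)⁻¹ := mul_nonneg (cast_nonneg _) (inv_nonneg.2 hqm.le)
  have h8 := (mul_le_mul_of_nonneg_left h6 h7).trans (h3.trans (cast_le.2 h1))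
  refine le_trans (le_of_eq ?_) h8
  rw [mul_assoc (Nat.card (SpG m F) : ℝ), inv_mul_cancel_left₀ hqm.ne']

end
end QM

end

theorem stmt_13 :
    ∃ C : ℝ, 0 < C ∧
      ∀ m : ℕ, 1 ≤ m →
        ∀ (F : Type) [Field F] [Fintype F], Even (Fintype.card F) →
          ∃ A : Finset (Matrix.symplecticGroup (Fin m) F),
            A.card ≤ 2 ∧
            (Nat.card {y : Matrix.symplecticGroup (Fin m) F //
                ∃ x ∈ A, InvGen x y} : ℝ) ≥
              (1 - 6 / Fintype.card F - C * (m : ℝ) ^ (-(1 : ℝ) / 200)) *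
                Nat.card (Matrix.symplecticGroup (Fin m) F) := by
  refine ⟨4 ^ 20, by positivity, fun m hm F _ _ hev => ?_⟩
  have triv : (1 - 6 / (Fintype.card F : ℝ) - 4 ^ 20 * (m : ℝ) ^ (-(1 : ℝ) / 200)) ≤ 0 → ∃ A : Finset (Matrix.symplecticGroup (Fin m) F), A.card ≤ 2 ∧
      (Nat.card {y : Matrix.symplecticGroup (Fin m) F // ∃ x ∈ A, InvGen x y} : ℝ) ≥ (1 - 6 / Fintype.card F - 4 ^ 20 * (m : ℝ) ^ (-(1 : ℝ) / 200)) * Nat.card (Matrix.symplecticGroup (Fin m) F) :=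
    fun h => ⟨∅, by simp, (mul_nonpos_of_nonpos_of_nonneg h (Nat.cast_nonneg _)).trans (Nat.cast_nonneg _)⟩
  have hm1 : (1 : ℝ) ≤ m := by exact_mod_cast hm
  have hq0 : (0 : ℝ) < Fintype.card F := by exact_mod_cast Fintype.card_pos
  have hmp : (0 : ℝ) < (m : ℝ) ^ (-(1 : ℝ) / 200) := Real.rpow_pos_of_pos (by linarith) _
  obtain ⟨t, ht1, ht2⟩ : ∃ t : ℕ, 2 ^ (400 * t) ≤ m ∧ m < 2 ^ (400 * (t + 1)) := by
    refine ⟨Nat.log 2 m / 400, (Nat.pow_le_pow_right two_pos (by omega)).trans (Nat.pow_log_le_self 2 (by omega)), (Nat.lt_pow_succ_log_self one_lt_two m).trans_le (Nat.pow_le_pow_right two_pos (by omega))⟩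
  have hmt : ((4 : ℝ) ^ (t + 1))⁻¹ ≤ (m : ℝ) ^ (-(1 : ℝ) / 200) := by
    have h1 : (m : ℝ) ≤ (2 : ℝ) ^ ((400 * (t + 1) : ℕ) : ℝ) := by rw [Real.rpow_natCast]; exact_mod_cast ht2.le
    have h2 := Real.rpow_le_rpow_of_nonpos (by linarith : (0 : ℝ) < m) h1 (by norm_num : -(1 : ℝ) / 200 ≤ 0)
    refine le_trans (le_of_eq ?_) h2
    rw [← Real.rpow_mul (by norm_num), show ((400 * (t + 1) : ℕ) : ℝ) * (-1 / 200) = -((2 * (t + 1) : ℕ) : ℝ) by push_cast; ring, Real.rpow_neg (by norm_num), Real.rpow_natCast, pow_mul]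
    norm_num
  by_cases hq : 8 ≤ Fintype.card F
  swap
  · refine triv ?_
    have : Fintype.card F ≤ 6 := by obtain ⟨r, hr⟩ := hev; omega
    have : (Fintype.card F : ℝ) ≤ 6 := by exact_mod_cast this
    have : 1 ≤ 6 / (Fintype.card F : ℝ) := by rwa [one_le_div hq0]
    have h5 : 0 < 4 ^ 20 * (m : ℝ) ^ (-(1 : ℝ) / 200) := by positivity
    linarith
  by_cases ht : 20 ≤ t
  swap
  · refine triv ?_
    have h1 : (4 : ℝ) ^ (t + 1) ≤ 4 ^ 20 := pow_le_pow_right₀ (by norm_num) (by omega)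
    have h2 : (1 : ℝ) ≤ 4 ^ 20 * ((4 : ℝ) ^ (t + 1))⁻¹ := by rwa [← div_eq_mul_inv, one_le_div (by positivity)]
    have h3 := mul_le_mul_of_nonneg_left hmt (by positivity : (0 : ℝ) ≤ 4 ^ 20)
    have h4 : 0 < 6 / (Fintype.card F : ℝ) := by positivity
    linarith
  haveI : CharP F 2 := by
    have := FiniteField.even_card_iff_char_two.2 (Nat.even_iff.1 hev)
    exact ringChar.of_eq this
  obtain ⟨A, hA, h⟩ := QM.main_count (F := F) (m := m) hq t ht _ rfl ht2 (by
    rw [← pow_mul, ← pow_mul, ← pow_add]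
    convert ht1 using 2
    ring)
  refine ⟨A, hA, le_trans ?_ h⟩
  rw [mul_comm]
  refine mul_le_mul_of_nonneg_left ?_ (Nat.cast_nonneg _)
  have h1 : (1612 : ℝ) * (t + 1) / 8 ^ t ≤ 4 ^ 20 * ((4 : ℝ) ^ (t + 1))⁻¹ := by
    rw [← div_eq_mul_inv, div_le_div_iff₀ (by positivity) (by positivity)]
    have h2 : (t : ℝ) + 1 ≤ 2 ^ t := by exact_mod_cast Nat.lt_two_pow_self (n := t)
    have h3 : (8 : ℝ) ^ t = 2 ^ t * 4 ^ t := by rw [← mul_pow]; norm_num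
    rw [h3, pow_succ (4 : ℝ) t]
    have h4 : (0 : ℝ) < 4 ^ t := by positivity
    have := mul_le_mul_of_nonneg_right h2 h4.le
    have : (0 : ℝ) < 2 ^ t * 4 ^ t := by positivity
    rw [show (4 : ℝ) ^ 20 = 1099511627776 by norm_num]
    generalize (2 : ℝ) ^ t = a at *
    generalize (4 : ℝ) ^ t = b at *
    linarith
  have h3 := mul_le_mul_of_nonneg_left hmt (by positivity : (0 : ℝ) ≤ 4 ^ 20)
  linarith
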